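/- arXiv:0811.3004 — 4 statements merged into one kernel-verified Lean document; each statement's English description precedes it below -/
import Mathlib

section
/- Let F be a characteristic-zero differential field whose field of constants C is algebraically closed, and let F = E_0 ⊆ E_1 ⊆ ⋯ ⊆ E_k be a tower of differential fields, all with field of constants C, such that E_1 = F(y_{1,1},…,y_{1,n_1}) where the y_{1,j} are algebraically independent antiderivatives of F, and for each 2 ≤ i ≤ k, E_i = E_{i−1}(y_{i,1},…,y_{i,n_i}) where y_{i,1},…,y_{i,n_i} are J-I-E antiderivatives of E_{i−1}: y_{i,j}′ = A_{i,j}/(C_{i,j}·B_{i,j}) with A_{i,j},B_{i,j},C_{i,j} pairwise relatively prime polynomials in E_{i−2}[y_{i−1,1},…,y_{i−1,n_{i−1}}] satisfying conditions C1 and C2. Let Λ_k denote the C-linear span of all the elements y_{i,j}, 1 ≤ i ≤ k, 1 ≤ j ≤ n_i. Then every intermediate field K with F ⊆ K ⊆ E_k that is closed under the derivation satisfies K = F(K ∩ Λ_k). -/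
/-- A derivation on a field: an additive map satisfying the Leibniz rule. -/
structure IsDerivation {E : Type*} [Field E] (D : E → E) : Prop where
  map_add : ∀ a b : E, D (a + b) = D a + D b
  leibniz : ∀ a b : E, D (a * b) = D a * b + a * D b

section JIEProof
open Polynomial

/-- `d` restricts to a derivation of the subfield `N`. -/
structure DerOn {U : Type*} [Field U] (d : U → U) (N : Subfield U) : Prop where
  mem : ∀ a ∈ N, d a ∈ N
  add : ∀ a ∈ N, ∀ b ∈ N, d (a + b) = d a + d b
  mul : ∀ a ∈ N, ∀ b ∈ N, d (a * b) = d a * b + a * d b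

namespace DerOn
variable {U : Type*} [Field U] {d : U → U} {N : Subfield U}

theorem zero (h : DerOn d N) : d 0 = 0 := by
  have := h.add 0 N.zero_mem 0 N.zero_mem
  simpa using this

theorem one (h : DerOn d N) : d 1 = 0 := by
  have := h.mul 1 N.one_mem 1 N.one_mem
  simpa using this

theorem neg (h : DerOn d N) {a : U} (ha : a ∈ N) : d (-a) = - d a := by
  have := h.add a ha (-a) (N.neg_mem ha)
  rw [add_neg_cancel, h.zero] at this
  linear_combination -this

theorem sub (h : DerOn d N) {a b : U} (ha : a ∈ N) (hb : b ∈ N) : d (a - b) = d a - d b := by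
  rw [sub_eq_add_neg, h.add a ha _ (N.neg_mem hb), h.neg hb, sub_eq_add_neg]

theorem div (h : DerOn d N) {a b : U} (ha : a ∈ N) (hb : b ∈ N) (hb0 : b ≠ 0) :
    d (a / b) = (d a * b - a * d b) / b ^ 2 := by
  have := h.mul (a / b) (N.div_mem ha hb) b hb
  rw [div_mul_cancel₀ _ hb0] at this
  rw [this]
  field_simp
  ring

theorem inv (h : DerOn d N) {b : U} (hb : b ∈ N) (hb0 : b ≠ 0) :
    d (b⁻¹) = - d b / b ^ 2 := by
  have := h.div N.one_mem hb hb0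
  rw [one_div] at this
  rw [this, h.one]; ring

theorem pow_succ (h : DerOn d N) {a : U} (ha : a ∈ N) (n : ℕ) :
    d (a ^ (n + 1)) = (n + 1) * a ^ n * d a := by
  induction n with
  | zero => simp
  | succ n ih =>
    rw [_root_.pow_succ, h.mul _ (N.pow_mem ha _) _ ha, ih]
    push_cast
    ring

theorem natCast (h : DerOn d N) (n : ℕ) : d (n : U) = 0 := by
  induction n with
  | zero => simpa using h.zero
  | succ n ih => push_cast; rw [h.add _ (natCast_mem N n) _ N.one_mem, ih, h.one, add_zero]

theorem sum (h : DerOn d N) {ι : Type*} (s : Finset ι) (f : ι → U) (hf : ∀ i ∈ s, f i ∈ N) :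
    d (∑ i ∈ s, f i) = ∑ i ∈ s, d (f i) := by
  classical
  induction s using Finset.induction_on with
  | empty => simpa using h.zero
  | insert a s ha ih =>
    rw [Finset.sum_insert ha, Finset.sum_insert ha,
      h.add _ (hf a (Finset.mem_insert_self _ _)) _
        (N.sum_mem fun i hi => hf i (Finset.mem_insert_of_mem hi)),
      ih fun i hi => hf i (Finset.mem_insert_of_mem hi)]

theorem mono (h : DerOn d N) {M : Subfield U} (hM : M ≤ N) (hm : ∀ a ∈ M, d a ∈ M) :
    DerOn d M :=
  ⟨hm, fun a ha b hb => h.add a (hM ha) b (hM hb), fun a ha b hb => h.mul a (hM ha) b (hM hb)⟩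

/-- The elements of `N` on which `d` takes values in a subfield `M` and which lie in `M`. -/
theorem closure_mem (h : DerOn d N) (S : Set U) (hS : S ⊆ N)
    (hd : ∀ a ∈ S, d a ∈ Subfield.closure S) :
    ∀ a ∈ Subfield.closure S, d a ∈ Subfield.closure S := by
  intro a ha
  have key : a ∈ N ∧ d a ∈ Subfield.closure S ∧ a ∈ Subfield.closure S := by
    induction ha using Subfield.closure_induction with
    | mem x hx => exact ⟨hS hx, hd x hx, Subfield.subset_closure hx⟩
    | one => exact ⟨N.one_mem, by rw [h.one]; exact zero_mem _, one_mem _⟩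
    | add x y hx hy ihx ihy =>
      refine ⟨N.add_mem ihx.1 ihy.1, ?_, add_mem ihx.2.2 ihy.2.2⟩
      rw [h.add _ ihx.1 _ ihy.1]; exact add_mem ihx.2.1 ihy.2.1
    | neg x hx ihx =>
      refine ⟨N.neg_mem ihx.1, ?_, neg_mem ihx.2.2⟩
      rw [h.neg ihx.1]; exact neg_mem ihx.2.1
    | inv x hx ihx =>
      refine ⟨N.inv_mem ihx.1, ?_, inv_mem ihx.2.2⟩
      by_cases hx0 : x = 0
      · rw [hx0, inv_zero, h.zero]; exact zero_mem _
      rw [h.inv ihx.1 hx0]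
      exact div_mem (neg_mem ihx.2.1) (pow_mem ihx.2.2 _)
    | mul x y hx hy ihx ihy =>
      refine ⟨N.mul_mem ihx.1 ihy.1, ?_, mul_mem ihx.2.2 ihy.2.2⟩
      rw [h.mul _ ihx.1 _ ihy.1]
      exact add_mem (mul_mem ihx.2.1 ihy.2.2) (mul_mem ihx.2.2 ihy.2.1)
  exact key.2.1

/-- Two derivations agreeing on generators agree on the generated field. -/
theorem ext_closure {d' : U → U} (h : DerOn d N) (h' : DerOn d' N) (S : Set U) (hS : S ⊆ N)
    (hd : ∀ a ∈ S, d a = d' a) : ∀ a ∈ Subfield.closure S, d a = d' a := by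
  intro a ha
  have key : a ∈ N ∧ d a = d' a := by
    induction ha using Subfield.closure_induction with
    | mem x hx => exact ⟨hS hx, hd x hx⟩
    | one => exact ⟨N.one_mem, by rw [h.one, h'.one]⟩
    | add x y hx hy ihx ihy =>
      refine ⟨N.add_mem ihx.1 ihy.1, ?_⟩
      rw [h.add _ ihx.1 _ ihy.1, h'.add _ ihx.1 _ ihy.1, ihx.2, ihy.2]
    | neg x hx ihx =>
      refine ⟨N.neg_mem ihx.1, ?_⟩
      rw [h.neg ihx.1, h'.neg ihx.1, ihx.2]
    | inv x hx ihx =>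
      refine ⟨N.inv_mem ihx.1, ?_⟩
      by_cases hx0 : x = 0
      · rw [hx0, inv_zero, h.zero, h'.zero]
      rw [h.inv ihx.1 hx0, h'.inv ihx.1 hx0, ihx.2]
    | mul x y hx hy ihx ihy =>
      refine ⟨N.mul_mem ihx.1 ihy.1, ?_⟩
      rw [h.mul _ ihx.1 _ ihy.1, h'.mul _ ihx.1 _ ihy.1, ihx.2, ihy.2]
  exact key.2

theorem zero_der (N : Subfield U) : DerOn (fun _ : U => (0 : U)) N :=
  ⟨fun _ _ => N.zero_mem, by simp, by simp⟩

end DerOn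

/-- `N(x)` -/
def Adj {U : Type*} [Field U] (N : Subfield U) (x : U) : Subfield U :=
  Subfield.closure ((N : Set U) ∪ {x})

section Adj
variable {U : Type*} [Field U]

theorem le_Adj (N : Subfield U) (x : U) : N ≤ Adj N x :=
  fun _ h => Subfield.subset_closure (Or.inl h)

theorem self_mem_Adj (N : Subfield U) (x : U) : x ∈ Adj N x :=
  Subfield.subset_closure (Or.inr rfl)

theorem Adj_le {N K : Subfield U} {x : U} (h : N ≤ K) (hx : x ∈ K) : Adj N x ≤ K := by
  refine Subfield.closure_le.mpr ?_
  rintro a (ha | rfl)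
  · exact h ha
  · exact hx

theorem Adj_eq_of_mem {N : Subfield U} {x : U} (hx : x ∈ N) : Adj N x = N :=
  le_antisymm (Adj_le le_rfl hx) (le_Adj N x)

theorem aeval_mem_Adj {N : Subfield U} {x : U} (p : N[X]) : aeval x p ∈ Adj N x := by
  rw [aeval_eq_sum_range]
  refine sum_mem fun i _ => ?_
  rw [Algebra.smul_def]
  exact mul_mem (le_Adj N x (SetLike.coe_mem _)) (pow_mem (self_mem_Adj N x) _)

theorem mem_Adj_iff {N : Subfield U} {x : U} (u : U) :
    u ∈ Adj N x ↔ ∃ r s : N[X], u = aeval x r / aeval x s := by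
  rw [← IntermediateField.mem_adjoin_simple_iff]
  have : Set.range (algebraMap N U) = (N : Set U) := by
    ext a
    exact ⟨fun ⟨b, hb⟩ => hb ▸ b.2, fun h => ⟨⟨a, h⟩, rfl⟩⟩
  rw [← IntermediateField.mem_toSubfield, IntermediateField.adjoin_toSubfield, this, Adj]

theorem aeval_ne_zero {N : Subfield U} {x : U} (hx : Transcendental N x) {p : N[X]} (hp : p ≠ 0) :
    aeval x p ≠ 0 := fun h => hp (transcendental_iff.mp hx p h)

theorem aeval_inj {N : Subfield U} {x : U} (hx : Transcendental N x) {p q : N[X]}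
    (h : aeval x p = aeval x q) : p = q :=
  transcendental_iff_injective.mp hx h

/-- coprime representation -/
theorem mem_Adj_coprime {N : Subfield U} {x : U} (hx : Transcendental N x) {u : U}
    (hu : u ∈ Adj N x) :
    ∃ r s : N[X], IsCoprime r s ∧ s ≠ 0 ∧ u = aeval x r / aeval x s := by
  classical
  obtain ⟨r, s, rfl⟩ := (mem_Adj_iff u).mp hu
  by_cases hs : s = 0
  · exact ⟨0, 1, isCoprime_one_right, one_ne_zero, by simp [hs]⟩
  obtain ⟨r', s', h1, h2, hc⟩ := extract_gcd r s
  have hg : gcd r s ≠ 0 := by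
    intro h; exact hs (by rw [h2, h, zero_mul])
  have hs' : s' ≠ 0 := by
    rintro rfl; exact hs (by rw [h2, mul_zero])
  refine ⟨r', s', (gcd_isUnit_iff r' s').mp hc, hs', ?_⟩
  have hg' : aeval x (gcd r s) ≠ 0 := aeval_ne_zero hx hg
  have e1 := congrArg (aeval x) h1
  have e2 := congrArg (aeval x) h2
  rw [map_mul] at e1 e2
  rw [e1, e2, mul_div_mul_left _ _ hg']

end Adj

/-- `x` is transcendental over `N`, and `d` is a derivation of `N(x)` with `d N ⊆ N`, `d x ∈ N`. -/
structure DExt {U : Type*} [Field U] (d : U → U) (N : Subfield U) (x : U) : Prop where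
  hN : DerOn d N
  hE : DerOn d (Adj N x)
  hx : d x ∈ N
  tr : Transcendental N x

namespace DExt
variable {U : Type*} [Field U] {d : U → U} {N : Subfield U} {x : U}

theorem of_big {E : Subfield U} (hE : DerOn d E) (hNE : N ≤ E) (hxE : x ∈ E)
    (hN : ∀ a ∈ N, d a ∈ N) (hx : d x ∈ N) (tr : Transcendental N x) : DExt d N x := by
  refine ⟨hE.mono hNE hN, hE.mono (Adj_le hNE hxE) ?_, hx, tr⟩
  refine hE.closure_mem _ ?_ ?_
  · rintro a (ha | rfl)
    · exact hNE ha
    · exact hxE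
  · rintro a (ha | rfl)
    · exact le_Adj N x (hN a ha)
    · exact le_Adj N _ hx

theorem exists_pD_aux (hN : DerOn d N) (hE : DerOn d (Adj N x)) (hx : d x ∈ N) (p : N[X]) : ∃ q : N[X], aeval x q = d (aeval x p) ∧
    ∀ i, (q.coeff i : U) = d (p.coeff i) + (i + 1) * p.coeff (i + 1) * d x := by
  induction p using Polynomial.induction_on' with
  | add p q hp hq =>
    obtain ⟨p1, h1, h2⟩ := hp
    obtain ⟨q1, h3, h4⟩ := hq
    refine ⟨p1 + q1, ?_, fun i => ?_⟩
    · rw [map_add, map_add, hE.add _ (aeval_mem_Adj p) _ (aeval_mem_Adj q), h1, h3]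
    · simp only [coeff_add, Subfield.coe_add]
      rw [h2, h4, hN.add _ (SetLike.coe_mem _) _ (SetLike.coe_mem _)]
      ring
  | monomial n a =>
    refine ⟨monomial n ⟨d a, hN.mem a a.2⟩ + C ⟨d x, hx⟩ * derivative (monomial n a), ?_, ?_⟩
    · have hxm := self_mem_Adj N x
      have ham := le_Adj N x a.2
      rcases n with _ | n
      · simp [Algebra.algebraMap_eq_smul_one]
        simp [Subfield.smul_def]
      · simp only [map_add, map_mul, aeval_monomial, derivative_monomial, aeval_C]
        have e1 : ∀ b : N, algebraMap N U b = (b : U) := fun _ => rfl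
        simp only [e1]
        rw [hE.mul _ ham _ (pow_mem hxm _), hE.pow_succ hxm]
        push_cast
        simp
        ring
    · intro i
      simp only [coeff_add, coeff_C_mul, coeff_derivative, coeff_monomial]
      push_cast
      by_cases h1 : n = i
      · subst h1
        simp
      · by_cases h2 : n = i + 1
        · subst h2
          simp [hN.zero]
          ring
        · simp [h1, h2, hN.zero]

theorem exists_pD (h : DExt d N x) (p : N[X]) : ∃ q : N[X], aeval x q = d (aeval x p) ∧
    ∀ i, (q.coeff i : U) = d (p.coeff i) + (i + 1) * p.coeff (i + 1) * d x :=
  exists_pD_aux h.hN h.hE h.hx p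

/-- the derivation induced by `d` on `N[X]` -/
noncomputable def pD (h : DExt d N x) (p : N[X]) : N[X] := (h.exists_pD p).choose

theorem aeval_pD (h : DExt d N x) (p : N[X]) : aeval x (h.pD p) = d (aeval x p) :=
  (h.exists_pD p).choose_spec.1

theorem coeff_pD (h : DExt d N x) (p : N[X]) (i : ℕ) :
    ((h.pD p).coeff i : U) = d (p.coeff i) + (i + 1) * p.coeff (i + 1) * d x :=
  (h.exists_pD p).choose_spec.2 i

theorem pD_mul (h : DExt d N x) (p q : N[X]) : h.pD (p * q) = h.pD p * q + p * h.pD q := by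
  apply aeval_inj h.tr
  simp only [map_add, map_mul, aeval_pD]
  exact h.hE.mul _ (aeval_mem_Adj p) _ (aeval_mem_Adj q)

theorem natDegree_pD_le (h : DExt d N x) (p : N[X]) : (h.pD p).natDegree ≤ p.natDegree := by
  rw [natDegree_le_iff_coeff_eq_zero]
  intro i hi
  have := h.coeff_pD p i
  rw [coeff_eq_zero_of_natDegree_lt hi, coeff_eq_zero_of_natDegree_lt (by omega : _ < i + 1)] at this
  simpa [h.hN.zero] using this

theorem degree_pD_lt (h : DExt d N x) {p : N[X]} (hp : p.Monic) : (h.pD p).degree < p.degree := by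
  rw [degree_eq_natDegree hp.ne_zero, degree_lt_iff_coeff_zero]
  intro i hi
  have := h.coeff_pD p i
  rw [coeff_eq_zero_of_natDegree_lt (by omega : _ < i + 1)] at this
  have h2 : d (p.coeff i) = 0 := by
    rcases eq_or_lt_of_le hi with h1 | h1
    · rw [← h1, hp.coeff_natDegree]
      simpa using h.hN.one
    · rw [coeff_eq_zero_of_natDegree_lt h1]
      simpa using h.hN.zero
  rw [h2] at this
  simpa using this

theorem not_dvd_pD (h : DExt d N x) {p : N[X]} (hp : p.Monic) (h0 : d (aeval x p) ≠ 0) :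
    ¬ p ∣ h.pD p := by
  intro hd
  have := eq_zero_of_dvd_of_degree_lt hd (h.degree_pD_lt hp)
  have h2 := h.aeval_pD p
  rw [this, map_zero] at h2
  exact h0 h2.symm

end DExt

section Loc
variable {U : Type*} [Field U] {d : U → U} {N : Subfield U} {x : U}

/-- localization of `N[x]` at the prime `p` -/
def Loc (tr : Transcendental N x) {p : N[X]} (hp : Prime p) : Subring U where
  carrier := {u | ∃ a b : N[X], ¬ p ∣ b ∧ u = aeval x a / aeval x b}
  zero_mem' := ⟨0, 1, fun h => hp.not_isUnit (isUnit_of_dvd_one h), by simp⟩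
  one_mem' := ⟨1, 1, fun h => hp.not_isUnit (isUnit_of_dvd_one h), by simp⟩
  add_mem' := by
    rintro _ _ ⟨a, b, hb, rfl⟩ ⟨a', b', hb', rfl⟩
    refine ⟨a * b' + b * a', b * b', fun h => (hp.dvd_or_dvd h).elim hb hb', ?_⟩
    have h1 := aeval_ne_zero tr (p := b) (by rintro rfl; exact hb (dvd_zero _))
    have h2 := aeval_ne_zero tr (p := b') (by rintro rfl; exact hb' (dvd_zero _))
    simp only [map_add, map_mul]
    rw [div_add_div _ _ h1 h2]
  mul_mem' := by
    rintro _ _ ⟨a, b, hb, rfl⟩ ⟨a', b', hb', rfl⟩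
    refine ⟨a * a', b * b', fun h => (hp.dvd_or_dvd h).elim hb hb', ?_⟩
    simp only [map_mul]
    rw [div_mul_div_comm]
  neg_mem' := by
    rintro _ ⟨a, b, hb, rfl⟩
    exact ⟨-a, b, hb, by rw [map_neg, neg_div]⟩

variable {tr : Transcendental N x} {p : N[X]} {hp : Prime p}

theorem mem_Loc {u : U} : u ∈ Loc tr hp ↔ ∃ a b : N[X], ¬ p ∣ b ∧ u = aeval x a / aeval x b :=
  Iff.rfl

theorem aeval_mem_Loc (a : N[X]) : aeval x a ∈ Loc tr hp :=
  ⟨a, 1, fun h => hp.not_isUnit (isUnit_of_dvd_one h), by simp⟩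

theorem base_mem_Loc {a : U} (ha : a ∈ N) : a ∈ Loc tr hp := by
  have := aeval_mem_Loc (tr := tr) (hp := hp) (Polynomial.C (⟨a, ha⟩ : N))
  rwa [aeval_C] at this

theorem inv_mem_Loc {b : N[X]} (hb : ¬ p ∣ b) : (aeval x b)⁻¹ ∈ Loc tr hp :=
  ⟨1, b, hb, by simp⟩

theorem Loc_le {u : U} (hu : u ∈ Loc tr hp) : u ∈ Adj N x := by
  obtain ⟨a, b, -, rfl⟩ := hu
  exact div_mem (aeval_mem_Adj a) (aeval_mem_Adj b)

theorem der_mem_Loc (h : DExt d N x) {u : U} (hu : u ∈ Loc tr hp) : d u ∈ Loc tr hp := by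
  obtain ⟨a, b, hb, rfl⟩ := hu
  have h1 := aeval_ne_zero tr (p := b) (by rintro rfl; exact hb (dvd_zero _))
  refine ⟨h.pD a * b - a * h.pD b, b ^ 2, fun h => hb (hp.dvd_of_dvd_pow h), ?_⟩
  rw [h.hE.div (aeval_mem_Adj a) (aeval_mem_Adj b) h1]
  simp only [map_sub, map_mul, map_pow, h.aeval_pD]

theorem notMem_Loc {a b : N[X]} (ha : ¬ p ∣ a) (hb : ¬ p ∣ b) {e : ℕ} (he : 1 ≤ e) :
    aeval x a / (aeval x p ^ e * aeval x b) ∉ Loc tr hp := by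
  rintro ⟨a', b', hb', h⟩
  have h1 := aeval_ne_zero tr (p := b) (by rintro rfl; exact hb (dvd_zero _))
  have h2 := aeval_ne_zero tr (p := b') (by rintro rfl; exact hb' (dvd_zero _))
  have h3 := aeval_ne_zero tr hp.ne_zero
  rw [div_eq_div_iff (mul_ne_zero (pow_ne_zero _ h3) h1) h2] at h
  have : a * b' = a' * (p ^ e * b) := by
    apply aeval_inj tr
    simpa only [map_mul, map_pow] using h
  have hd : p ∣ a * b' := by
    rw [this]
    exact dvd_mul_of_dvd_right (dvd_mul_of_dvd_left (dvd_pow_self p (by omega)) _) _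
  exact (hp.dvd_or_dvd hd).elim ha hb'

theorem pole_repr {u : U} (hu : u ∈ Adj N x) (hu' : u ∉ Loc tr hp) :
    ∃ (e : ℕ) (a b : N[X]), 1 ≤ e ∧ ¬ p ∣ a ∧ ¬ p ∣ b ∧
      u = aeval x a / (aeval x p ^ e * aeval x b) := by
  obtain ⟨r, s, hc, hs, rfl⟩ := mem_Adj_coprime tr hu
  have hfin : FiniteMultiplicity p s := FiniteMultiplicity.of_prime_left hp hs
  obtain ⟨b, hb, hnb⟩ := hfin.exists_eq_pow_mul_and_not_dvd
  have hps : p ∣ s := by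
    by_contra h
    exact hu' ⟨r, s, h, rfl⟩
  refine ⟨multiplicity p s, r, b, ?_, ?_, hnb, ?_⟩
  · rw [Nat.one_le_iff_ne_zero]
    intro h0
    rw [h0, pow_zero, one_mul] at hb
    exact hnb (hb ▸ hps)
  · intro h
    exact hp.not_isUnit (hc.isUnit_of_dvd' h hps)
  · conv_lhs => rw [hb]
    rw [map_mul, map_pow]

/-- the pole lemma -/
theorem pole_lemma [CharZero U] (h : DExt d N x) (hpd : ¬ p ∣ h.pD p) {u : U} (hu : u ∈ Adj N x)
    (hu' : u ∉ Loc tr hp) : ∃ e : ℕ, 1 ≤ e ∧ aeval x p ^ e * u ∈ Loc tr hp ∧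
      aeval x p ^ e * d u ∉ Loc tr hp := by
  obtain ⟨e, a, b, he, ha, hb, hue⟩ := pole_repr hu hu'
  have h1 := aeval_ne_zero tr (p := b) (by rintro rfl; exact hb (dvd_zero _))
  have h3 := aeval_ne_zero tr hp.ne_zero
  have hw : aeval x p ^ e * u = aeval x a / aeval x b := by
    rw [hue]; field_simp
  have hwm : aeval x p ^ e * u ∈ Loc tr hp := ⟨a, b, hb, hw⟩
  refine ⟨e, he, hwm, fun hcon => ?_⟩
  have hdw := der_mem_Loc h hwm
  obtain ⟨e, rfl⟩ : ∃ e', e = e' + 1 := ⟨e - 1, by omega⟩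
  have hpm := aeval_mem_Adj (x := x) p
  rw [h.hE.mul _ (pow_mem hpm _) _ hu, h.hE.pow_succ hpm] at hdw
  have h4 := sub_mem hdw hcon
  have h5 : ¬ p ∣ Polynomial.C ((e + 1 : ℕ) : N) * h.pD p * a := by
    intro hd
    rcases hp.dvd_or_dvd hd with hd | hd
    · rcases hp.dvd_or_dvd hd with hd | hd
      · refine hp.not_isUnit (isUnit_of_dvd_unit hd ?_)
        rw [isUnit_C]
        exact (Nat.cast_ne_zero.mpr (Nat.succ_ne_zero e)).isUnit
      · exact hpd hd
    · exact ha hd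
  refine notMem_Loc (tr := tr) (hp := hp) h5 hb le_rfl ?_
  convert h4 using 1
  simp only [map_mul, aeval_C, h.aeval_pD, map_natCast]
  rw [hue]
  push_cast
  field_simp
  ring

theorem pole_one [CharZero U] (h : DExt d N x) (hpd : ¬ p ∣ h.pD p) {u : U} (hu : u ∈ Adj N x)
    (hd : aeval x p * d u ∈ Loc tr hp) : u ∈ Loc tr hp := by
  by_contra hu'
  obtain ⟨e, he, -, h2⟩ := pole_lemma h hpd hu hu'
  obtain ⟨e, rfl⟩ : ∃ e', e = e' + 1 := ⟨e - 1, by omega⟩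
  apply h2
  rw [pow_succ, mul_assoc]
  exact mul_mem (pow_mem (aeval_mem_Loc p) _) hd

theorem pole_two [CharZero U] (h : DExt d N x) (hpd : ¬ p ∣ h.pD p) {u : U} (hu : u ∈ Adj N x)
    (hd : aeval x p ^ 2 * d u ∈ Loc tr hp) : aeval x p * u ∈ Loc tr hp := by
  by_cases hu' : u ∈ Loc tr hp
  · exact mul_mem (aeval_mem_Loc p) hu'
  obtain ⟨e, he, h1, h2⟩ := pole_lemma h hpd hu hu'
  obtain ⟨e, rfl⟩ : ∃ e', e = e' + 1 := ⟨e - 1, by omega⟩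
  rcases e with _ | e
  · simpa using h1
  · exfalso
    apply h2
    have : aeval x p ^ (e + 1 + 1) * d u = aeval x p ^ e * (aeval x p ^ 2 * d u) := by ring
    rw [this]
    exact mul_mem (pow_mem (aeval_mem_Loc p) _) hd

theorem simple_pole {f : U} (hf : f ∈ N) (h : f / aeval x p ∈ Loc tr hp) : f = 0 := by
  by_contra hf0
  have h5 : ¬ p ∣ Polynomial.C (⟨f, hf⟩ : N) := by
    intro hd
    refine hp.not_isUnit (isUnit_of_dvd_unit hd ?_)
    rw [isUnit_C]
    exact IsUnit.mk0 _ (fun h => hf0 (congrArg Subtype.val h))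
  refine notMem_Loc (tr := tr) (hp := hp) h5 (fun h => hp.not_isUnit (isUnit_of_dvd_one h)) le_rfl ?_
  convert h using 1
  simp [aeval_C]
  rfl

end Loc

section AntiDer
variable {U : Type*} [Field U] [CharZero U] {D : U → U}

theorem adj_der (hD : DerOn D ⊤) {N : Subfield U} {x : U} (hN : ∀ a ∈ N, D a ∈ N)
    (hx : D x ∈ N) : ∀ a ∈ Adj N x, D a ∈ Adj N x := by
  refine hD.closure_mem _ (fun _ _ => trivial) ?_
  rintro a (ha | rfl)
  · exact le_Adj N x (hN a ha)
  · exact le_Adj N _ hx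

/-- an antiderivative not in `N` is transcendental -/
theorem antider_transcendental (hD : DerOn D ⊤) {N : Subfield U} {x : U} (hN : ∀ a ∈ N, D a ∈ N)
    (hc : ∀ a, D a = 0 → a ∈ N) (hx : D x ∈ N) (hxN : x ∉ N) : Transcendental N x := by
  intro halg
  have hxint : IsIntegral N x := halg.isIntegral
  have hmon := minpoly.monic hxint
  obtain ⟨q, hq1, hq2⟩ := DExt.exists_pD_aux (hD.mono le_top hN)
    (hD.mono le_top (adj_der hD hN hx)) hx (minpoly N x)
  rw [minpoly.aeval, hD.zero] at hq1
  have hdeg : q.degree < (minpoly N x).degree := by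
    rw [degree_eq_natDegree hmon.ne_zero, degree_lt_iff_coeff_zero]
    intro i hi
    have := hq2 i
    rw [coeff_eq_zero_of_natDegree_lt (by omega : _ < i + 1)] at this
    have h2 : D ((minpoly N x).coeff i) = 0 := by
      rcases eq_or_lt_of_le hi with h1 | h1
      · rw [← h1, hmon.coeff_natDegree]
        simpa using hD.one
      · rw [coeff_eq_zero_of_natDegree_lt h1]
        simpa using hD.zero
    rw [h2] at this
    simpa using this
  have hq0 : q = 0 := by
    by_contra h0
    have := minpoly.degree_le_of_ne_zero N x h0 hq1
    exact absurd hdeg (not_lt.mpr this)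
  have hpos := minpoly.natDegree_pos hxint
  obtain ⟨n, hn⟩ : ∃ n, (minpoly N x).natDegree = n + 1 := ⟨_, (Nat.succ_pred_eq_of_pos hpos).symm⟩
  have h1 := hq2 n
  have h2 : (minpoly N x).coeff (n + 1) = 1 := by rw [← hn]; exact hmon.coeff_natDegree
  rw [hq0, h2] at h1
  simp only [coeff_zero, ZeroMemClass.coe_zero, OneMemClass.coe_one, mul_one] at h1
  set b : U := ((minpoly N x).coeff n : U) with hb
  have hbN : b ∈ N := SetLike.coe_mem _
  have hnN : ((n + 1 : ℕ) : U) ∈ N := natCast_mem N _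
  have h3 : D (b + ((n + 1 : ℕ) : U) * x) = 0 := by
    rw [hD.add _ trivial _ trivial, hD.mul _ trivial _ trivial, hD.natCast]
    push_cast
    linear_combination -h1
  have h4 := N.sub_mem (hc _ h3) hbN
  rw [add_sub_cancel_left] at h4
  have h5 : ((n + 1 : ℕ) : U) ≠ 0 := Nat.cast_ne_zero.mpr (Nat.succ_ne_zero n)
  have h6 := N.div_mem h4 hnN
  rw [mul_div_cancel_left₀ _ h5] at h6
  exact hxN h6

theorem mk_dext (hD : DerOn D ⊤) {N : Subfield U} {x : U} (hN : ∀ a ∈ N, D a ∈ N)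
    (hc : ∀ a, D a = 0 → a ∈ N) (hx : D x ∈ N) (hxN : x ∉ N) : DExt D N x :=
  DExt.of_big hD le_top trivial hN hx (antider_transcendental hD hN hc hx hxN)

theorem aeval_notMem {N : Subfield U} {x : U} (tr : Transcendental N x) {p : N[X]}
    (hp : 0 < p.natDegree) : aeval x p ∉ N := by
  intro h
  have : p = C ⟨aeval x p, h⟩ := by
    apply aeval_inj tr
    rw [aeval_C]; rfl
  rw [this, natDegree_C] at hp
  exact lt_irrefl _ hp

theorem DExt.not_dvd_irred {d : U → U} {N : Subfield U} {x : U} (h : DExt d N x)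
    (hc : ∀ a, d a = 0 → a ∈ N) {p : N[X]} (hm : p.Monic) (hp : Irreducible p) :
    ¬ p ∣ h.pD p :=
  h.not_dvd_pD hm fun h0 => aeval_notMem h.tr hp.natDegree_pos (hc _ h0)

theorem coprime_notMem_Loc {N : Subfield U} {x : U} (tr : Transcendental N x) {p : N[X]}
    (hp : Prime p) {r s : N[X]} (hc : IsCoprime r s) (hs : s ≠ 0) (hps : p ∣ s) :
    aeval x r / aeval x s ∉ Loc tr hp := by
  rintro ⟨a, b, hb, h⟩
  have h1 := aeval_ne_zero tr (p := b) (by rintro rfl; exact hb (dvd_zero _))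
  rw [div_eq_div_iff (aeval_ne_zero tr hs) h1] at h
  have h2 : r * b = a * s := by
    apply aeval_inj tr
    simpa only [map_mul] using h
  have : p ∣ r * b := by rw [h2]; exact dvd_mul_of_dvd_right hps _
  rcases hp.dvd_or_dvd this with h3 | h3
  · exact hp.not_isUnit (hc.isUnit_of_dvd' h3 hps)
  · exact hb h3

/-- Ostrowski, one antiderivative -/
theorem ostrowski_one (hD : DerOn D ⊤) {N : Subfield U} {x : U} (hN : ∀ a ∈ N, D a ∈ N)
    (hc : ∀ a, D a = 0 → a ∈ N) (hx : D x ∈ N) {a : U} (ha : a ∈ Adj N x) (hDa : D a ∈ N) :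
    ∃ c, D c = 0 ∧ a - c * x ∈ N := by
  by_cases hxN : x ∈ N
  · rw [Adj_eq_of_mem hxN] at ha
    exact ⟨0, hD.zero, by simpa using ha⟩
  have h := mk_dext hD hN hc hx hxN
  obtain ⟨r, s, hco, hs, hrs⟩ := mem_Adj_coprime h.tr ha
  have hsu : IsUnit s := by
    by_contra hsu
    obtain ⟨p, hm, hp, hps⟩ := exists_monic_irreducible_factor s hsu
    refine coprime_notMem_Loc h.tr hp.prime hco hs hps ?_
    rw [← hrs]
    refine pole_one h (h.not_dvd_irred hc hm hp) ha ?_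
    exact mul_mem (aeval_mem_Loc p) (base_mem_Loc hDa)
  obtain ⟨s0, hs0, rfl⟩ := isUnit_iff.mp hsu
  have hs0' : s0 ≠ 0 := hs0.ne_zero
  obtain ⟨P, hP⟩ : ∃ P : N[X], a = aeval x P := by
    refine ⟨r * C s0⁻¹, ?_⟩
    rw [hrs, map_mul, aeval_C, aeval_C, map_inv₀, div_eq_mul_inv]
  have h1 : h.pD P = C ⟨D a, hDa⟩ := by
    apply aeval_inj h.tr
    rw [h.aeval_pD, ← hP, aeval_C]; rfl
  rcases hn : P.natDegree with _ | n
  · rw [eq_C_of_natDegree_eq_zero hn, aeval_C] at hP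
    refine ⟨0, hD.zero, ?_⟩
    rw [hP, zero_mul, sub_zero]
    exact SetLike.coe_mem _
  · have e1 := h.coeff_pD P (n + 1)
    rw [h1, coeff_C_succ, coeff_eq_zero_of_natDegree_lt (by omega : _ < n + 1 + 1)] at e1
    simp only [ZeroMemClass.coe_zero, mul_zero, zero_mul, add_zero] at e1
    rcases n with _ | n
    · refine ⟨P.coeff 1, e1.symm, ?_⟩
      rw [eq_X_add_C_of_natDegree_le_one hn.le] at hP
      simp only [map_add, map_mul, aeval_C, aeval_X] at hP
      rw [hP]
      have : (algebraMap N U) (P.coeff 1) = (P.coeff 1 : U) := rfl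
      rw [this, add_sub_cancel_left]
      exact SetLike.coe_mem _
    · exfalso
      have e2 := h.coeff_pD P (n + 1)
      rw [h1, coeff_C_succ] at e2
      set b : U := (P.coeff (n + 1) : U) with hb
      set c : U := (P.coeff (n + 1 + 1) : U) with hcdef
      have hbN : b ∈ N := SetLike.coe_mem _
      have hcN : c ∈ N := SetLike.coe_mem _
      have hc0 : c ≠ 0 := by
        intro h0
        have : P.coeff (n + 1 + 1) = 0 := Subtype.ext h0
        rw [← hn, coeff_natDegree, leadingCoeff_eq_zero] at this
        rw [this, natDegree_zero] at hn
        omega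
      have hnN : ((n + 2 : ℕ) : U) ∈ N := natCast_mem N _
      have h3 : D (b + ((n + 2 : ℕ) : U) * (c * x)) = 0 := by
        rw [hD.add _ trivial _ trivial, hD.mul _ trivial _ trivial, hD.natCast,
          hD.mul _ trivial _ trivial, ← e1]
        push_cast at e2 ⊢
        linear_combination -e2
      have h4 := N.sub_mem (hc _ h3) hbN
      rw [add_sub_cancel_left] at h4
      have h5 : ((n + 2 : ℕ) : U) ≠ 0 := Nat.cast_ne_zero.mpr (Nat.succ_ne_zero _)
      have h6 := N.div_mem (N.div_mem h4 hnN) hcN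
      rw [mul_div_cancel_left₀ _ h5, mul_div_cancel_left₀ _ hc0] at h6
      exact hxN h6

/-- Ostrowski, finitely many antiderivatives -/
theorem ostrowski (hD : DerOn D ⊤) {N : Subfield U} {ι : Type*} (hN : ∀ a ∈ N, D a ∈ N)
    (hc : ∀ a, D a = 0 → a ∈ N) (f : ι → U) (hf : ∀ i, D (f i) ∈ N) (s : Finset ι) (a : U)
    (ha : a ∈ Subfield.closure ((N : Set U) ∪ f '' s)) (hDa : D a ∈ N) :
    ∃ c : ι → U, (∀ i, D (c i) = 0) ∧ a - ∑ i ∈ s, c i * f i ∈ N := by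
  classical
  induction s using Finset.induction_on generalizing a with
  | empty =>
    refine ⟨fun _ => 0, fun _ => hD.zero, ?_⟩
    simpa [Subfield.closure_eq] using ha
  | insert i0 s hi0 ih =>
    set N' := Subfield.closure ((N : Set U) ∪ f '' s) with hN'
    have hNN' : N ≤ N' := fun _ h => Subfield.subset_closure (Or.inl h)
    have hN'D : ∀ a ∈ N', D a ∈ N' := by
      refine hD.closure_mem _ (fun _ _ => trivial) ?_
      rintro a (ha | ⟨i, -, rfl⟩)
      · exact hNN' (hN a ha)
      · exact hNN' (hf i)
    have ha' : a ∈ Adj N' (f i0) := by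
      refine (Subfield.closure_le.mpr ?_ : Subfield.closure _ ≤ Adj N' (f i0)) ha
      rintro b (hb | ⟨i, hi, rfl⟩)
      · exact le_Adj _ _ (hNN' hb)
      · rw [Finset.coe_insert] at hi
        rcases hi with rfl | hi
        · exact self_mem_Adj _ _
        · exact le_Adj _ _ (Subfield.subset_closure (Or.inr ⟨i, hi, rfl⟩))
    obtain ⟨c0, hc0, h0⟩ := ostrowski_one hD hN'D (fun a h => hNN' (hc a h)) (hNN' (hf i0)) ha'
      (hNN' hDa)
    obtain ⟨c, hc1, hc2⟩ := ih (a - c0 * f i0) h0 (by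
      rw [hD.sub trivial trivial, hD.mul _ trivial _ trivial, hc0, zero_mul, zero_add]
      exact N.sub_mem hDa (N.mul_mem (hc _ hc0) (hf i0)))
    refine ⟨Function.update c i0 c0, fun i => ?_, ?_⟩
    · by_cases hi : i = i0
      · subst hi; simpa using hc0
      · simpa [hi] using hc1 i
    · rw [Finset.sum_insert hi0, Function.update_self]
      have : ∑ i ∈ s, Function.update c i0 c0 i * f i = ∑ i ∈ s, c i * f i := by
        refine Finset.sum_congr rfl fun i hi => ?_
        rw [Function.update_of_ne (by rintro rfl; exact hi0 hi)]
      rw [this, ← sub_sub]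
      exact hc2

theorem dvd_pow_of_primes {K : Type*} [Field K] {Q S : K[X]} (hQ : Q ≠ 0)
    (h : ∀ p : K[X], p.Monic → Irreducible p → p ∣ Q → p ∣ S) : ∃ n : ℕ, Q ∣ S ^ n := by
  have h' : ∀ p : K[X], Prime p → p ∣ Q → p ∣ S := by
    intro p hp hpQ
    obtain ⟨q, hm, hq, hqp⟩ := exists_monic_irreducible_factor p hp.not_isUnit
    have := hp.irreducible.dvd_symm hq
    exact ((hq.dvd_symm hp.irreducible hqp).trans (h q hm hq (hqp.trans hpQ)))
  clear h
  induction Q using UniqueFactorizationMonoid.induction_on_prime with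
  | h₁ => exact absurd rfl hQ
  | h₂ x hx => exact ⟨0, hx.dvd⟩
  | h₃ a p ha hp ih =>
    obtain ⟨n, hn⟩ := ih ha fun q hq hqa => h' q hq (dvd_mul_of_dvd_right hqa _)
    exact ⟨n + 1, by rw [pow_succ, mul_comm p]; exact mul_dvd_mul hn (h' p hp (dvd_mul_right _ _))⟩

end AntiDer

section
variable {U : Type*} [Field U] [CharZero U] {D : U → U}

theorem aeval_map_incl {M K : Subfield U} (hMK : M ≤ K) (x : U) (p : M[X]) :
    aeval x (p.map (Subfield.inclusion hMK)) = aeval x p := by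
  rw [aeval_def, eval₂_map, aeval_def]
  rfl

/-- a polynomial over `K` with value in `M(x)` has coefficients in `M` -/
theorem coeff_mem_of_aeval_mem {M K : Subfield U} (hMK : M ≤ K) {x : U} (tr : Transcendental K x)
    (trM : Transcendental M x) {T : K[X]} (hT : aeval x T ∈ Adj M x) (i : ℕ) :
    (T.coeff i : U) ∈ M := by
  obtain ⟨r, s, -, hs, hrs⟩ := mem_Adj_coprime trM hT
  have hs' := aeval_ne_zero trM hs
  have h1 : r.map (Subfield.inclusion hMK) = s.map (Subfield.inclusion hMK) * T := by
    apply aeval_inj tr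
    rw [map_mul, aeval_map_incl, aeval_map_incl, hrs]
    field_simp
  have h2 : s ∣ r := by
    rw [← Polynomial.map_dvd_map' (Subfield.inclusion hMK), h1]
    exact dvd_mul_right _ _
  obtain ⟨t, rfl⟩ := h2
  have h3 : T = t.map (Subfield.inclusion hMK) := by
    apply aeval_inj tr
    rw [aeval_map_incl, hrs, map_mul, mul_div_cancel_left₀ _ hs']
  rw [h3, coeff_map]
  exact SetLike.coe_mem _

theorem closed_step_aux {M K : Subfield U} (hMK : M ≤ K)
    {x : U} (hdM : DExt D M x) (hdK : DExt D K x)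
    (hcl : ∀ a ∈ K, D a ∈ M → a ∈ M) {S : M[X]} (hS : S.Monic) (n : ℕ) :
    ∀ P : K[X], (∀ i, n ≤ i → P.coeff i = 0) → D (aeval x P / aeval x S) ∈ Adj M x →
      aeval x P / aeval x S ∈ Adj M x := by
  have hS0 := aeval_ne_zero hdM.tr hS.ne_zero
  have hle : Adj M x ≤ Adj K x := Adj_le (hMK.trans (le_Adj K x)) (self_mem_Adj K x)
  induction n with
  | zero =>
    intro P hP _
    have : P = 0 := by ext i; simp [hP i (Nat.zero_le i)]
    rw [this]; simp
  | succ n ih =>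
    intro P hP hDP
    set S' := S.map (Subfield.inclusion hMK) with hS'
    have hS'm : S'.Monic := hS.map _
    have eS : aeval x S' = aeval x S := aeval_map_incl hMK x S
    have hSm := aeval_mem_Adj (x := x) S
    have hPm := aeval_mem_Adj (x := x) P
    have hT : aeval x (hdK.pD P * S' - P * hdK.pD S') ∈ Adj M x := by
      rw [hdK.hE.div hPm (hle hSm) hS0] at hDP
      have := mul_mem hDP (pow_mem hSm 2)
      rw [div_mul_cancel₀ _ (pow_ne_zero 2 hS0)] at this
      simpa only [map_sub, map_mul, hdK.aeval_pD, eS] using this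
    have h1 := coeff_mem_of_aeval_mem hMK hdK.tr hdM.tr hT (n + S'.natDegree)
    have hPn : P.natDegree ≤ n := natDegree_le_iff_coeff_eq_zero.mpr fun i hi => hP i hi
    have h2 : (hdK.pD S').coeff S'.natDegree = 0 := by
      have := hdK.degree_pD_lt hS'm
      rw [degree_eq_natDegree hS'm.ne_zero] at this
      exact coeff_eq_zero_of_degree_lt this
    rw [coeff_sub, coeff_mul_add_eq_of_natDegree_le ((hdK.natDegree_pD_le P).trans hPn) le_rfl,
      coeff_mul_add_eq_of_natDegree_le hPn (hdK.natDegree_pD_le S'), h2, mul_zero, sub_zero,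
      hS'm.coeff_natDegree, mul_one, hdK.coeff_pD, hP (n + 1) le_rfl] at h1
    simp only [ZeroMemClass.coe_zero, mul_zero, zero_mul, add_zero] at h1
    have h3 : (P.coeff n : U) ∈ M := hcl _ (SetLike.coe_mem _) h1
    set c : U := (P.coeff n : U) with hc
    have h4 : c * x ^ n / aeval x S ∈ Adj M x :=
      div_mem (mul_mem (le_Adj M x h3) (pow_mem (self_mem_Adj M x) n)) hSm
    have h5 : aeval x P / aeval x S =
        aeval x (P - monomial n (P.coeff n)) / aeval x S + c * x ^ n / aeval x S := by
      rw [map_sub, aeval_monomial, ← add_div]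
      congr 1
      have : (algebraMap K U) (P.coeff n) = c := rfl
      rw [this]; ring
    rw [h5]
    refine add_mem (ih _ ?_ ?_) h4
    · intro i hi
      rw [coeff_sub, coeff_monomial]
      split_ifs with h
      · subst h; simp
      · rw [hP i (by omega), sub_zero]
    · have h6 : aeval x (P - monomial n (P.coeff n)) / aeval x S =
        aeval x P / aeval x S - c * x ^ n / aeval x S := by rw [h5]; ring
      rw [h6, hdK.hE.sub (div_mem hPm (hle hSm)) (hle h4)]
      exact sub_mem hDP (hdM.hE.mem _ h4)

theorem closed_step (hD : DerOn D ⊤) {M K : Subfield U} (hMK : M ≤ K)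
    (hM : ∀ a ∈ M, D a ∈ M) (hK : ∀ a ∈ K, D a ∈ K) (hc : ∀ a, D a = 0 → a ∈ M)
    (hcl : ∀ a ∈ K, D a ∈ M → a ∈ M) {x : U} (hx : D x ∈ M) (hxK : x ∉ K) :
    ∀ a ∈ Adj K x, D a ∈ Adj M x → a ∈ Adj M x := by
  intro a ha hDa
  have hdK := mk_dext hD hK (fun a h => hMK (hc a h)) (hMK hx) hxK
  have hdM := mk_dext hD hM hc hx (fun h => hxK (hMK h))
  obtain ⟨P, Q, hco, hQ, hPQ⟩ := mem_Adj_coprime hdK.tr ha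
  obtain ⟨R, S, -, hS, hRS⟩ := mem_Adj_coprime hdM.tr hDa
  set S1 := S * C S.leadingCoeff⁻¹ with hS1
  have hS1m : S1.Monic := monic_mul_leadingCoeff_inv hS
  set S' := S1.map (Subfield.inclusion hMK) with hS'
  have eS : aeval x S' = aeval x S1 := aeval_map_incl hMK x S1
  have hRS1 : D a = aeval x (R * C S.leadingCoeff⁻¹) / aeval x S1 := by
    rw [hRS, hS1, map_mul, map_mul, mul_div_mul_right]
    refine aeval_ne_zero hdM.tr ?_
    rw [Ne, C_eq_zero, inv_eq_zero, leadingCoeff_eq_zero]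
    exact hS
  obtain ⟨N, Q', hN⟩ := dvd_pow_of_primes (Q := Q) (S := S') hQ (by
    intro p hm hp hpQ
    by_contra hpS
    refine coprime_notMem_Loc hdK.tr hp.prime hco hQ hpQ ?_
    rw [← hPQ]
    refine pole_one hdK (hdK.not_dvd_irred (fun a h => hMK (hc a h)) hm hp) ha ?_
    refine mul_mem (aeval_mem_Loc p) ?_
    rw [hRS1, ← eS, ← aeval_map_incl hMK]
    exact ⟨_, _, hpS, rfl⟩)
  have hQ0 := aeval_ne_zero hdK.tr hQ
  have hSN : aeval x Q * aeval x Q' = aeval x (S1 ^ N) := by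
    rw [← map_mul, ← hN, map_pow, map_pow, eS]
  have hS1N := aeval_ne_zero hdM.tr (hS1m.pow N).ne_zero
  have hQ'0 : aeval x Q' ≠ 0 := by
    intro h; rw [h, mul_zero] at hSN; exact hS1N hSN.symm
  have ha2 : a = aeval x (P * Q') / aeval x (S1 ^ N) := by
    rw [← hSN, hPQ, map_mul, mul_div_mul_right _ _ hQ'0]
  rw [ha2] at hDa ⊢
  exact closed_step_aux hMK hdM hdK hcl (hS1m.pow N) ((P * Q').natDegree + 1) _
    (fun i hi => coeff_eq_zero_of_natDegree_lt hi) hDa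

/-- Theorem I -/
theorem closed_eq (hD : DerOn D ⊤) {σ : Type*} [Finite σ] (w : σ → U) {F E : Subfield U}
    (hcF : ∀ a, D a = 0 → a ∈ F) (hwE : ∀ s, w s ∈ E)
    (hex : ∀ M : Subfield U, F ≤ M → (∀ a ∈ M, D a ∈ M) → ¬ E ≤ M → ∃ s, w s ∉ M ∧ D (w s) ∈ M)
    (t : ℕ) : ∀ M K : Subfield U, {s | w s ∉ M}.ncard ≤ t → F ≤ M → M ≤ K → K ≤ E →
      (∀ a ∈ M, D a ∈ M) → (∀ a ∈ K, D a ∈ K) → (∀ a ∈ K, D a ∈ M → a ∈ M) → K ≤ M := by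
  induction t with
  | zero =>
    intro M K hcard hFM hMK hKE hM hK hcl
    by_cases hEM : E ≤ M
    · exact hKE.trans hEM
    obtain ⟨s, hs, -⟩ := hex M hFM hM hEM
    rw [Nat.le_zero, Set.ncard_eq_zero (Set.toFinite _)] at hcard
    have : s ∈ {s | w s ∉ M} := hs
    rw [hcard] at this
    exact this.elim
  | succ t ih =>
    intro M K hcard hFM hMK hKE hM hK hcl
    by_cases hEM : E ≤ M
    · exact hKE.trans hEM
    obtain ⟨s, hs, hDs⟩ := hex M hFM hM hEM
    have hsK : w s ∉ K := fun h => hs (hcl _ h hDs)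
    have hlt : {s' | w s' ∉ Adj M (w s)}.ncard < {s | w s ∉ M}.ncard := by
      refine Set.ncard_lt_ncard ?_ (Set.toFinite _)
      refine ⟨fun s' h1 h2 => h1 (le_Adj _ _ h2), fun hsub => ?_⟩
      exact hsub (a := s) hs (self_mem_Adj _ _)
    have key := ih (Adj M (w s)) (Adj K (w s)) (by omega) (hFM.trans (le_Adj _ _))
      (Adj_le (hMK.trans (le_Adj _ _)) (self_mem_Adj _ _)) (Adj_le hKE (hwE s))
      (adj_der hD hM hDs) (adj_der hD hK (hMK hDs))
      (closed_step hD hMK hM hK (fun a h => hFM (hcF a h)) hcl hDs hsK)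
    intro a ha
    have hdK := mk_dext hD hK (fun a h => hMK (hFM (hcF a h))) (hMK hDs) hsK
    have hdM := mk_dext hD hM (fun a h => hFM (hcF a h)) hDs hs
    have h1 : aeval (w s) (C (⟨a, ha⟩ : K)) ∈ Adj M (w s) := by
      rw [aeval_C]
      exact key (le_Adj _ _ ha)
    simpa using coeff_mem_of_aeval_mem hMK hdK.tr hdM.tr h1 0

/-- the kernel of a derivation with `d M = 0`, `d x = 1` -/
theorem ker_der {d : U → U} {M : Subfield U} {x : U} (h : DExt d M x) (h0 : ∀ a ∈ M, d a = 0)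
    (hx : d x = 1) {u : U} (hu : u ∈ Adj M x) (hdu : d u = 0) : u ∈ M := by
  have hcoeff : ∀ (p : M[X]) (i : ℕ), (h.pD p).coeff i = (i + 1) * p.coeff (i + 1) := by
    intro p i
    apply Subtype.ext
    rw [h.coeff_pD, h0 _ (SetLike.coe_mem _), hx]
    push_cast; ring
  have hder : ∀ p : M[X], h.pD p = derivative p := by
    intro p; ext i; rw [hcoeff, coeff_derivative]; push_cast; ring
  obtain ⟨r, s, hco, hs, rfl⟩ := mem_Adj_coprime h.tr hu
  have hs0 := aeval_ne_zero h.tr hs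
  rw [h.hE.div (aeval_mem_Adj r) (aeval_mem_Adj s) hs0, div_eq_zero_iff] at hdu
  have h1 := hdu.resolve_right (pow_ne_zero 2 hs0)
  have h2 : derivative r * s - r * derivative s = 0 := by
    rw [← hder, ← hder]
    apply aeval_inj h.tr
    simpa only [map_sub, map_mul, h.aeval_pD, map_zero] using h1
  have h3 : s ∣ derivative s := by
    refine hco.symm.dvd_of_dvd_mul_left ⟨derivative r, ?_⟩
    linear_combination -h2
  have h4 : derivative s = 0 := by
    by_contra h
    exact absurd (degree_le_of_dvd h3 h) (not_le.mpr (degree_derivative_lt hs))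
  have h5 : derivative r = 0 := by
    rw [h4, mul_zero, sub_zero] at h2
    exact (mul_eq_zero.mp h2).resolve_right hs
  have h6 := derivative_eq_zero.mp h4
  have h7 := derivative_eq_zero.mp h5
  rw [eq_C_of_natDegree_eq_zero h6, eq_C_of_natDegree_eq_zero h7, aeval_C, aeval_C]
  exact div_mem (SetLike.coe_mem _) (SetLike.coe_mem _)
end

section Transl
variable {U : Type*} [Field U] [CharZero U] {ι : Type*} (P : Subfield U) (z : ι → U) (c : ι)

/-- the field generated by `P` and all `z i` with `i ≠ c` -/
def Nc : Subfield U := Subfield.closure ((P : Set U) ∪ z '' {i | i ≠ c})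

theorem le_Nc : P ≤ Nc P z c := fun _ h => Subfield.subset_closure (Or.inl h)

theorem mem_Nc {i : ι} (hi : i ≠ c) : z i ∈ Nc P z c :=
  Subfield.subset_closure (Or.inr ⟨i, hi, rfl⟩)

theorem Adj_Nc : Adj (Nc P z c) (z c) = Subfield.closure ((P : Set U) ∪ Set.range z) := by
  apply le_antisymm
  · refine Adj_le (Subfield.closure_mono ?_) (Subfield.subset_closure (Or.inr ⟨c, rfl⟩))
    exact Set.union_subset_union_right _ (Set.image_subset_range _ _)
  · refine Subfield.closure_le.mpr ?_
    rintro a (ha | ⟨i, rfl⟩)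
    · exact le_Adj _ _ (le_Nc P z c ha)
    · by_cases hi : i = c
      · subst hi; exact self_mem_Adj _ _
      · exact le_Adj _ _ (mem_Nc P z c hi)

open Classical in
/-- rewriting polynomials in all variables as polynomials in one variable -/
noncomputable def PhiH : MvPolynomial ι P →+* (Nc P z c)[X] :=
  MvPolynomial.eval₂Hom (Polynomial.C.comp (Subfield.inclusion (le_Nc P z c)))
    (fun i => if h : i = c then X else Polynomial.C ⟨z i, mem_Nc P z c h⟩)

theorem PhiH_C (a : P) :
    PhiH P z c (MvPolynomial.C a) = Polynomial.C (Subfield.inclusion (le_Nc P z c) a) := by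
  simp [PhiH]

theorem PhiH_X_self : PhiH P z c (MvPolynomial.X c) = X := by
  simp [PhiH]

theorem PhiH_X_ne {i : ι} (hi : i ≠ c) :
    PhiH P z c (MvPolynomial.X i) = Polynomial.C ⟨z i, mem_Nc P z c hi⟩ := by
  simp [PhiH, hi]

theorem aeval_PhiH (A : MvPolynomial ι P) :
    aeval (z c) (PhiH P z c A) = MvPolynomial.aeval z A := by
  induction A using MvPolynomial.induction_on with
  | C a => rw [PhiH_C, aeval_C, MvPolynomial.aeval_C]; rfl
  | add p q hp hq => rw [map_add, map_add, map_add, hp, hq]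
  | mul_X p i hp =>
    rw [map_mul, map_mul, map_mul, hp, MvPolynomial.aeval_X]
    congr 1
    by_cases hi : i = c
    · subst hi; rw [PhiH_X_self, aeval_X]
    · rw [PhiH_X_ne P z c hi, aeval_C]; rfl

theorem derivative_PhiH (A : MvPolynomial ι P) :
    derivative (PhiH P z c A) = PhiH P z c (MvPolynomial.pderiv c A) := by
  classical
  induction A using MvPolynomial.induction_on with
  | C a => rw [PhiH_C, derivative_C, MvPolynomial.pderiv_C, map_zero]
  | add p q hp hq => simp only [map_add, hp, hq]
  | mul_X p i hp =>
    rw [map_mul, derivative_mul, hp, MvPolynomial.pderiv_mul, map_add, map_mul, map_mul]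
    congr 2
    by_cases hi : i = c
    · subst hi; rw [PhiH_X_self, MvPolynomial.pderiv_X_self]; simp
    · rw [PhiH_X_ne P z c hi, MvPolynomial.pderiv_X_of_ne (fun h => hi h)]; simp

theorem PhiH_inj (hz : AlgebraicIndependent P z) : Function.Injective (PhiH P z c) := by
  intro A B h
  have := congrArg (aeval (z c)) h
  rw [aeval_PhiH, aeval_PhiH] at this
  exact hz this

theorem transcendental_Nc (hz : AlgebraicIndependent P z) : Transcendental (Nc P z c) (z c) := by
  have h1 := hz.transcendental_adjoin (s := {i | i ≠ c}) (i := c) (by simp)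
  set S := z '' {i | i ≠ c} with hS
  open IntermediateField.algebraAdjoinAdjoin in
  have h2 : Transcendental (IntermediateField.adjoin P S) (z c) := by
    intro h
    exact h1 ((IsFractionRing.isAlgebraic_iff (Algebra.adjoin P S)
      (IntermediateField.adjoin P S) U).mpr h)
  have hrange : Set.range (algebraMap P U) = (P : Set U) := by
    ext a
    exact ⟨fun ⟨b, hb⟩ => hb ▸ b.2, fun h => ⟨⟨a, h⟩, rfl⟩⟩
  have hmem : ∀ a ∈ Nc P z c, a ∈ IntermediateField.adjoin P S := by
    intro a ha
    rw [← IntermediateField.mem_toSubfield, IntermediateField.adjoin_toSubfield, hrange]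
    exact ha
  rintro ⟨p, hp0, hp⟩
  apply h2
  let f : Nc P z c →+* IntermediateField.adjoin P S :=
    { toFun := fun a => ⟨a, hmem a a.2⟩
      map_one' := rfl
      map_mul' := fun _ _ => rfl
      map_zero' := rfl
      map_add' := fun _ _ => rfl }
  refine ⟨p.map f, (Polynomial.map_ne_zero_iff f.injective).mpr hp0, ?_⟩
  rw [aeval_def, eval₂_map]
  exact hp

theorem Nc_frac (hz : AlgebraicIndependent P z) (u : U) (hu : u ∈ Nc P z c) :
    ∃ a b : MvPolynomial ι P,
    MvPolynomial.pderiv c a = 0 ∧ MvPolynomial.pderiv c b = 0 ∧ b ≠ 0 ∧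
      MvPolynomial.aeval z b * u = MvPolynomial.aeval z a := by
  classical
  have hne : ∀ b : MvPolynomial ι P, b ≠ 0 → MvPolynomial.aeval z b ≠ 0 := by
    intro b hb h
    exact hb (hz (by rw [h, map_zero]))
  unfold Nc at hu
  induction hu using Subfield.closure_induction with
  | mem x hx =>
    rcases hx with hx | ⟨i, hi, rfl⟩
    · refine ⟨MvPolynomial.C ⟨x, hx⟩, 1, by simp, by simp, one_ne_zero, ?_⟩
      rw [MvPolynomial.aeval_C, map_one, one_mul]; rfl
    · exact ⟨MvPolynomial.X i, 1, MvPolynomial.pderiv_X_of_ne hi, by simp, one_ne_zero,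
        by simp⟩
  | one => exact ⟨1, 1, by simp, by simp, one_ne_zero, by simp⟩
  | add x y hx hy ihx ihy =>
    obtain ⟨a, b, h1, h2, h3, h4⟩ := ihx
    obtain ⟨a', b', h1', h2', h3', h4'⟩ := ihy
    refine ⟨a * b' + b * a', b * b', ?_, ?_, mul_ne_zero h3 h3', ?_⟩
    · simp [MvPolynomial.pderiv_mul, *]
    · simp [MvPolynomial.pderiv_mul, *]
    · simp only [map_add, map_mul]
      rw [← h4, ← h4']; ring
  | neg x hx ihx =>
    obtain ⟨a, b, h1, h2, h3, h4⟩ := ihx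
    exact ⟨-a, b, by simp [h1], h2, h3, by rw [map_neg, ← h4]; ring⟩
  | inv x hx ihx =>
    obtain ⟨a, b, h1, h2, h3, h4⟩ := ihx
    by_cases hx0 : x = 0
    · exact ⟨0, 1, by simp, by simp, one_ne_zero, by simp [hx0]⟩
    · refine ⟨b, a, h2, h1, ?_, ?_⟩
      · rintro rfl
        rw [map_zero] at h4
        exact mul_ne_zero (hne b h3) hx0 h4
      · rw [← h4]; field_simp
  | mul x y hx hy ihx ihy =>
    obtain ⟨a, b, h1, h2, h3, h4⟩ := ihx
    obtain ⟨a', b', h1', h2', h3', h4'⟩ := ihy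
    refine ⟨a * a', b * b', ?_, ?_, mul_ne_zero h3 h3', ?_⟩
    · simp [MvPolynomial.pderiv_mul, *]
    · simp [MvPolynomial.pderiv_mul, *]
    · simp only [map_mul]
      rw [← h4, ← h4']; ring

theorem PhiH_const {s : MvPolynomial ι P} (hs : MvPolynomial.pderiv c s = 0) :
    ∃ t : Nc P z c, PhiH P z c s = Polynomial.C t ∧ (t : U) = MvPolynomial.aeval z s := by
  have h1 : derivative (PhiH P z c s) = 0 := by rw [derivative_PhiH, hs, map_zero]
  have h2 := eq_C_of_natDegree_eq_zero (derivative_eq_zero.mp h1)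
  refine ⟨_, h2, ?_⟩
  rw [← aeval_PhiH, h2, aeval_C]
  simp
  rfl

theorem PhiH_clear (hz : AlgebraicIndependent P z) (p : (Nc P z c)[X]) : ∃ s A : MvPolynomial ι P,
    MvPolynomial.pderiv c s = 0 ∧ s ≠ 0 ∧ PhiH P z c s * p = PhiH P z c A := by
  classical
  induction p using Polynomial.induction_on' with
  | add p q hp hq =>
    obtain ⟨s, A, h1, h2, h3⟩ := hp
    obtain ⟨s', A', h1', h2', h3'⟩ := hq
    refine ⟨s * s', A * s' + s * A', ?_, mul_ne_zero h2 h2', ?_⟩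
    · simp [MvPolynomial.pderiv_mul, *]
    · simp only [map_add, map_mul]
      rw [← h3, ← h3']; ring
  | monomial n a =>
    obtain ⟨a1, b, h1, h2, h3, h4⟩ := Nc_frac P z c hz a a.2
    refine ⟨b, a1 * MvPolynomial.X c ^ n, h2, h3, ?_⟩
    apply aeval_inj (transcendental_Nc P z c hz)
    rw [map_mul, aeval_PhiH, aeval_PhiH, aeval_monomial, map_mul, ← h4, map_pow,
      MvPolynomial.aeval_X, ← mul_assoc]
    rfl

theorem not_dvd_const (hz : AlgebraicIndependent P z) {Q s : MvPolynomial ι P} (hQ : MvPolynomial.pderiv c Q ≠ 0) (hs0 : s ≠ 0)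
    (hs : MvPolynomial.pderiv c s = 0) : ¬ Q ∣ s := by
  rintro ⟨t, ht⟩
  obtain ⟨u, hu, -⟩ := PhiH_const P z c hs
  have h0 : PhiH P z c s ≠ 0 := fun h => hs0 (PhiH_inj P z c hz (by rw [h, map_zero]))
  have h1 : PhiH P z c Q ∣ PhiH P z c s := by rw [ht, map_mul]; exact dvd_mul_right _ _
  have h2 := natDegree_le_of_dvd h1 h0
  rw [hu, natDegree_C, Nat.le_zero] at h2
  have h3 := derivative_eq_zero.mpr h2
  rw [derivative_PhiH] at h3
  exact hQ (PhiH_inj P z c hz (by rw [h3, map_zero]))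

theorem PhiH_dvd (hz : AlgebraicIndependent P z) {Q B : MvPolynomial ι P} (hQp : Prime Q) (hQ : MvPolynomial.pderiv c Q ≠ 0)
    (h : PhiH P z c Q ∣ PhiH P z c B) : Q ∣ B := by
  obtain ⟨p, hp⟩ := h
  obtain ⟨s, A, h1, h2, h3⟩ := PhiH_clear P z c hz p
  have h4 : s * B = Q * A := by
    apply PhiH_inj P z c hz
    rw [map_mul, map_mul, hp, ← h3]; ring
  have h5 : Q ∣ s * B := ⟨A, h4⟩
  exact (hQp.dvd_or_dvd h5).resolve_left (not_dvd_const P z c hz hQ h2 h1)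

theorem PhiH_prime (hz : AlgebraicIndependent P z) {Q : MvPolynomial ι P} (hQp : Prime Q) (hQ : MvPolynomial.pderiv c Q ≠ 0) :
    Prime (PhiH P z c Q) := by
  have hinj := PhiH_inj P z c hz
  refine ⟨fun h => hQp.ne_zero (hinj (by rw [h, map_zero])), ?_, ?_⟩
  · intro hu
    have h2 := natDegree_eq_zero_of_isUnit hu
    have h3 := derivative_eq_zero.mpr h2
    rw [derivative_PhiH] at h3
    exact hQ (hinj (by rw [h3, map_zero]))
  · have hcl : ∀ (p : (Nc P z c)[X]) (s A : MvPolynomial ι P), MvPolynomial.pderiv c s = 0 →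
        s ≠ 0 → PhiH P z c s * p = PhiH P z c A → Q ∣ A → PhiH P z c Q ∣ p := by
      intro p s A h1 h2 h3 h4
      obtain ⟨t, ht, -⟩ := PhiH_const P z c h1
      have ht0 : t ≠ 0 := by
        rintro rfl
        exact h2 (hinj (by rw [ht, map_zero, map_zero]))
      have hu : IsUnit (PhiH P z c s) := by rw [ht]; exact isUnit_C.mpr (IsUnit.mk0 t ht0)
      have : PhiH P z c Q ∣ PhiH P z c s * p := by
        obtain ⟨r, rfl⟩ := h4
        exact ⟨PhiH P z c r, by rw [h3, map_mul]⟩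
      obtain ⟨v, hv⟩ := hu
      obtain ⟨r, hr⟩ := this
      refine ⟨(↑v⁻¹ : (Nc P z c)[X]) * r, ?_⟩
      have h7 : (↑v⁻¹ : (Nc P z c)[X]) * PhiH P z c s = 1 := by rw [← hv]; exact v.inv_mul
      linear_combination (↑v⁻¹ : (Nc P z c)[X]) * hr - p * h7
    intro p1 p2 hd
    obtain ⟨s, A, h1, h2, h3⟩ := PhiH_clear P z c hz p1
    obtain ⟨s', A', h1', h2', h3'⟩ := PhiH_clear P z c hz p2
    have h4 : PhiH P z c Q ∣ PhiH P z c (A * A') := by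
      rw [map_mul, ← h3, ← h3']
      obtain ⟨r, hr⟩ := hd
      refine ⟨PhiH P z c s * PhiH P z c s' * r, ?_⟩
      linear_combination PhiH P z c s * PhiH P z c s' * hr
    rcases hQp.dvd_or_dvd (PhiH_dvd P z c hz hQp hQ h4) with h5 | h5
    · exact Or.inl (hcl p1 s A h1 h2 h3 h5)
    · exact Or.inr (hcl p2 s' A' h1' h2' h3' h5)

theorem transl (hz : AlgebraicIndependent P z) {A Q B : MvPolynomial ι P} (hQi : Prime Q)
    (hQ : MvPolynomial.pderiv c Q ≠ 0) (hA : MvPolynomial.pderiv c A = 0)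
    (hB : MvPolynomial.pderiv c B = 0) (hA0 : A ≠ 0) (hB0 : B ≠ 0) :
    ∃ (q : (Nc P z c)[X]) (hq : Prime q), q.Monic ∧
      (∃ f ∈ Nc P z c, f ≠ 0 ∧ MvPolynomial.aeval z A / (MvPolynomial.aeval z Q *
        MvPolynomial.aeval z B) = f / aeval (z c) q) ∧
      ∀ A' Q' B' : MvPolynomial ι P, ¬ Q ∣ Q' → ¬ Q ∣ B' → MvPolynomial.aeval z A' /
        (MvPolynomial.aeval z Q' * MvPolynomial.aeval z B') ∈
          Loc (transcendental_Nc P z c hz) hq := by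
  have hp := PhiH_prime P z c hz hQi hQ
  set l := (PhiH P z c Q).leadingCoeff with hl
  have hl0 : l ≠ 0 := leadingCoeff_ne_zero.mpr hp.ne_zero
  have hlu : IsUnit (Polynomial.C l⁻¹) := by rw [isUnit_C]; exact (inv_ne_zero hl0).isUnit
  have hass : Associated (PhiH P z c Q) (PhiH P z c Q * Polynomial.C l⁻¹) :=
    (associated_mul_unit_right _ _ hlu)
  refine ⟨PhiH P z c Q * Polynomial.C l⁻¹, hass.prime hp, monic_mul_leadingCoeff_inv hp.ne_zero,
    ?_, ?_⟩
  · obtain ⟨a, ha, ha'⟩ := PhiH_const P z c hA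
    obtain ⟨b, hb, hb'⟩ := PhiH_const P z c hB
    have hne : ∀ b : MvPolynomial ι P, b ≠ 0 → MvPolynomial.aeval z b ≠ 0 := by
      intro b hb h
      exact hb (hz (by rw [h, map_zero]))
    have hl0' : (l : U) ≠ 0 := fun h => hl0 (Subtype.ext h)
    have ha0 := hne A hA0
    have hb0 := hne B hB0
    have hq0 := hne Q hQi.ne_zero
    refine ⟨a / (b * l), ?_, ?_, ?_⟩
    · exact div_mem (SetLike.coe_mem _) (mul_mem (SetLike.coe_mem _) (SetLike.coe_mem _))
    · rw [ha', hb']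
      exact div_ne_zero ha0 (mul_ne_zero hb0 hl0')
    · rw [map_mul, aeval_PhiH, aeval_C, ha', hb']
      have : (algebraMap (Nc P z c) U) l⁻¹ = (l : U)⁻¹ := rfl
      rw [this]
      field_simp
  · intro A' Q' B' h1 h2
    refine ⟨PhiH P z c A', PhiH P z c (Q' * B'), ?_, ?_⟩
    · intro hd
      have := PhiH_dvd P z c hz hQi hQ (hass.dvd.trans hd)
      exact (hQi.dvd_or_dvd this).elim h1 h2
    · rw [aeval_PhiH, aeval_PhiH, map_mul]

end Transl

/-- the hypotheses of the main theorem, bundled -/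
structure Tower {U : Type*} [Field U] (D : U → U) (C : Subfield U) (k : ℕ) (n : ℕ → ℕ)
    (y : (i : ℕ) → Fin (n i) → U) (E : ℕ → Subfield U) : Prop where
  hD : DerOn D ⊤
  hC : ∀ c : U, c ∈ C ↔ D c = 0
  hCE : ∀ i ≤ k, C ≤ E i
  hEd : ∀ i ≤ k, ∀ a ∈ E i, D a ∈ E i
  hgen : ∀ i < k, E (i + 1) = Subfield.closure (↑(E i) ∪ Set.range (y i))
  hder0 : ∀ j, D (y 0 j) ∈ E 0
  hind0 : AlgebraicIndependent (E 0) (y 0)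
  hJ : ∀ m, m + 1 < k →
      ∃ A B Cc : Fin (n (m + 1)) → MvPolynomial (Fin (n m)) (E m),
        (∀ j, A j ≠ 0) ∧ (∀ j, B j ≠ 0) ∧
        (∀ j, Irreducible (Cc j)) ∧
        (∀ j j', j ≠ j' → ¬ Cc j ∣ Cc j') ∧
        (∀ j j', ¬ Cc j ∣ B j') ∧
        (∀ j, ∃ c : Fin (n m),
          MvPolynomial.pderiv c (Cc j) ≠ 0 ∧
          MvPolynomial.pderiv c (A j) = 0 ∧ MvPolynomial.pderiv c (B j) = 0) ∧
        (∀ j, D (y (m + 1) j) =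
          MvPolynomial.aeval (y m) (A j) /
            (MvPolynomial.aeval (y m) (Cc j) *
              MvPolynomial.aeval (y m) (B j)))

section Gen
variable {U : Type*} [Field U] [CharZero U] {D : U → U}

theorem transcendental_of_le {N : Subfield U} {R : Type*} [CommRing R] [Algebra R U]
    (hinj : Function.Injective (algebraMap R U))
    (h : ∀ r : R, algebraMap R U r ∈ N) {x : U} (hx : Transcendental N x) : Transcendental R x := by
  rintro ⟨p, hp0, hp⟩
  apply hx
  let f : R →+* N := (algebraMap R U).codRestrict N h
  have hf : Function.Injective f := fun a b hab => hinj (congrArg Subtype.val hab)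
  refine ⟨p.map f, (Polynomial.map_ne_zero_iff hf).mpr hp0, ?_⟩
  rw [aeval_def, eval₂_map]
  exact hp

theorem algInd_of_linInd (hD : DerOn D ⊤) {N : Subfield U} {ι : Type*} [Finite ι]
    (hN : ∀ a ∈ N, D a ∈ N) (hc : ∀ a, D a = 0 → a ∈ N) (f : ι → U) (hf : ∀ i, D (f i) ∈ N)
    (hlin : ∀ (s : Finset ι) (c : ι → U), (∀ i, D (c i) = 0) → ∑ i ∈ s, c i * f i ∈ N →
      ∀ i ∈ s, c i = 0) : AlgebraicIndependent N f := by
  classical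
  refine algebraicIndependent_of_finite_type' (algebraMap N U).injective ?_
  intro t ht _ i hi
  set s := ht.toFinset with hs
  set N' := Subfield.closure ((N : Set U) ∪ f '' s) with hN'
  have hNN' : N ≤ N' := fun _ h => Subfield.subset_closure (Or.inl h)
  have hN'D : ∀ a ∈ N', D a ∈ N' := by
    refine hD.closure_mem _ (fun _ _ => trivial) ?_
    rintro a (ha | ⟨i, -, rfl⟩)
    · exact hNN' (hN a ha)
    · exact hNN' (hf i)
  have hi' : f i ∉ N' := by
    intro hmem
    obtain ⟨c, hc1, hc2⟩ := ostrowski hD hN hc f hf s (f i) hmem (hf i)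
    have his : i ∉ s := by rw [hs, Set.Finite.mem_toFinset]; exact hi
    have := hlin (insert i s) (Function.update (fun j => - c j) i 1) ?_ ?_ i
      (Finset.mem_insert_self _ _)
    · simp at this
    · intro j
      by_cases hj : j = i
      · subst hj; simpa using hD.one
      · simp [hj, hD.neg (a := c j) trivial, hc1 j]
    · rw [Finset.sum_insert his, Function.update_self, one_mul]
      have e : ∑ j ∈ s, Function.update (fun j => - c j) i 1 j * f j = - ∑ j ∈ s, c j * f j := by
        rw [← Finset.sum_neg_distrib]
        refine Finset.sum_congr rfl fun j hj => ?_
        rw [Function.update_of_ne (by rintro rfl; exact his hj)]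
        ring
      rw [e, ← sub_eq_add_neg]
      exact hc2
  have htr := antider_transcendental hD hN'D (fun a h => hNN' (hc a h)) (hNN' (hf i)) hi'
  refine transcendental_of_le (N := N') Subtype.val_injective ?_ htr
  rintro ⟨r, hr⟩
  change r ∈ N'
  induction hr using Algebra.adjoin_induction with
  | mem a ha =>
    refine Subfield.subset_closure (Or.inr ?_)
    rw [hs, Set.Finite.coe_toFinset]; exact ha
  | algebraMap a => exact hNN' a.2
  | add a b _ _ ha hb => exact add_mem ha hb
  | mul a b _ _ ha hb => exact mul_mem ha hb

end Gen

/-- index set of all the generators of levels `< m` -/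
def Sig (n : ℕ → ℕ) (m : ℕ) : Type := {s : Σ i : ℕ, Fin (n i) // s.1 < m}

instance (n : ℕ → ℕ) (m : ℕ) : Finite (Sig n m) := by
  refine Finite.of_surjective (fun s : Σ i : Fin m, Fin (n i) =>
    (⟨⟨s.1, s.2⟩, s.1.2⟩ : Sig n m)) ?_
  rintro ⟨⟨i, j⟩, h⟩
  exact ⟨⟨⟨i, h⟩, j⟩, rfl⟩

/-- the generator with a given index -/
def wv {U : Type*} {n : ℕ → ℕ} (y : (i : ℕ) → Fin (n i) → U) (m : ℕ) (s : Sig n m) : U :=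
  y s.1.1 s.1.2

namespace Tower
variable {U : Type*} [Field U] [CharZero U] {D : U → U} {C : Subfield U} {k : ℕ} {n : ℕ → ℕ}
    {y : (i : ℕ) → Fin (n i) → U} {E : ℕ → Subfield U}

theorem le_succ (T : Tower D C k n y E) {i : ℕ} (hi : i < k) : E i ≤ E (i + 1) := by
  rw [T.hgen i hi]
  exact fun _ h => Subfield.subset_closure (Or.inl h)

theorem y_mem (T : Tower D C k n y E) {i : ℕ} (hi : i < k) (j) : y i j ∈ E (i + 1) := by
  rw [T.hgen i hi]
  exact Subfield.subset_closure (Or.inr ⟨j, rfl⟩)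

theorem mono (T : Tower D C k n y E) {i m : ℕ} (him : i ≤ m) (hm : m ≤ k) : E i ≤ E m := by
  induction m, him using Nat.le_induction with
  | base => exact le_rfl
  | succ m _ ih => exact (ih (by omega)).trans (T.le_succ (by omega))

theorem const_mem (T : Tower D C k n y E) {i : ℕ} (hi : i ≤ k) (a : U) (ha : D a = 0) : a ∈ E i :=
  T.hCE i hi ((T.hC a).mpr ha)

theorem Dy_mem (T : Tower D C k n y E) {i : ℕ} (hi : i < k) (j) : D (y i j) ∈ E i := by
  rcases i with _ | m
  · exact T.hder0 j
  · obtain ⟨A, B, Cc, -, -, -, -, -, -, h⟩ := T.hJ m hi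
    have hmem : ∀ p : MvPolynomial (Fin (n m)) (E m), MvPolynomial.aeval (y m) p ∈ E (m + 1) := by
      intro p
      induction p using MvPolynomial.induction_on with
      | C a => rw [MvPolynomial.aeval_C]; exact T.le_succ (by omega) a.2
      | add p q hp hq => rw [map_add]; exact add_mem hp hq
      | mul_X p i hp =>
        rw [map_mul, MvPolynomial.aeval_X]; exact mul_mem hp (T.y_mem (by omega) i)
    rw [h]
    exact div_mem (hmem _) (mul_mem (hmem _) (hmem _))

/-- existence of a new antiderivative over a differential subfield -/
theorem exists_new (T : Tower D C k n y E) (M : Subfield U) (hM : E 0 ≤ M) (hEM : ¬ E k ≤ M) :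
    ∃ s : Sig n k, wv y k s ∉ M ∧ D (wv y k s) ∈ M := by
  by_contra! hcon
  apply hEM
  have : ∀ m ≤ k, E m ≤ M := by
    intro m
    induction m with
    | zero => exact fun _ => hM
    | succ m ih =>
      intro hm
      rw [T.hgen m (by omega)]
      refine Subfield.closure_le.mpr ?_
      rintro a (ha | ⟨j, rfl⟩)
      · exact ih (by omega) ha
      · by_contra hj
        exact hcon ⟨⟨m, j⟩, by exact hm⟩ hj (ih (by omega) (T.Dy_mem (by omega) j))
  exact this k le_rfl

theorem Nc_der (T : Tower D C k n y E) {m : ℕ} (hm : m < k) (c : Fin (n m)) :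
    ∀ a ∈ Nc (E m) (y m) c, D a ∈ Nc (E m) (y m) c := by
  refine T.hD.closure_mem _ (fun _ _ => trivial) ?_
  rintro a (ha | ⟨i, -, rfl⟩)
  · exact le_Nc _ _ _ (T.hEd m hm.le a ha)
  · exact le_Nc _ _ _ (T.Dy_mem hm i)

theorem Nc_dext (T : Tower D C k n y E) {m : ℕ} (hm : m < k) (c : Fin (n m))
    (hind : AlgebraicIndependent (E m) (y m)) : DExt D (Nc (E m) (y m) c) (y m c) :=
  DExt.of_big T.hD le_top trivial (T.Nc_der hm c) (le_Nc _ _ _ (T.Dy_mem hm c))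
    (transcendental_Nc _ _ _ hind)

theorem pole_data (T : Tower D C k n y E) {m : ℕ} (hm : m + 1 < k)
    (hind : AlgebraicIndependent (E m) (y m)) (j : Fin (n (m + 1))) :
    ∃ (c : Fin (n m)) (q : (Nc (E m) (y m) c)[X]) (hq : Prime q), q.Monic ∧
      (∃ f ∈ Nc (E m) (y m) c, f ≠ 0 ∧ D (y (m + 1) j) = f / aeval (y m c) q) ∧
      ∀ i, i ≠ j → D (y (m + 1) i) ∈ Loc (transcendental_Nc (E m) (y m) c hind) hq := by
  obtain ⟨A, B, Cc, hA, hB, hirr, h1, h2, h3, h⟩ := T.hJ m hm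
  obtain ⟨c, hc1, hc2, hc3⟩ := h3 j
  obtain ⟨q, hq, hqm, ⟨f, hf, hf0, hfe⟩, hother⟩ :=
    transl (E m) (y m) c hind (hirr j).prime hc1 hc2 hc3 (hA j) (hB j)
  refine ⟨c, q, hq, hqm, ⟨f, hf, hf0, by rw [h j, hfe]⟩, fun i hi => ?_⟩
  rw [h i]
  exact hother _ _ _ (h1 j i hi.symm) (h2 j i)

theorem Nc_adj (T : Tower D C k n y E) {m : ℕ} (hm : m < k) (c : Fin (n m)) :
    Adj (Nc (E m) (y m) c) (y m c) = E (m + 1) := by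
  rw [Adj_Nc, T.hgen m hm]

theorem Nc_not_dvd (T : Tower D C k n y E) {m : ℕ} (hm : m < k) (c : Fin (n m))
    (h : DExt D (Nc (E m) (y m) c) (y m c)) {q : (Nc (E m) (y m) c)[X]} (hq : Prime q)
    (hqm : q.Monic) : ¬ q ∣ h.pD q :=
  h.not_dvd_irred (fun a ha => le_Nc _ _ _ (T.const_mem hm.le a ha)) hqm hq.irreducible

theorem lin_ind (T : Tower D C k n y E) {m : ℕ} (hm : m + 1 < k)
    (hind : AlgebraicIndependent (E m) (y m)) (s : Finset (Fin (n (m + 1))))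
    (v : Fin (n (m + 1)) → U) (hv : ∀ j, D (v j) = 0) (l : U) (hl : l ∈ E (m + 1))
    (h : ∑ j ∈ s, v j * D (y (m + 1) j) + D l ∈ E m) : ∀ j ∈ s, v j = 0 := by
  classical
  intro j hj
  obtain ⟨c, q, hq, hqm, ⟨f, hf, hf0, hfe⟩, hother⟩ := T.pole_data hm hind j
  have hd := T.Nc_dext (by omega) c hind
  have hnd := T.Nc_not_dvd (by omega) c hd hq hqm
  have hvN : ∀ i, v i ∈ Nc (E m) (y m) c :=
    fun i => le_Nc _ _ _ (T.const_mem (by omega) _ (hv i))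
  have hq0 := aeval_ne_zero hd.tr hq.ne_zero
  rw [← Finset.add_sum_erase s _ hj, hfe] at h
  have hS : ∑ i ∈ s.erase j, v i * D (y (m + 1) i) ∈
      Loc (transcendental_Nc (E m) (y m) c hind) hq := by
    refine sum_mem fun i hi => mul_mem (base_mem_Loc (hvN i)) (hother i ?_)
    exact Finset.ne_of_mem_erase hi
  have hR := base_mem_Loc (tr := transcendental_Nc (E m) (y m) c hind) (hp := hq)
    (le_Nc (E m) (y m) c h)
  have hX : v j * (f / aeval (y m c) q) + D l ∈
      Loc (transcendental_Nc (E m) (y m) c hind) hq := by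
    have := sub_mem hR hS
    convert this using 1; ring
  have hvf := mul_mem (hvN j) hf
  have hlL : l ∈ Loc (transcendental_Nc (E m) (y m) c hind) hq := by
    refine pole_one hd hnd (by rw [T.Nc_adj (by omega)]; exact hl) ?_
    have := sub_mem (mul_mem (aeval_mem_Loc q) hX) (base_mem_Loc hvf)
    convert this using 1
    field_simp; ring
  have h4 := sub_mem hX (der_mem_Loc hd hlL)
  have h5 : v j * f = 0 := by
    refine simple_pole (tr := transcendental_Nc (E m) (y m) c hind) (hp := hq) hvf ?_
    convert h4 using 1; ring
  exact (mul_eq_zero.mp h5).resolve_right hf0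

theorem alg_ind (T : Tower D C k n y E) {m : ℕ} (hm : m < k) :
    AlgebraicIndependent (E m) (y m) := by
  induction m with
  | zero => exact T.hind0
  | succ m ih =>
    have hind := ih (by omega)
    refine algInd_of_linInd T.hD (T.hEd _ hm.le) (T.const_mem hm.le) _ (T.Dy_mem hm) ?_
    intro s c hc hsum
    refine T.lin_ind hm hind s c hc (- ∑ j ∈ s, c j * y (m + 1) j) (neg_mem hsum) ?_
    rw [T.hD.neg trivial, T.hD.sum _ _ (fun _ _ => trivial)]
    have : ∑ j ∈ s, D (c j * y (m + 1) j) = ∑ j ∈ s, c j * D (y (m + 1) j) := by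
      refine Finset.sum_congr rfl fun j _ => ?_
      rw [T.hD.mul _ trivial _ trivial, hc]; ring
    rw [this, add_neg_cancel]
    exact zero_mem _

/-- elements of `E (m+1)` with derivative in `E m` -/
theorem repr_level (T : Tower D C k n y E) {m : ℕ} (hm : m < k) (a : U) (ha : a ∈ E (m + 1))
    (hDa : D a ∈ E m) : ∃ v : Fin (n m) → U, (∀ j, D (v j) = 0) ∧ a - ∑ j, v j * y m j ∈ E m := by
  rw [T.hgen m hm] at ha
  exact ostrowski T.hD (T.hEd m hm.le) (T.const_mem hm.le) (y m) (T.Dy_mem hm) Finset.univ a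
    (by simpa using ha) hDa

theorem drop_level (T : Tower D C k n y E) {r m : ℕ} (hrm : r < m) (hm : m ≤ k) (a : U)
    (ha : a ∈ E m) (hDa : D a ∈ E r) : a ∈ E (r + 1) := by
  induction m, hrm using Nat.le_induction with
  | base => exact ha
  | succ m hrm' ih =>
    have hrm : r + 1 ≤ m := hrm'
    apply ih (by omega)
    obtain ⟨v, hv, hl⟩ := T.repr_level (by omega) a ha (T.mono (by omega) (by omega) hDa)
    obtain ⟨m, rfl⟩ : ∃ m', m = m' + 1 := ⟨m - 1, by omega⟩
    have hind := T.alg_ind (m := m) (by omega)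
    have h0 := T.lin_ind (by omega) hind Finset.univ v hv _ hl (by
      rw [T.hD.sub trivial trivial, T.hD.sum _ _ (fun _ _ => trivial)]
      have : ∑ j, D (v j * y (m + 1) j) = ∑ j, v j * D (y (m + 1) j) := by
        refine Finset.sum_congr rfl fun j _ => ?_
        rw [T.hD.mul _ trivial _ trivial, hv]; ring
      rw [this, add_sub_cancel]
      exact T.mono (by omega) (by omega) hDa)
    have : ∑ j, v j * y (m + 1) j = 0 :=
      Finset.sum_eq_zero fun j hj => by rw [h0 j hj, zero_mul]
    rw [this, sub_zero] at hl
    exact hl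

theorem all_ind (T : Tower D C k n y E) {m : ℕ} (hm : m ≤ k) :
    AlgebraicIndependent (E 0) (wv y m) := by
  induction m with
  | zero =>
    haveI : IsEmpty (Sig n 0) := ⟨fun s => absurd s.2 (Nat.not_lt_zero _)⟩
    exact algebraicIndependent_empty_type_iff.mpr (algebraMap (E 0) U).injective
  | succ m ih =>
    have h1 := ih (by omega)
    have h2 := T.alg_ind (m := m) (by omega)
    have hle := T.mono (Nat.zero_le m) (by omega)
    letI : Algebra (E 0) (E m) := (Subfield.inclusion hle).toAlgebra
    haveI : IsScalarTower (E 0) (E m) U := IsScalarTower.of_algebraMap_eq (fun _ => rfl)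
    have h3 := h1.sumElim_of_tower (S := E m) (y := y m) (by
      rintro _ ⟨s, rfl⟩
      have : wv y m s ∈ E m := T.mono (i := s.1.1 + 1) s.2 (by omega)
        (T.y_mem (lt_of_lt_of_le s.2 (by omega)) _)
      exact ⟨⟨_, this⟩, rfl⟩) h2
    let e : Fin (n m) ⊕ Sig n m → Sig n (m + 1) := Sum.elim
      (fun j => ⟨⟨m, j⟩, Nat.lt_succ_self m⟩) (fun s => ⟨s.1, Nat.lt_succ_of_lt s.2⟩)
    have hbij : Function.Bijective e := by
      constructor
      · rintro (a | ⟨⟨i, j⟩, hi⟩) (b | ⟨⟨i', j'⟩, hi'⟩) hab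
        · have h5 : (⟨m, a⟩ : Σ i : ℕ, Fin (n i)) = ⟨m, b⟩ := congrArg Subtype.val hab
          rw [Sigma.mk.injEq] at h5
          rw [eq_of_heq h5.2]
        · have h5 : m = i' := congrArg (fun s : Sig n (m + 1) => s.1.1) hab
          simp only at hi'
          omega
        · have h5 : i = m := congrArg (fun s : Sig n (m + 1) => s.1.1) hab
          simp only at hi
          omega
        · have h5 : (⟨i, j⟩ : Σ i : ℕ, Fin (n i)) = ⟨i', j'⟩ := congrArg Subtype.val hab
          congr 1
          exact Subtype.ext h5
      · rintro ⟨⟨i, j⟩, hi⟩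
        by_cases him : i < m
        · exact ⟨Sum.inr ⟨⟨i, j⟩, him⟩, rfl⟩
        · have : i = m := by simp only at hi; omega
          subst this
          exact ⟨Sum.inl j, rfl⟩
    rw [← algebraicIndependent_equiv (Equiv.ofBijective e hbij)]
    convert h3 using 1
    funext s
    rcases s with s | s <;> rfl

theorem gen_all (T : Tower D C k n y E) {m : ℕ} (hm : m ≤ k) :
    E m = Subfield.closure ((E 0 : Set U) ∪ Set.range (wv y m)) := by
  apply le_antisymm
  · induction m with
    | zero => exact fun _ h => Subfield.subset_closure (Or.inl h)
    | succ m ih =>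
      rw [T.hgen m (by omega)]
      refine Subfield.closure_le.mpr ?_
      rintro a (ha | ⟨j, rfl⟩)
      · refine Subfield.closure_mono (Set.union_subset_union_right _ ?_) (ih (by omega) ha)
        rintro _ ⟨s, rfl⟩
        exact ⟨⟨s.1, Nat.lt_succ_of_lt s.2⟩, rfl⟩
      · exact Subfield.subset_closure (Or.inr ⟨⟨⟨m, j⟩, Nat.lt_succ_self m⟩, rfl⟩)
  · refine Subfield.closure_le.mpr ?_
    rintro a (ha | ⟨s, rfl⟩)
    · exact T.mono (Nat.zero_le m) hm ha
    · exact T.mono (i := s.1.1 + 1) s.2 hm (T.y_mem (lt_of_lt_of_le s.2 hm) _)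

end Tower

section ExDer
variable {U : Type*} [Field U] [CharZero U] {σ : Type*}

/-- flow homomorphism -/
noncomputable def flowH (F : Type*) [Field F] (θ : σ → F) :
    MvPolynomial σ F →+* (MvPolynomial σ F)[X] :=
  MvPolynomial.eval₂Hom (Polynomial.C.comp MvPolynomial.C)
    (fun s => Polynomial.C (MvPolynomial.X s) + Polynomial.C (MvPolynomial.C (θ s)) * X)

theorem flowH_eval (F : Type*) [Field F] (θ : σ → F) (a : MvPolynomial σ F) :
    (flowH F θ a).eval 0 = a := by
  induction a using MvPolynomial.induction_on with
  | C a => simp [flowH]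
  | add p q hp hq => rw [map_add, eval_add, hp, hq]
  | mul_X p i hp =>
    rw [map_mul, eval_mul, hp]
    simp [flowH]

theorem flowH_der (F : Type*) [Field F] (θ : σ → F) (a : MvPolynomial σ F) :
    derivative (flowH F θ a) =
      flowH F θ (MvPolynomial.mkDerivation F (fun s => MvPolynomial.C (θ s)) a) := by
  induction a using MvPolynomial.induction_on with
  | C a => rw [MvPolynomial.derivation_C]; simp [flowH]
  | add p q hp hq => simp only [map_add, hp, hq]
  | mul_X p i hp =>
    rw [map_mul, derivative_mul, hp, Derivation.leibniz, map_add, MvPolynomial.mkDerivation_X]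
    simp only [smul_eq_mul, map_mul]
    have h1 : derivative (flowH F θ (MvPolynomial.X i)) = flowH F θ (MvPolynomial.C (θ i)) := by
      simp [flowH]
    rw [h1]
    ring

theorem no_eigen (F : Type*) [Field F] [CharZero F] (θ : σ → F) (a b : MvPolynomial σ F)
    (ha : a ≠ 0) (hb : b ≠ 0) (c : F)
    (h : MvPolynomial.mkDerivation F (fun s => MvPolynomial.C (θ s)) a * b -
      a * MvPolynomial.mkDerivation F (fun s => MvPolynomial.C (θ s)) b =
        MvPolynomial.C c * (a * b)) : c = 0 := by
  by_contra hc
  have hne : ∀ a : MvPolynomial σ F, a ≠ 0 → flowH F θ a ≠ 0 := by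
    intro a ha h0
    apply ha
    rw [← flowH_eval F θ a, h0, eval_zero]
  have h1 := congrArg (flowH F θ) h
  simp only [map_sub, map_mul, ← flowH_der] at h1
  set A := flowH F θ a with hA
  set B := flowH F θ b with hB
  have hA0 : A ≠ 0 := hne a ha
  have hB0 : B ≠ 0 := hne b hb
  have h2 : (flowH F θ (MvPolynomial.C c) * (A * B)).degree = A.degree + B.degree := by
    have : flowH F θ (MvPolynomial.C c) = Polynomial.C (MvPolynomial.C c) := by simp [flowH]
    rw [this, degree_mul, degree_C, zero_add, degree_mul]
    rwa [Ne, MvPolynomial.C_eq_zero]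
  have hAb : A.degree ≠ ⊥ := degree_ne_bot.mpr hA0
  have hBb : B.degree ≠ ⊥ := degree_ne_bot.mpr hB0
  have h3 : (derivative A * B - A * derivative B).degree < A.degree + B.degree := by
    refine lt_of_le_of_lt (degree_sub_le _ _) (max_lt ?_ ?_)
    · rw [degree_mul]
      exact WithBot.add_lt_add_right hBb (degree_derivative_lt hA0)
    · rw [degree_mul]
      exact WithBot.add_lt_add_left hAb (degree_derivative_lt hB0)
  rw [h1, h2] at h3
  exact lt_irrefl _ h3

theorem frac_closure (F : Subfield U) (w : σ → U) (u : U) :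
    u ∈ Subfield.closure ((F : Set U) ∪ Set.range w) ↔
      ∃ r s : MvPolynomial σ F, u = MvPolynomial.aeval w r / MvPolynomial.aeval w s := by
  rw [← IntermediateField.mem_adjoin_range_iff]
  have : Set.range (algebraMap F U) = (F : Set U) := by
    ext a
    exact ⟨fun ⟨b, hb⟩ => hb ▸ b.2, fun h => ⟨⟨a, h⟩, rfl⟩⟩
  rw [← IntermediateField.mem_toSubfield, IntermediateField.adjoin_toSubfield, this]

theorem frac_closure' (F : Subfield U) (w : σ → U) (hw : AlgebraicIndependent F w) (u : U)
    (hu : u ∈ Subfield.closure ((F : Set U) ∪ Set.range w)) :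
      ∃ r s : MvPolynomial σ F, s ≠ 0 ∧ MvPolynomial.aeval w s ≠ 0 ∧
        u = MvPolynomial.aeval w r / MvPolynomial.aeval w s := by
  obtain ⟨r, s, h⟩ := (frac_closure F w u).mp hu
  by_cases hs : s = 0
  · refine ⟨0, 1, one_ne_zero, by simp, ?_⟩
    rw [h, hs]; simp
  · exact ⟨r, s, hs, fun h0 => hs (hw (by rw [h0, map_zero])), h⟩

theorem exists_der (F : Subfield U) (w : σ → U) (hw : AlgebraicIndependent F w) (θ : σ → F) :
    ∃ d : U → U, DerOn d (Subfield.closure ((F : Set U) ∪ Set.range w)) ∧ (∀ a ∈ F, d a = 0) ∧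
      (∀ s, d (w s) = θ s) ∧
      ∀ g ∈ Subfield.closure ((F : Set U) ∪ Set.range w), g ≠ 0 → ∀ c ∈ F, d g = c * g → c = 0 := by
  classical
  set E := Subfield.closure ((F : Set U) ∪ Set.range w) with hE
  set δ := MvPolynomial.mkDerivation F (fun s => (MvPolynomial.C (θ s) : MvPolynomial σ F)) with hδ
  set φ := MvPolynomial.aeval (R := F) w with hφ
  have hrep : ∀ u : U, ∃ rs : MvPolynomial σ F × MvPolynomial σ F, u ∈ E →
      (rs.2 ≠ 0 ∧ φ rs.2 ≠ 0 ∧ u = φ rs.1 / φ rs.2) := by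
    intro u
    by_cases hu : u ∈ E
    · obtain ⟨r, s, h⟩ := frac_closure' F w hw u hu
      exact ⟨(r, s), fun _ => h⟩
    · exact ⟨(0, 0), fun h => absurd h hu⟩
  choose ρ hρ using hrep
  let d : U → U := fun u => (φ (δ (ρ u).1) * φ (ρ u).2 - φ (ρ u).1 * φ (δ (ρ u).2)) / φ (ρ u).2 ^ 2
  have hmemφ : ∀ a, φ a ∈ E := fun a => (frac_closure F w _).mpr ⟨a, 1, by simp [hφ]⟩
  have key : ∀ a b : MvPolynomial σ F, φ b ≠ 0 →
      d (φ a / φ b) = (φ (δ a) * φ b - φ a * φ (δ b)) / φ b ^ 2 := by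
    intro a b hb
    obtain ⟨-, h2, h3⟩ := hρ (φ a / φ b) (div_mem (hmemφ a) (hmemφ b))
    simp only [d]
    set r := (ρ (φ a / φ b)).1
    set s := (ρ (φ a / φ b)).2
    rw [div_eq_div_iff hb h2] at h3
    have h4 : a * s = r * b := hw (by simpa only [map_mul] using h3)
    have h5 := congrArg (fun p => φ (δ p)) h4
    simp only [Derivation.leibniz, smul_eq_mul, map_add, map_mul] at h5
    rw [div_eq_div_iff (pow_ne_zero 2 h2) (pow_ne_zero 2 hb)]
    linear_combination (-(φ b) * φ s) * h5 + (φ s * φ (δ b) + φ b * φ (δ s)) * h3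
  have key1 : ∀ a : MvPolynomial σ F, d (φ a) = φ (δ a) := by
    intro a
    have := key a 1 (by simp)
    simpa using this
  refine ⟨d, ⟨?_, ?_, ?_⟩, ?_, ?_, ?_⟩
  · intro u hu
    exact div_mem (sub_mem (mul_mem (hmemφ _) (hmemφ _)) (mul_mem (hmemφ _) (hmemφ _)))
      (pow_mem (hmemφ _) 2)
  · intro u hu v hv
    obtain ⟨a, b, -, hb, rfl⟩ := frac_closure' F w hw u hu
    obtain ⟨a', b', -, hb', rfl⟩ := frac_closure' F w hw v hv
    change φ b ≠ 0 at hb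
    change φ b' ≠ 0 at hb'
    have e : φ a / φ b + φ a' / φ b' = φ (a * b' + b * a') / φ (b * b') := by
      simp only [map_add, map_mul]; rw [div_add_div _ _ hb hb']
    simp only [← hφ]
    rw [e, key _ _ hb, key _ _ hb', key _ _ (by rw [map_mul]; exact mul_ne_zero hb hb')]
    simp only [Derivation.leibniz, smul_eq_mul, map_add, map_mul]
    field_simp
    ring
  · intro u hu v hv
    obtain ⟨a, b, -, hb, rfl⟩ := frac_closure' F w hw u hu
    obtain ⟨a', b', -, hb', rfl⟩ := frac_closure' F w hw v hv
    change φ b ≠ 0 at hb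
    change φ b' ≠ 0 at hb'
    have e : φ a / φ b * (φ a' / φ b') = φ (a * a') / φ (b * b') := by
      simp only [map_mul]; rw [div_mul_div_comm]
    simp only [← hφ]
    rw [e, key _ _ hb, key _ _ hb', key _ _ (by rw [map_mul]; exact mul_ne_zero hb hb')]
    simp only [Derivation.leibniz, smul_eq_mul, map_add, map_mul]
    field_simp
    ring
  · intro a ha
    have := key1 (MvPolynomial.C ⟨a, ha⟩)
    rw [MvPolynomial.derivation_C, map_zero, hφ, MvPolynomial.aeval_C] at this
    exact this
  · intro s
    have := key1 (MvPolynomial.X s)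
    rw [hδ, MvPolynomial.mkDerivation_X, hφ, MvPolynomial.aeval_C, MvPolynomial.aeval_X] at this
    exact this
  · intro g hg hg0 c hc hdg
    obtain ⟨a, b, hb0, hb, rfl⟩ := frac_closure' F w hw g hg
    have ha0 : a ≠ 0 := by rintro rfl; simp at hg0
    rw [key _ _ hb, div_eq_iff (pow_ne_zero 2 hb)] at hdg
    have h5 : δ a * b - a * δ b = MvPolynomial.C ⟨c, hc⟩ * (a * b) := by
      apply hw
      simp only [map_sub, map_mul, MvPolynomial.aeval_C]
      have e : algebraMap F U ⟨c, hc⟩ = c := rfl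
      rw [e]
      refine hdg.trans ?_
      field_simp
    exact congrArg Subtype.val (no_eigen F θ a b ha0 hb0 _ h5)

end ExDer

section Local
variable {U : Type*} [Field U] [CharZero U] {d D : U → U} {N : Subfield U} {x : U}
  {Q : N[X]}

theorem local_case_zero {tr : Transcendental N x} {hQ : Prime Q} (hd : DExt d N x)
    (hD : DExt D N x) (hnd : ¬ Q ∣ hD.pD Q) (h0 : d (aeval x Q) = 0) {f l μ v : U} (hf : f ∈ N)
    (hl : l ∈ Adj N x) (hμ : μ ∈ N) (hμ0 : μ ≠ 0) (hv : v ∈ N)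
    (h : μ * d (f / aeval x Q) + v * (f / aeval x Q) + D l ∈ Loc tr hQ) :
    d (f / aeval x Q) = -(v / μ) * (f / aeval x Q) := by
  have hQ0 := aeval_ne_zero tr hQ.ne_zero
  have e1 : d (f / aeval x Q) = d f / aeval x Q := by
    rw [hd.hE.div (le_Adj _ _ hf) (aeval_mem_Adj Q) hQ0, h0]
    field_simp; ring
  have hdf : d f ∈ N := hd.hN.mem f hf
  have hg : μ * d f + v * f ∈ N := add_mem (mul_mem hμ hdf) (mul_mem hv hf)
  have e2 : μ * d (f / aeval x Q) + v * (f / aeval x Q) = (μ * d f + v * f) / aeval x Q := by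
    rw [e1]; ring
  rw [e2] at h
  have hlL : l ∈ Loc tr hQ := by
    refine pole_one hD hnd hl ?_
    have : aeval x Q * D l = aeval x Q * ((μ * d f + v * f) / aeval x Q + D l)
        - (μ * d f + v * f) := by field_simp; ring
    rw [this]
    exact sub_mem (mul_mem (aeval_mem_Loc _) h) (base_mem_Loc hg)
  have h2 : (μ * d f + v * f) / aeval x Q ∈ Loc tr hQ := by
    have := sub_mem h (der_mem_Loc hD hlL)
    simpa using this
  have h3 := simple_pole hg h2
  rw [e1]
  field_simp
  linear_combination h3

theorem local_case_ne {tr : Transcendental N x} {hQ : Prime Q} (hd : DExt d N x)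
    (hD : DExt D N x) (hnd : ¬ Q ∣ hD.pD Q) (hQm : Q.Monic) (h0 : d (aeval x Q) ≠ 0)
    {f l μ v : U} (hf : f ∈ N) (hf0 : f ≠ 0)
    (hl : l ∈ Adj N x) (hμ : μ ∈ N) (hμ0 : μ ≠ 0) (hv : v ∈ N)
    (h : μ * d (f / aeval x Q) + v * (f / aeval x Q) + D l ∈ Loc tr hQ) :
    ∃ a b : N[X], ¬ Q ∣ a ∧ ¬ Q ∣ b ∧ l = aeval x a / (aeval x Q * aeval x b) := by
  have hQ0 := aeval_ne_zero tr hQ.ne_zero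
  have e1 : d (f / aeval x Q) = (d f * aeval x Q - f * d (aeval x Q)) / aeval x Q ^ 2 :=
    hd.hE.div (le_Adj _ _ hf) (aeval_mem_Adj Q) hQ0
  have hfL : f ∈ Loc tr hQ := base_mem_Loc hf
  have hdf : d f ∈ Loc tr hQ := base_mem_Loc (hd.hN.mem f hf)
  have hμL : μ ∈ Loc tr hQ := base_mem_Loc hμ
  have hvL : v ∈ Loc tr hQ := base_mem_Loc hv
  have hQL : aeval x Q ∈ Loc tr hQ := aeval_mem_Loc Q
  have hdQL : d (aeval x Q) ∈ Loc tr hQ := der_mem_Loc hd hQL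
  rw [e1] at h
  have hl1 : aeval x Q * l ∈ Loc tr hQ := by
    refine pole_two hD hnd hl ?_
    have : aeval x Q ^ 2 * D l = aeval x Q ^ 2 *
        (μ * ((d f * aeval x Q - f * d (aeval x Q)) / aeval x Q ^ 2) + v * (f / aeval x Q) + D l)
        - (μ * (d f * aeval x Q - f * d (aeval x Q)) + v * f * aeval x Q) := by field_simp; ring
    rw [this]
    exact sub_mem (mul_mem (pow_mem hQL 2) h) (add_mem (mul_mem hμL
      (sub_mem (mul_mem hdf hQL) (mul_mem hfL hdQL))) (mul_mem (mul_mem hvL hfL) hQL))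
  have hl2 : l ∉ Loc tr hQ := by
    intro hlL
    have h1 := sub_mem h (der_mem_Loc hD hlL)
    rw [add_sub_cancel_right] at h1
    have h2 : f * d (aeval x Q) / aeval x Q ∈ Loc tr hQ := by
      have h3 : f * d (aeval x Q) / aeval x Q = d f + μ⁻¹ * (v * f - aeval x Q *
        (μ * ((d f * aeval x Q - f * d (aeval x Q)) / aeval x Q ^ 2) + v * (f / aeval x Q))) := by
        field_simp; ring
      rw [h3]
      exact add_mem hdf (mul_mem (base_mem_Loc (inv_mem hμ)) (sub_mem (mul_mem hvL hfL)
        (mul_mem hQL h1)))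
    have h3 : d (aeval x Q) / aeval x Q ∈ Loc tr hQ := by
      have := mul_mem (base_mem_Loc (tr := tr) (hp := hQ) (inv_mem hf)) h2
      have e : f⁻¹ * (f * d (aeval x Q) / aeval x Q) = d (aeval x Q) / aeval x Q := by field_simp
      rwa [e] at this
    rw [← hd.aeval_pD] at h3
    have := notMem_Loc (tr := tr) (hp := hQ) (hd.not_dvd_pD hQm h0)
      (b := 1) (fun h => hQ.not_isUnit (isUnit_of_dvd_one h)) (le_refl 1)
    rw [map_one, mul_one, pow_one] at this
    exact this h3
  obtain ⟨e, a, b, he, ha, hb, hle⟩ := pole_repr hl hl2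
  refine ⟨a, b, ha, hb, ?_⟩
  obtain ⟨e, rfl⟩ : ∃ e', e = e' + 1 := ⟨e - 1, by omega⟩
  rcases e with _ | e
  · simpa using hle
  · exfalso
    refine notMem_Loc (tr := tr) (hp := hQ) ha hb (e := e + 1) (by omega) ?_
    have hb0 := aeval_ne_zero tr (p := b) (by rintro rfl; exact hb (dvd_zero _))
    have e3 : aeval x a / (aeval x Q ^ (e + 1) * aeval x b) = aeval x Q * l := by
      rw [hle]; field_simp; ring
    rw [e3]; exact hl1

theorem local_contra {N2 : Subfield U} (hN : N ≤ N2) (hQ : Irreducible Q) (hQm : Q.Monic)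
    (hd : DExt d N x) (h2 : DExt d N2 x) (h0 : d (aeval x Q) ≠ 0) {l m : U}
    {a b : N[X]} (ha : ¬ Q ∣ a) (hb : ¬ Q ∣ b) (hl : l = aeval x a / (aeval x Q * aeval x b))
    (hm : m ∈ Adj N2 x) (hml : d m - l ∈ N2) : False := by
  set ι := Subfield.inclusion hN with hι
  have hQ' : ¬ IsUnit (Q.map ι) := by
    rw [isUnit_map]; exact hQ.not_isUnit
  obtain ⟨p, hpm, hp, hpQ⟩ := exists_monic_irreducible_factor (Q.map ι) hQ'
  have hpp := hp.prime
  obtain ⟨Q2, hQ2⟩ := hpQ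
  have hsep : (Q.map ι).Separable := hQ.separable.map
  have hpQ2 : ¬ p ∣ Q2 := by
    rintro ⟨R, hR⟩
    refine hp.not_isUnit (hsep.squarefree p ⟨R, ?_⟩)
    rw [hQ2, hR]; ring
  have hco : ∀ a : N[X], ¬ Q ∣ a → ¬ p ∣ a.map ι := by
    intro a ha hpa
    have := ((hQ.coprime_iff_not_dvd).mpr ha).map (mapRingHom ι)
    exact hp.not_isUnit (this.isUnit_of_dvd' ⟨Q2, hQ2⟩ hpa)
  have hpD : h2.pD (Q.map ι) = (hd.pD Q).map ι := by
    apply aeval_inj h2.tr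
    rw [h2.aeval_pD, aeval_map_incl, aeval_map_incl, hd.aeval_pD]
  have hnd : ¬ p ∣ h2.pD p := by
    intro h
    refine hco (hd.pD Q) (hd.not_dvd_pD hQm h0) ?_
    rw [← hpD, hQ2, h2.pD_mul]
    exact dvd_add (h.mul_right _) (dvd_mul_right _ _)
  have ha' := hco a ha
  have hb' := hco b hb
  have hQ2b : ¬ p ∣ Q2 * b.map ι := fun h => (hpp.dvd_or_dvd h).elim hpQ2 hb'
  have hp0 := aeval_ne_zero h2.tr hp.ne_zero
  have hl' : l = aeval x (a.map ι) / (aeval x p ^ 1 * aeval x (Q2 * b.map ι)) := by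
    have e1 : aeval x p * aeval x Q2 = aeval x Q := by
      rw [← map_mul, ← hQ2, aeval_map_incl]
    rw [hl, map_mul, ← mul_assoc, pow_one, e1, aeval_map_incl, aeval_map_incl]
  have hnl := notMem_Loc (tr := h2.tr) (hp := hpp) ha' hQ2b (le_refl 1)
  rw [← hl'] at hnl
  apply hnl
  have hmL : m ∈ Loc h2.tr hpp := by
    refine pole_one h2 hnd hm ?_
    have : aeval x p * d m = aeval x p * (d m - l) +
        aeval x (a.map ι) * (aeval x (Q2 * b.map ι))⁻¹ := by
      have hb0 := aeval_ne_zero h2.tr (p := Q2 * b.map ι)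
        (by intro h; rw [h] at hQ2b; exact hQ2b (dvd_zero _))
      rw [hl', pow_one]
      field_simp
      ring
    rw [this]
    exact add_mem (mul_mem (aeval_mem_Loc _) (base_mem_Loc hml))
      (mul_mem (aeval_mem_Loc _) (inv_mem_Loc hQ2b))
  have := sub_mem (der_mem_Loc h2 hmL) (base_mem_Loc (tr := h2.tr) (hp := hpp) hml)
  simpa using this

end Local

/-- auxiliary derivation over the base field with constant values on the generators -/
structure PDer {U : Type*} [Field U] (C : Subfield U) (k : ℕ) {n : ℕ → ℕ}
    (y : (i : ℕ) → Fin (n i) → U) (E : ℕ → Subfield U) (δ : U → U) : Prop where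
  hd : DerOn δ (E k)
  h0 : ∀ a ∈ E 0, δ a = 0
  hy : ∀ i < k, ∀ j, δ (y i j) ∈ C
  eig : ∀ g ∈ E k, g ≠ 0 → ∀ c ∈ E 0, δ g = c * g → c = 0

/-- linear span of the generators of level `< r` -/
def LamS {U : Type*} [Field U] (C : Subfield U) {n : ℕ → ℕ}
    (y : (i : ℕ) → Fin (n i) → U) (r : ℕ) : Submodule C U :=
  Submodule.span C {a : U | ∃ i < r, ∃ j, a = y i j}

namespace Tower
variable {U : Type*} [Field U] [CharZero U] {D : U → U} {C : Subfield U} {k : ℕ} {n : ℕ → ℕ}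
    {y : (i : ℕ) → Fin (n i) → U} {E : ℕ → Subfield U} {δ : U → U}

theorem lam_succ {r : ℕ} {μ : U} (h : μ ∈ LamS C y (r + 1)) :
    ∃ v : Fin (n r) → C, ∃ ρ ∈ LamS C y r, μ = ∑ j, (v j : U) * y r j + ρ := by
  have hset : {a : U | ∃ i < r + 1, ∃ j, a = y i j} =
      Set.range (y r) ∪ {a : U | ∃ i < r, ∃ j, a = y i j} := by
    ext a
    constructor
    · rintro ⟨i, hi, j, rfl⟩
      rcases Nat.lt_succ_iff_lt_or_eq.mp hi with h | rfl
      · exact Or.inr ⟨i, h, j, rfl⟩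
      · exact Or.inl ⟨j, rfl⟩
    · rintro (⟨j, rfl⟩ | ⟨i, hi, j, rfl⟩)
      · exact ⟨r, by omega, j, rfl⟩
      · exact ⟨i, by omega, j, rfl⟩
  rw [LamS, hset, Submodule.span_union, Submodule.mem_sup] at h
  obtain ⟨a, ha, ρ, hρ, rfl⟩ := h
  obtain ⟨v, rfl⟩ := (Submodule.mem_span_range_iff_exists_fun C).mp ha
  exact ⟨v, ρ, hρ, rfl⟩

theorem D_cmul (T : Tower D C k n y E) {c a : U} (hc : c ∈ C) : D (c * a) = c * D a := by
  rw [T.hD.mul _ trivial _ trivial, (T.hC c).mp hc]; ring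

theorem D_lam (T : Tower D C k n y E) {r : ℕ} (hr : r < k) {μ : U} (h : μ ∈ LamS C y (r + 1)) :
    D μ ∈ E r := by
  induction h using Submodule.span_induction with
  | mem a ha =>
    obtain ⟨i, hi, j, rfl⟩ := ha
    exact T.mono (by omega) hr.le (T.Dy_mem (by omega) j)
  | zero => rw [T.hD.zero]; exact zero_mem _
  | add a b _ _ ha hb => rw [T.hD.add _ trivial _ trivial]; exact add_mem ha hb
  | smul c a _ ha =>
    change D ((c : U) * a) ∈ E r
    rw [T.D_cmul c.2]
    exact mul_mem (T.hCE r hr.le c.2) ha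

theorem lam_mem (T : Tower D C k n y E) {r : ℕ} (hr : r ≤ k) {μ : U} (h : μ ∈ LamS C y r) :
    μ ∈ E r := by
  induction h using Submodule.span_induction with
  | mem a ha =>
    obtain ⟨i, hi, j, rfl⟩ := ha
    exact T.mono (by omega) hr (T.y_mem (by omega) j)
  | zero => exact zero_mem _
  | add a b _ _ ha hb => exact add_mem ha hb
  | smul c a _ ha =>
    exact mul_mem (T.hCE r hr c.2) ha

theorem P_E (T : Tower D C k n y E) (P : PDer C k y E δ) {i : ℕ} (hi : i ≤ k) :
    ∀ a ∈ E i, δ a ∈ E i := by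
  have hg := T.gen_all hi
  rw [hg]
  refine P.hd.closure_mem _ ?_ ?_
  · rw [T.gen_all le_rfl]
    refine (Set.union_subset_union_right _ ?_).trans Subfield.subset_closure
    rintro _ ⟨s, rfl⟩
    exact ⟨⟨s.1, by have := s.2; omega⟩, rfl⟩
  · rw [← hg]
    rintro a (ha | ⟨s, rfl⟩)
    · rw [P.h0 a ha]; exact zero_mem _
    · exact T.hCE i hi (P.hy _ (by have := s.2; omega) _)

theorem P_Nc (T : Tower D C k n y E) (P : PDer C k y E δ) {i : ℕ} (hi : i < k) (c : Fin (n i)) :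
    DExt δ (Nc (E i) (y i) c) (y i c) := by
  have h1 : E i ≤ E k := T.mono hi.le le_rfl
  have h2 : ∀ j, y i j ∈ E k := fun j => T.mono (by omega) le_rfl (T.y_mem hi j)
  have h3 : ((E i : Set U) ∪ y i '' {j | j ≠ c}) ⊆ E k := by
    rintro a (ha | ⟨j, -, rfl⟩)
    · exact h1 ha
    · exact h2 j
  refine DExt.of_big P.hd (Subfield.closure_le.mpr h3) (h2 c) ?_
    (le_Nc _ _ _ (T.hCE i hi.le (P.hy i hi c))) (transcendental_Nc _ _ _ (T.alg_ind hi))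
  refine P.hd.closure_mem _ h3 ?_
  rintro a (ha | ⟨j, -, rfl⟩)
  · exact le_Nc _ _ _ (T.P_E P hi.le a ha)
  · exact le_Nc _ _ _ (T.hCE i hi.le (P.hy i hi j))

theorem P_N2 (T : Tower D C k n y E) (P : PDer C k y E δ) (s : Sig n k) :
    DExt δ (Nc (E 0) (wv y k) s) (wv y k s) := by
  have h1 : E 0 ≤ E k := T.mono (Nat.zero_le k) le_rfl
  have h2 : ∀ s : Sig n k, wv y k s ∈ E k :=
    fun s => T.mono (by have := s.2; omega) le_rfl (T.y_mem s.2 _)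
  have h3 : ((E 0 : Set U) ∪ wv y k '' {j | j ≠ s}) ⊆ E k := by
    rintro a (ha | ⟨j, -, rfl⟩)
    · exact h1 ha
    · exact h2 j
  have h4 : ∀ s : Sig n k, δ (wv y k s) ∈ Nc (E 0) (wv y k) s :=
    fun s => le_Nc _ _ _ (T.hCE 0 (Nat.zero_le k) (P.hy _ s.2 _))
  refine DExt.of_big P.hd (Subfield.closure_le.mpr h3) (h2 s) ?_
    (h4 s) (transcendental_Nc _ _ _ (T.all_ind le_rfl))
  refine P.hd.closure_mem _ h3 ?_
  rintro a (ha | ⟨j, -, rfl⟩)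
  · rw [P.h0 a ha]; exact zero_mem _
  · exact le_Nc (E 0) (wv y k) s (T.hCE 0 (Nat.zero_le k) (P.hy _ j.2 _))

theorem N_le_N2 (T : Tower D C k n y E) {i : ℕ} (hi : i < k) (c : Fin (n i)) :
    Nc (E i) (y i) c ≤ Nc (E 0) (wv y k) ⟨⟨i, c⟩, hi⟩ := by
  refine Subfield.closure_le.mpr ?_
  have h1 : E i ≤ Nc (E 0) (wv y k) ⟨⟨i, c⟩, hi⟩ := by
    rw [T.gen_all hi.le]
    refine Subfield.closure_le.mpr ?_
    rintro a (ha | ⟨s, rfl⟩)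
    · exact le_Nc _ _ _ ha
    · refine mem_Nc (E 0) (wv y k) _ (i := (⟨s.1, s.2.trans hi⟩ : Sig n k)) ?_
      intro h
      have := congrArg (fun s : Sig n k => s.1.1) h
      have h2 := s.2
      simp only at this
      omega
  rintro a (ha | ⟨j, hj, rfl⟩)
  · exact h1 ha
  · refine mem_Nc (E 0) (wv y k) _ (i := (⟨⟨i, j⟩, hi⟩ : Sig n k)) ?_
    intro h
    apply hj
    have := congrArg Subtype.val h
    simpa using this

theorem core_level (T : Tower D C k n y E) (P : PDer C k y E δ) {m : U} (hm : m ∈ E k) {r : ℕ}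
    (hr : r + 1 < k) {v : Fin (n (r + 1)) → C} {ρ : U} (hρ : ρ ∈ LamS C y (r + 1))
    (h : δ (D (∑ j, (v j : U) * y (r + 1) j + ρ)) + D (δ m) = 0) (j : Fin (n (r + 1)))
    (hj : (v j : U) ≠ 0) : δ (D (y (r + 1) j)) = 0 := by
  classical
  have hEk : E (r + 1) ≤ E k := T.mono hr.le le_rfl
  have hDy : ∀ i, D (y (r + 1) i) ∈ E (r + 1) := T.Dy_mem hr
  have hDρ : D ρ ∈ E r := T.D_lam (by omega) hρ
  have hDρ' : D ρ ∈ E (r + 1) := T.le_succ (by omega) hDρ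
  have hvE : ∀ i, (v i : U) ∈ E r := fun i => T.hCE r (by omega) (v i).2
  have hvE' : ∀ i, (v i : U) ∈ E (r + 1) := fun i => T.hCE _ (by omega) (v i).2
  have e1 : D (∑ j, (v j : U) * y (r + 1) j + ρ) = ∑ j, (v j : U) * D (y (r + 1) j) + D ρ := by
    rw [T.hD.add _ trivial _ trivial, T.hD.sum _ _ (fun _ _ => trivial)]
    congr 1
    exact Finset.sum_congr rfl fun i _ => T.D_cmul (v i).2
  have e2 : δ (∑ j, (v j : U) * D (y (r + 1) j) + D ρ) =
      ∑ j, (v j : U) * δ (D (y (r + 1) j)) + δ (D ρ) := by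
    rw [P.hd.add _ (sum_mem fun i _ => mul_mem (hEk (hvE' i)) (hEk (hDy i))) _ (hEk hDρ'),
      P.hd.sum _ _ (fun i _ => mul_mem (hEk (hvE' i)) (hEk (hDy i)))]
    congr 1
    refine Finset.sum_congr rfl fun i _ => ?_
    rw [P.hd.mul _ (hEk (hvE' i)) _ (hEk (hDy i)),
      P.h0 _ (T.hCE 0 (Nat.zero_le k) (v i).2)]
    ring
  rw [e1, e2] at h
  have hδm : δ m ∈ E k := P.hd.mem m hm
  have hδDy : ∀ i, δ (D (y (r + 1) i)) ∈ E (r + 1) := fun i => T.P_E P hr.le _ (hDy i)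
  have hDδ : D (δ m) ∈ E (r + 1) := by
    have : D (δ m) = - (∑ j, (v j : U) * δ (D (y (r + 1) j)) + δ (D ρ)) := by
      linear_combination h
    rw [this]
    exact neg_mem (add_mem (sum_mem fun i _ => mul_mem (hvE' i) (hδDy i))
      (T.P_E P hr.le _ hDρ'))
  obtain ⟨u, hu, hl⟩ := T.repr_level hr (δ m) (T.drop_level hr le_rfl _ hδm hDδ) hDδ
  set l := δ m - ∑ j, u j * y (r + 1) j with hldef
  have huC : ∀ i, u i ∈ C := fun i => (T.hC _).mpr (hu i)
  have e3 : D (δ m) = ∑ j, u j * D (y (r + 1) j) + D l := by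
    have : δ m = ∑ j, u j * y (r + 1) j + l := by rw [hldef]; ring
    rw [this, T.hD.add _ trivial _ trivial, T.hD.sum _ _ (fun _ _ => trivial)]
    congr 1
    exact Finset.sum_congr rfl fun i _ => T.D_cmul (huC i)
  rw [e3] at h
  have hind := T.alg_ind (m := r) (by omega)
  obtain ⟨c, q, hq, hqm, ⟨f, hf, hf0, hfe⟩, hother⟩ := T.pole_data hr hind j
  have hdD := T.Nc_dext (by omega) c hind
  have hnd := T.Nc_not_dvd (by omega) c hdD hq hqm
  have hdδ := T.P_Nc P (i := r) (by omega) c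
  have hvN : ∀ i, (v i : U) ∈ Nc (E r) (y r) c := fun i => le_Nc _ _ _ (hvE i)
  have huN : ∀ i, u i ∈ Nc (E r) (y r) c := fun i => le_Nc _ _ _ (T.hCE r (by omega) (huC i))
  have hloc : (v j : U) * δ (f / aeval (y r c) q) + u j * (f / aeval (y r c) q) + D l ∈
      Loc (transcendental_Nc (E r) (y r) c hind) hq := by
    rw [← hfe]
    rw [← Finset.add_sum_erase _ _ (Finset.mem_univ j),
      ← Finset.add_sum_erase _ (fun i => u i * D (y (r + 1) i)) (Finset.mem_univ j)] at h
    have : (v j : U) * δ (D (y (r + 1) j)) + u j * D (y (r + 1) j) + D l =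
        - (∑ i ∈ Finset.univ.erase j, (v i : U) * δ (D (y (r + 1) i)) + δ (D ρ) +
          ∑ i ∈ Finset.univ.erase j, u i * D (y (r + 1) i)) := by
      linear_combination h
    rw [this]
    refine neg_mem (add_mem (add_mem (sum_mem fun i hi => ?_) ?_) (sum_mem fun i hi => ?_))
    · exact mul_mem (base_mem_Loc (hvN i))
        (der_mem_Loc hdδ (hother i (Finset.ne_of_mem_erase hi)))
    · exact base_mem_Loc (le_Nc _ _ _ (T.P_E P (by omega) _ hDρ))
    · exact mul_mem (base_mem_Loc (huN i)) (hother i (Finset.ne_of_mem_erase hi))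
  have hlA : l ∈ Adj (Nc (E r) (y r) c) (y r c) := by
    rw [T.Nc_adj (by omega)]; exact hl
  by_cases h0 : δ (aeval (y r c) q) = 0
  · have h1 := local_case_zero hdδ hdD hnd h0 hf hlA (hvN j) hj (huN j) hloc
    rw [hfe, h1]
    have hg0 : D (y (r + 1) j) ≠ 0 := by
      rw [hfe]
      exact div_ne_zero hf0 (aeval_ne_zero hdD.tr hq.ne_zero)
    rw [← hfe] at h1 ⊢
    have := P.eig _ (hEk (hDy j)) hg0 _ (neg_mem (div_mem (T.hCE 0 (Nat.zero_le k) (huC j))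
      (T.hCE 0 (Nat.zero_le k) (v j).2))) h1
    rw [this, zero_mul]
  · exfalso
    obtain ⟨a, b, ha, hb, hlab⟩ :=
      local_case_ne hdδ hdD hnd hqm h0 hf hf0 hlA (hvN j) hj (huN j) hloc
    have hrk : r < k := by omega
    have h2 := T.P_N2 P ⟨⟨r, c⟩, hrk⟩
    refine local_contra (T.N_le_N2 hrk c) hq.irreducible hqm hdδ h2 h0 ha hb hlab (m := m) ?_ ?_
    · have h5 := Adj_Nc (E 0) (wv y k) (⟨⟨r, c⟩, hrk⟩ : Sig n k)
      rw [← T.gen_all le_rfl] at h5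
      exact h5.ge hm
    · rw [hldef, sub_sub_cancel]
      refine sum_mem fun i _ => mul_mem (le_Nc _ _ _ (T.hCE 0 (Nat.zero_le k) (huC i))) ?_
      refine mem_Nc (E 0) (wv y k) _ (i := (⟨⟨r + 1, i⟩, hr⟩ : Sig n k)) ?_
      intro h
      have := congrArg (fun s : Sig n k => s.1.1) h
      simp at this

theorem core (T : Tower D C k n y E) (P : PDer C k y E δ) {m : U} (hm : m ∈ E k) (r : ℕ)
    (hr : r ≤ k) : ∀ μ ∈ LamS C y r, δ (D μ) + D (δ m) = 0 → δ (D μ) = 0 := by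
  induction r with
  | zero =>
    intro μ hμ _
    have : μ = 0 := by simpa [LamS] using hμ
    rw [this, T.hD.zero, P.hd.zero]
  | succ r ih =>
    intro μ hμ h
    rcases r with _ | r
    · exact P.h0 _ (T.D_lam (by omega) hμ)
    obtain ⟨v, ρ, hρ, rfl⟩ := lam_succ hμ
    have hrk : r + 1 < k := by omega
    have hj := T.core_level P hm hrk hρ h
    have hEk : E (r + 1) ≤ E k := T.mono hrk.le le_rfl
    have hvE' : ∀ i, (v i : U) ∈ E k := fun i => T.hCE _ (by omega) (v i).2
    have hDy : ∀ i, D (y (r + 1) i) ∈ E k := fun i => hEk (T.Dy_mem hrk i)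
    have hDρ : D ρ ∈ E k := T.mono (by omega) le_rfl (T.D_lam (r := r) (by omega) hρ)
    have e : δ (D (∑ j, (v j : U) * y (r + 1) j + ρ)) = δ (D ρ) := by
      have e1 : D (∑ j, (v j : U) * y (r + 1) j + ρ) =
          ∑ j, (v j : U) * D (y (r + 1) j) + D ρ := by
        rw [T.hD.add _ trivial _ trivial, T.hD.sum _ _ (fun _ _ => trivial)]
        congr 1
        exact Finset.sum_congr rfl fun i _ => T.D_cmul (v i).2
      rw [e1, P.hd.add _ (sum_mem fun i _ => mul_mem (hvE' i) (hDy i)) _ hDρ,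
        P.hd.sum _ _ (fun i _ => mul_mem (hvE' i) (hDy i)), Finset.sum_eq_zero, zero_add]
      intro i _
      rw [P.hd.mul _ (hvE' i) _ (hDy i), P.h0 _ (T.hCE 0 (Nat.zero_le k) (v i).2)]
      by_cases hv : (v i : U) = 0
      · rw [hv]; ring
      · rw [hj i hv]; ring
    rw [e] at h ⊢
    exact ih (by omega) ρ hρ h

end Tower

namespace Tower
variable {U : Type*} [Field U] [CharZero U] {D : U → U} {C : Subfield U} {k : ℕ} {n : ℕ → ℕ}
    {y : (i : ℕ) → Fin (n i) → U} {E : ℕ → Subfield U}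

theorem exists_PDer (T : Tower D C k n y E) (Θ : U →ₗ[C] C) :
    ∃ δ : U → U, PDer C k y E δ ∧ ∀ μ ∈ LamS C y k, δ μ = Θ μ := by
  have hC0 : ∀ c : C, (c : U) ∈ E 0 := fun c => T.hCE 0 (Nat.zero_le k) c.2
  obtain ⟨δ, h1, h2, h3, h4⟩ := exists_der (E 0) (wv y k) (T.all_ind le_rfl)
    (fun s => ⟨(Θ (wv y k s) : U), hC0 _⟩)
  rw [← T.gen_all le_rfl] at h1 h4
  refine ⟨δ, ⟨h1, h2, fun i hi j => ?_, h4⟩, fun μ hμ => ?_⟩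
  · have := h3 ⟨⟨i, j⟩, hi⟩
    change δ (y i j) = _ at this
    rw [this]
    exact SetLike.coe_mem _
  · induction hμ using Submodule.span_induction with
    | mem a ha =>
      obtain ⟨i, hi, j, rfl⟩ := ha
      exact h3 ⟨⟨i, j⟩, hi⟩
    | zero => rw [h1.zero, map_zero]; rfl
    | add a b ha hb iha ihb =>
      rw [h1.add _ (T.lam_mem le_rfl ha) _ (T.lam_mem le_rfl hb), iha, ihb, map_add]; rfl
    | smul c a ha iha =>
      rw [map_smul]
      change δ ((c : U) * a) = (c : U) * Θ a
      rw [h1.mul _ (T.hCE k le_rfl c.2) _ (T.lam_mem le_rfl ha), h2 _ (hC0 c), iha]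
      ring

theorem exists_functional {M : Subfield U} (hCM : C ≤ M) {x : U} (hx : x ∉ M) :
    ∃ Θ : U →ₗ[C] C, (∀ a ∈ M, Θ a = 0) ∧ Θ x = 1 := by
  let MC : Submodule C U :=
    { carrier := M
      add_mem' := fun ha hb => add_mem ha hb
      zero_mem' := zero_mem M
      smul_mem' := fun c a ha => mul_mem (hCM c.2) ha }
  obtain ⟨f, hf, hle⟩ := Submodule.exists_le_ker_of_notMem (p := MC) (v := x) hx
  refine ⟨(f x)⁻¹ • f, fun a ha => ?_, ?_⟩
  · have : f a = 0 := hle ha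
    rw [LinearMap.smul_apply, this, smul_zero]
  · rw [LinearMap.smul_apply, smul_eq_mul, inv_mul_cancel₀ hf]

theorem claim_two (T : Tower D C k n y E) (t : ℕ) : ∀ S : Set U, S ⊆ LamS C y k →
    (∀ a ∈ Subfield.closure ((E 0 : Set U) ∪ S), D a ∈ Subfield.closure ((E 0 : Set U) ∪ S)) →
    {s | wv y k s ∉ Subfield.closure ((E 0 : Set U) ∪ S)}.ncard ≤ t →
    ∀ η ∈ E k, D η ∈ Subfield.closure ((E 0 : Set U) ∪ S) →
    ∃ m ∈ Subfield.closure ((E 0 : Set U) ∪ S), ∃ μ ∈ LamS C y k, η = m + μ := by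
  induction t with
  | zero =>
    intro S hS hM hcard η hη hDη
    by_cases hE : E k ≤ Subfield.closure ((E 0 : Set U) ∪ S)
    · exact ⟨η, hE hη, 0, zero_mem _, by simp⟩
    obtain ⟨s, hs, -⟩ := T.exists_new _ (fun _ h => Subfield.subset_closure (Or.inl h)) hE
    have h0 := (Set.ncard_eq_zero (Set.toFinite _)).mp (Nat.le_zero.mp hcard)
    have : s ∈ {s | wv y k s ∉ Subfield.closure ((E 0 : Set U) ∪ S)} := hs
    rw [h0] at this
    exact absurd this (Set.notMem_empty _)
  | succ t ih =>
    intro S hS hM hcard η hη hDη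
    by_cases hE : E k ≤ Subfield.closure ((E 0 : Set U) ∪ S)
    · exact ⟨η, hE hη, 0, zero_mem _, by simp⟩
    obtain ⟨s, hs, hDs⟩ := T.exists_new _ (fun _ h => Subfield.subset_closure (Or.inl h)) hE
    set M := Subfield.closure ((E 0 : Set U) ∪ S) with hMdef
    set x := wv y k s with hx
    have hxL : x ∈ LamS C y k := Submodule.subset_span ⟨s.1.1, s.2, s.1.2, rfl⟩
    have hE0M : E 0 ≤ M := fun _ h => Subfield.subset_closure (Or.inl h)
    have hSM : S ⊆ M := fun _ h => Subfield.subset_closure (Or.inr h)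
    have hCM : C ≤ M := (T.hCE 0 (Nat.zero_le k)).trans hE0M
    have hLE : ∀ a ∈ LamS C y k, a ∈ E k := fun a ha => T.lam_mem le_rfl ha
    have hgE : ((E 0 : Set U) ∪ S) ⊆ E k := by
      rintro a (ha | ha)
      · exact T.mono (Nat.zero_le k) le_rfl ha
      · exact hLE a (hS ha)
    have hME : M ≤ E k := Subfield.closure_le.mpr hgE
    have hxE : x ∈ E k := hLE x hxL
    have hM' : Subfield.closure ((E 0 : Set U) ∪ insert x S) = Adj M x := by
      apply le_antisymm
      · refine Subfield.closure_le.mpr ?_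
        rintro a (ha | rfl | ha)
        · exact le_Adj _ _ (hE0M ha)
        · exact self_mem_Adj _ _
        · exact le_Adj _ _ (hSM ha)
      · refine Adj_le ?_ (Subfield.subset_closure (Or.inr (Set.mem_insert _ _)))
        exact Subfield.closure_mono (Set.union_subset_union_right _ (Set.subset_insert _ _))
    have hAE : Adj M x ≤ E k := Adj_le hME hxE
    have hIH := ih (insert x S) (Set.insert_subset hxL hS)
    rw [hM'] at hIH
    obtain ⟨m, hm, μ, hμ, rfl⟩ := hIH (adj_der T.hD hM hDs) (by
      have : {s | wv y k s ∉ Adj M x} ⊂ {s | wv y k s ∉ M} := by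
        refine ⟨fun s hs h => hs (le_Adj _ _ h), fun h => ?_⟩
        exact h (a := s) hs (self_mem_Adj _ _)
      have := Set.ncard_lt_ncard this (Set.toFinite _)
      omega) η hη (le_Adj _ _ hDη)
    obtain ⟨Θ, hΘM, hΘx⟩ := exists_functional hCM hs
    obtain ⟨δ, P, hδΘ⟩ := T.exists_PDer Θ
    have hδx : δ x = 1 := by rw [hδΘ x hxL, hΘx]; rfl
    have hzero : ∀ L : Subfield U, DerOn (fun _ : U => (0 : U)) L := fun L =>
      ⟨fun _ _ => zero_mem L, fun _ _ _ _ => by simp, fun _ _ _ _ => by simp⟩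
    have hδM : ∀ a ∈ M, δ a = 0 := by
      refine P.hd.ext_closure (hzero _) _ hgE ?_
      rintro a (ha | ha)
      · exact P.h0 a ha
      · rw [hδΘ a (hS ha), hΘM a (hSM ha)]; rfl
    have hDE := T.hEd k le_rfl
    have hδE := P.hd.mem
    have hε : DerOn (fun a => δ (D a) - D (δ a)) (E k) := by
      refine ⟨fun a ha => sub_mem (hδE _ (hDE a ha)) (hDE _ (hδE a ha)), fun a ha b hb => ?_,
        fun a ha b hb => ?_⟩
      · rw [T.hD.add _ trivial _ trivial, P.hd.add _ ha _ hb, T.hD.add _ trivial _ trivial,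
          P.hd.add _ (hDE a ha) _ (hDE b hb)]
        ring
      · rw [T.hD.mul _ trivial _ trivial, P.hd.mul _ ha _ hb, T.hD.add _ trivial _ trivial,
          P.hd.add _ (mul_mem (hDE a ha) hb) _ (mul_mem ha (hDE b hb)),
          P.hd.mul _ (hDE a ha) _ hb, P.hd.mul _ ha _ (hDE b hb),
          T.hD.mul _ trivial _ trivial, T.hD.mul _ trivial _ trivial]
        ring
    have hcomm : ∀ a ∈ Adj M x, δ (D a) = D (δ a) := by
      intro a ha
      rw [← hM'] at ha
      have h1 : ∀ a ∈ M, δ (D a) - D (δ a) = 0 := fun a ha => by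
        rw [hδM _ (hM a ha), hδM a ha, T.hD.zero, sub_zero]
      refine sub_eq_zero.mp (hε.ext_closure (hzero _) _ ?_ ?_ a ha)
      · rintro a (ha | rfl | ha)
        · exact hgE (Or.inl ha)
        · exact hxE
        · exact hgE (Or.inr ha)
      · rintro a (ha | rfl | ha)
        · exact h1 a (hE0M ha)
        · show δ (D x) - D (δ x) = 0
          rw [hδM _ hDs, hδx, T.hD.one, sub_zero]
        · exact h1 a (hSM ha)
    have hmE := hAE hm
    have hμE := hLE μ hμ
    have hDA := adj_der T.hD hM hDs
    have e1 : δ (D μ) + D (δ m) = 0 := by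
      rw [← hcomm m hm, add_comm, ← P.hd.add _ (hDE m hmE) _ (hDE μ hμE),
        ← T.hD.add _ trivial _ trivial]
      exact hδM _ hDη
    have e2 := T.core P hmE k le_rfl μ hμ e1
    have hdx : DExt δ M x := DExt.of_big P.hd hME hxE
      (fun a ha => by rw [hδM a ha]; exact zero_mem _) (by rw [hδx]; exact one_mem _)
      (mk_dext T.hD hM (fun a ha => hE0M (T.const_mem (Nat.zero_le k) a ha)) hDs hs).tr
    rw [e2, zero_add] at e1
    have hcC : δ m ∈ C := (T.hC _).mpr e1
    refine ⟨m - δ m * x, ?_, δ m * x + μ, ?_, by ring⟩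
    · refine ker_der hdx hδM hδx
        (sub_mem hm (mul_mem (le_Adj _ _ (hCM hcC)) (self_mem_Adj _ _))) ?_
      rw [P.hd.sub hmE (mul_mem (hME (hCM hcC)) hxE),
        P.hd.mul _ (hME (hCM hcC)) _ hxE, hδx, hδM _ (hCM hcC)]
      ring
    · exact add_mem (Submodule.smul_mem _ (⟨δ m, hcC⟩ : C) hxL) hμ

theorem main (T : Tower D C k n y E) (K : Subfield U) (hFK : E 0 ≤ K) (hKE : K ≤ E k)
    (hK : ∀ a ∈ K, D a ∈ K) :
    K = Subfield.closure ((E 0 : Set U) ∪ ((K : Set U) ∩ LamS C y k)) := by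
  let S : Set U := {a | ∃ V : Set U, V ⊆ (K : Set U) ∩ LamS C y k ∧
    (∀ b ∈ V, D b ∈ Subfield.closure ((E 0 : Set U) ∪ V)) ∧ a ∈ V}
  have hS : S ⊆ (K : Set U) ∩ LamS C y k := fun a ⟨V, hV, _, ha⟩ => hV ha
  set M := Subfield.closure ((E 0 : Set U) ∪ S) with hM
  have hE0M : E 0 ≤ M := fun _ h => Subfield.subset_closure (Or.inl h)
  have hMK : M ≤ K := by
    refine Subfield.closure_le.mpr ?_
    rintro a (ha | ha)
    · exact hFK ha
    · exact (hS ha).1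
  have hSD : ∀ b ∈ S, D b ∈ M := by
    rintro b ⟨V, hV, hVD, hb⟩
    refine Subfield.closure_mono (Set.union_subset_union_right _ ?_) (hVD b hb)
    exact fun a ha => ⟨V, hV, hVD, ha⟩
  have hMD : ∀ a ∈ M, D a ∈ M := by
    refine T.hD.closure_mem _ (fun _ _ => trivial) ?_
    rintro a (ha | ha)
    · exact hE0M (T.hEd 0 (Nat.zero_le k) a ha)
    · exact hSD a ha
  have hcl : ∀ a ∈ K, D a ∈ M → a ∈ M := by
    intro a ha hDa
    obtain ⟨m, hm, μ, hμ, rfl⟩ := T.claim_two _ S (fun a ha => (hS ha).2) hMD le_rfl a (hKE ha) hDa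
    have hμK : μ ∈ K := by
      have := sub_mem ha (hMK hm)
      simpa using this
    have hDμ : D μ ∈ M := by
      have := sub_mem hDa (hMD m hm)
      rw [T.hD.add _ trivial _ trivial] at this
      simpa using this
    refine add_mem hm (Subfield.subset_closure (Or.inr ?_))
    have hle : M ≤ Subfield.closure ((E 0 : Set U) ∪ insert μ S) :=
      Subfield.closure_mono (Set.union_subset_union_right _ (Set.subset_insert _ _))
    refine ⟨insert μ S, Set.insert_subset ⟨hμK, hμ⟩ hS, ?_, Set.mem_insert _ _⟩
    rintro b (rfl | hb)
    · exact hle hDμ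
    · exact hle (hSD b hb)
  apply le_antisymm
  · refine (closed_eq T.hD (wv y k) (F := E 0) (E := E k)
      (fun a ha => T.const_mem (Nat.zero_le k) a ha)
      (fun s => T.mono (by have := s.2; omega) le_rfl (T.y_mem s.2 _))
      (fun M hM _ hE => T.exists_new M hM hE) _ M K le_rfl hE0M hMK hKE hMD hK hcl).trans ?_
    exact Subfield.closure_mono (Set.union_subset_union_right _ hS)
  · refine Subfield.closure_le.mpr ?_
    rintro a (ha | ha)
    · exact hFK ha
    · exact ha.1

end Tower

end JIEProof

/-- **Classification of differential subfields of a J-I-E tower.**  Let `F` be a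
characteristic-zero differential field with algebraically closed field of constants
`C`, and let `F = E₀ ⊆ E₁ ⊆ ⋯ ⊆ E_k` be a tower of differential fields (all with
constants `C`) where `E₁` is generated by algebraically independent antiderivatives
`y₀ⱼ` of `F`, and for `i ≥ 1` the field `E_{i+1}` is generated over `E_i` by J-I-E
antiderivatives `yᵢⱼ`: each `yᵢⱼ' = Aⱼ/(Cⱼ·Bⱼ)` with `Aⱼ, Bⱼ, Cⱼ` pairwise
relatively prime polynomials in `E_{i-1}[y_{i-1,1},…]` satisfying conditions C1 and
C2.  Writing `Λ_k` for the `C`-linear span of all the `yᵢⱼ`, every intermediate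
field `F ⊆ K ⊆ E_k` closed under the derivation satisfies `K = F(K ∩ Λ_k)`. -/
theorem jie_tower_intermediate_field_structure
    {U : Type*} [Field U] [CharZero U]
    (D : U → U) (hD : IsDerivation D)
    (C : Subfield U) (hC : ∀ c : U, c ∈ C ↔ D c = 0)
    [IsAlgClosed C]
    (F : Subfield U) (hF : ∀ a ∈ F, D a ∈ F) (hCF : C ≤ F)
    {k : ℕ} (hk : 0 < k)
    (n : ℕ → ℕ) (y : (i : ℕ) → Fin (n i) → U)
    (Etow : ℕ → Subfield U) (hE0 : Etow 0 = F)
    (hEdiff : ∀ i ≤ k, ∀ a ∈ Etow i, D a ∈ Etow i)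
    (hEconst : ∀ i ≤ k, C ≤ Etow i)
    (hgen : ∀ i < k, Etow (i + 1) = Subfield.closure (↑(Etow i) ∪ Set.range (y i)))
    (hlevel1deriv : ∀ j, D (y 0 j) ∈ F)
    (hlevel1ind : AlgebraicIndependent F (y 0))
    (hJIE : ∀ m, 1 ≤ m → m < k →
      ∃ A B Cc : Fin (n m) → MvPolynomial (Fin (n (m - 1))) (Etow (m - 1)),
        (∀ j, IsRelPrime (A j) (B j)) ∧
        (∀ j, IsRelPrime (A j) (Cc j)) ∧
        (∀ j, IsRelPrime (B j) (Cc j)) ∧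
        -- condition C1
        (∀ j, Irreducible (Cc j)) ∧
        (∀ j j', j ≠ j' → ¬ Cc j ∣ Cc j') ∧
        (∀ j j', ¬ Cc j ∣ B j') ∧
        -- condition C2
        (∀ j, ∃ c : Fin (n (m - 1)),
          MvPolynomial.pderiv c (Cc j) ≠ 0 ∧
          MvPolynomial.pderiv c (A j) = 0 ∧ MvPolynomial.pderiv c (B j) = 0) ∧
        (∀ j, D (y m j) =
          MvPolynomial.aeval (y (m - 1)) (A j) /
            (MvPolynomial.aeval (y (m - 1)) (Cc j) *
              MvPolynomial.aeval (y (m - 1)) (B j))))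
    (K : Subfield U) (hFK : F ≤ K) (hKE : K ≤ Etow k) (hK : ∀ a ∈ K, D a ∈ K) :
    K = Subfield.closure
      (↑F ∪ (↑K ∩ (Submodule.span C {a : U | ∃ i < k, ∃ j, a = y i j} : Set U))) := by
  subst hE0
  have T : Tower D C k n y Etow :=
    { hD := ⟨fun _ _ => trivial, fun a _ b _ => hD.map_add a b, fun a _ b _ => hD.leibniz a b⟩
      hC := hC
      hCE := hEconst
      hEd := hEdiff
      hgen := hgen
      hder0 := hlevel1deriv
      hind0 := hlevel1ind
      hJ := fun m hm => by
        obtain ⟨A, B, Cc, -, h2, -, h4, h5, h6, h7, h8⟩ := hJIE (m + 1) (by omega) hm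
        refine ⟨A, B, Cc, fun j h => ?_, fun j h => ?_, h4, h5, h6, h7, h8⟩
        · have h9 := h2 j
          rw [h] at h9
          exact (h4 j).not_isUnit (h9 (dvd_zero _) dvd_rfl)
        · apply h6 j j
          rw [h]
          exact dvd_zero _ }
  exact T.main K hFK hKE hK
end

section
/- Let F be a characteristic-zero differential field whose field of constants C is algebraically closed, and let U ⊇ F be a no-new-constants differential field extension. Let S ⊆ U be a finite set of antiderivatives of F (y′ ∈ F for every y ∈ S) that is algebraically independent over F. Let w_1,…,w_s ∈ U and suppose that for each j there exist y_j ∈ S and c_j ∈ C such that w_j′ = y_j′/(y_j + c_j), where the pairs (y_1,c_1),…,(y_s,c_s) are pairwise distinct. Then w_1,…,w_s are algebraically independent over F(S). -/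
namespace LogInd
open Polynomial Differential

set_option linter.unusedSectionVars false

section generic
variable {M U : Type*} [Field M] [Field U] [CharZero U] [Algebra M U]
  [Differential M] [Differential U] [DifferentialAlgebra M U]

lemma deriv_poly (t : U) (τ : M) (ht : t′ = algebraMap M U τ) (P : M[X]) :
    (aeval t P)′ = aeval t (implicitDeriv (C τ) P) :=
  deriv_aeval_eq_implicitDeriv t (C τ) (by simpa using ht) P

lemma coeff_implicitDeriv (τ : M) (P : M[X]) (n : ℕ) :
    (implicitDeriv (C τ) P).coeff n = (P.coeff n)′ + τ * (P.coeff (n+1) * (n+1)) := by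
  simp [implicitDeriv, coeff_derivative]

lemma degree_implicitDeriv (τ : M) (P : M[X]) (hP : P.Monic) :
    (implicitDeriv (C τ) P).degree < P.degree := by
  rw [degree_eq_natDegree hP.ne_zero, degree_lt_iff_coeff_zero]
  intro m hm
  rw [coeff_implicitDeriv]
  have h1 : P.coeff (m+1) = 0 := coeff_eq_zero_of_natDegree_lt (by lia)
  rw [h1]
  rcases hm.eq_or_lt with h | h
  · rw [← h, hP.coeff_natDegree]; simp
  · rw [coeff_eq_zero_of_natDegree_lt h]; simp

lemma algebraic_case (hN : ∀ u : U, u′ = 0 → u ∈ Set.range (algebraMap M U))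
    (x : U) (hx : IsAlgebraic M x) (τ : M) (ht : x′ = algebraMap M U τ) :
    x ∈ Set.range (algebraMap M U) := by
  have hi : IsIntegral M x := hx.isIntegral
  have hm := minpoly.monic hi
  set p := minpoly M x with hp
  have h0 : implicitDeriv (C τ) p = 0 := by
    by_contra hne
    have := minpoly.degree_le_of_ne_zero M x hne (by
      rw [← deriv_poly x τ ht, hp, minpoly.aeval, map_zero])
    exact absurd (degree_implicitDeriv τ p hm) (not_lt.mpr this)
  have hpos : 0 < p.natDegree := minpoly.natDegree_pos hi
  obtain ⟨n, hn⟩ : ∃ n, p.natDegree = n + 1 := ⟨p.natDegree - 1, by lia⟩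
  have h1 := coeff_implicitDeriv τ p n
  rw [h0, ← hn, hm.coeff_natDegree, coeff_zero] at h1
  have hn0 : ((n : U) + 1) ≠ 0 := by exact_mod_cast Nat.succ_ne_zero n
  obtain ⟨a, ha⟩ := hN (algebraMap M U (p.coeff n) + ((n + 1 : ℕ) : U) * x) (by
    rw [map_add, deriv_algebraMap, Derivation.leibniz, Derivation.map_natCast, ht]
    have h2 := congrArg (algebraMap M U) h1
    simp only [map_zero, map_add, map_mul, map_one, map_natCast] at h2
    simp only [smul_eq_mul, Nat.cast_add, Nat.cast_one]
    linear_combination -h2)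
  refine ⟨(a - p.coeff n) / ((n : M) + 1), ?_⟩
  simp only [map_div₀, map_sub, map_add, map_natCast, map_one]
  rw [div_eq_iff hn0, ha]; push_cast; ring

lemma exists_rep (t : U) (ht : Transcendental M t) (A B : M[X]) :
    ∃ P Q : M[X], Q.Monic ∧ IsCoprime P Q ∧ aeval t A / aeval t B = aeval t P / aeval t Q := by
  classical
  have hinj := transcendental_iff_injective.mp ht
  by_cases hB : B = 0
  · exact ⟨0, 1, monic_one, isCoprime_one_right, by simp [hB]⟩
  set g := EuclideanDomain.gcd A B with hg
  have hg0 : g ≠ 0 := fun h => hB (EuclideanDomain.gcd_eq_zero_iff.mp h).2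
  obtain ⟨P, hP⟩ := EuclideanDomain.gcd_dvd_left A B
  obtain ⟨Q, hQ⟩ := EuclideanDomain.gcd_dvd_right A B
  rw [← hg] at hP hQ
  have hQ0 : Q ≠ 0 := by rintro rfl; simp at hQ; exact hB hQ
  have hco : IsCoprime P Q := by
    have := EuclideanDomain.gcd_eq_gcd_ab A B
    refine ⟨EuclideanDomain.gcdA A B, EuclideanDomain.gcdB A B, ?_⟩
    apply mul_left_cancel₀ hg0
    rw [← hg] at this
    calc _ = (g * P) * EuclideanDomain.gcdA A B + (g * Q) * EuclideanDomain.gcdB A B := by ring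
      _ = g * 1 := by rw [← hP, ← hQ, ← this, mul_one]
  have hl : Q.leadingCoeff ≠ 0 := leadingCoeff_ne_zero.mpr hQ0
  have hu : IsUnit (C Q.leadingCoeff⁻¹) := by simpa using hl
  have hgt : aeval t g ≠ 0 := fun h => hg0 (hinj (by simpa using h))
  have hcl : algebraMap M U Q.leadingCoeff⁻¹ ≠ 0 := by simpa using hl
  refine ⟨P * C Q.leadingCoeff⁻¹, Q * C Q.leadingCoeff⁻¹, monic_mul_leadingCoeff_inv hQ0, ?_, ?_⟩
  · rw [isCoprime_mul_unit_right_left hu, isCoprime_mul_unit_right_right hu]; exact hco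
  · conv_lhs => rw [hP, hQ]
    simp only [map_mul, aeval_C]
    rw [mul_div_mul_left _ _ hgt, mul_div_mul_right _ _ hcl]

lemma linear_case (hN : ∀ u : U, u′ = 0 → u ∈ Set.range (algebraMap M U))
    (t : U) (htr : Transcendental M t) (τ : M) (ht : t′ = algebraMap M U τ)
    (A B : M[X]) (m : M) (hv : (aeval t A / aeval t B)′ = algebraMap M U m) :
    ∃ e b : M, e′ = 0 ∧ aeval t A / aeval t B = algebraMap M U e * t + algebraMap M U b := by
  have hinj := transcendental_iff_injective.mp htr
  have : CharZero M := (algebraMap M U).charZero_iff (algebraMap M U).injective |>.mpr inferInstance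
  obtain ⟨P, Q, hQ, hco, hrep⟩ := exists_rep t htr A B
  rw [hrep] at hv ⊢
  have hQt : aeval t Q ≠ 0 := fun h => hQ.ne_zero (hinj (by simpa using h))
  set δ := implicitDeriv (C τ) with hδ
  have e1 : δ P * Q - P * δ Q = C m * Q ^ 2 := by
    apply hinj
    have h2 : (aeval t P)′ = (aeval t P / aeval t Q * aeval t Q)′ := by
      rw [div_mul_cancel₀ _ hQt]
    rw [Derivation.leibniz, hv, deriv_poly t τ ht, deriv_poly t τ ht] at h2
    simp only [smul_eq_mul] at h2
    simp only [map_sub, map_mul, map_pow, aeval_C]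
    rw [h2]
    field_simp
    ring
  have hdvd : Q ∣ δ Q := by
    apply hco.symm.dvd_of_dvd_mul_left
    exact ⟨δ P - C m * Q, by linear_combination -e1⟩
  have hz : δ Q = 0 := by
    by_contra hne
    exact absurd (degree_le_of_dvd hdvd hne) (not_le.mpr (degree_implicitDeriv τ Q hQ))
  obtain ⟨a, ha⟩ := hN (aeval t Q) (by rw [deriv_poly t τ ht, ← hδ, hz, map_zero])
  have hQC : Q = C a := hinj (by simp [ha])
  have hQ1 : Q = 1 := by
    rw [hQC] at hQ ⊢
    have : a = 1 := by simpa [Monic] using hQ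
    rw [this, map_one]
  rw [hQ1] at e1 ⊢
  have e2 : δ P = C m := by
    have : δ 1 = 0 := Derivation.map_one_eq_zero _
    simpa [this] using e1
  have hcoef : ∀ n, (P.coeff n)′ + τ * (P.coeff (n+1) * (n+1)) = (C m).coeff n := fun n => by
    rw [← coeff_implicitDeriv, ← hδ, e2]
  have hdeg : P.natDegree ≤ 1 := by
    by_contra hlt
    obtain ⟨k, hk⟩ : ∃ k, P.natDegree = k + 2 := ⟨P.natDegree - 2, by lia⟩
    have hl : P.coeff (k+2) ≠ 0 := by
      rw [← hk]; exact leadingCoeff_ne_zero.mpr (by rintro rfl; simp at hk)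
    have h3 := hcoef (k+2)
    rw [coeff_eq_zero_of_natDegree_lt (by lia : P.natDegree < k+2+1), coeff_C] at h3
    have h4 := hcoef (k+1)
    rw [coeff_C] at h4
    simp at h3 h4
    obtain ⟨a, ha⟩ := hN (algebraMap M U (P.coeff (k+1)) +
        ((k+2 : ℕ) : U) * (algebraMap M U (P.coeff (k+2)) * t)) (by
      have h5 := congrArg (algebraMap M U) h4
      simp only [map_zero, map_add, map_mul, map_one, map_natCast] at h5
      rw [map_add, deriv_algebraMap, Derivation.leibniz, Derivation.leibniz,
        Derivation.map_natCast, ht, deriv_algebraMap, h3]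
      simp only [smul_eq_mul, map_zero]
      simp only [Nat.cast_add, Nat.cast_ofNat]
      linear_combination h5)
    have h6 : C (P.coeff (k+1)) + ((k+2 : ℕ) : M[X]) * (C (P.coeff (k+2)) * X) = C a :=
      hinj (by simp only [map_add, map_mul, aeval_C, aeval_X, map_natCast, ha])
    have h7 := congrArg (fun q => coeff q 1) h6
    rw [← C_eq_natCast] at h7
    simp only [coeff_add, coeff_C_mul, coeff_C, coeff_X] at h7
    simp at h7
    rcases h7 with h7 | h7
    · exact absurd h7 (by exact_mod_cast (by lia : k + 2 ≠ 0))
    · exact hl h7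
  refine ⟨P.coeff 1, P.coeff 0, ?_, ?_⟩
  · have := hcoef 1
    rw [coeff_eq_zero_of_natDegree_lt (by lia : P.natDegree < 1 + 1), coeff_C] at this
    simpa using this
  · conv_lhs => rw [eq_X_add_C_of_natDegree_le_one hdeg]
    simp

/-- regular at `X = a` -/
def Reg (t : U) (a : M) (h : U) : Prop :=
  ∃ A B : M[X], B.eval a ≠ 0 ∧ h = aeval t A / aeval t B

lemma Reg.add {t : U} (ht : Transcendental M t) {a : M} {h k : U} (hh : Reg t a h)
    (hk : Reg t a k) : Reg t a (h + k) := by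
  have hinj := transcendental_iff_injective.mp ht
  obtain ⟨A, B, hB, rfl⟩ := hh
  obtain ⟨A', B', hB', rfl⟩ := hk
  have h1 : aeval t B ≠ 0 := fun h => hB (by
    rw [show B = 0 from hinj (by simpa using h)]; simp)
  have h2 : aeval t B' ≠ 0 := fun h => hB' (by
    rw [show B' = 0 from hinj (by simpa using h)]; simp)
  refine ⟨A * B' + B * A', B * B', by simp [hB, hB'], ?_⟩
  rw [div_add_div _ _ h1 h2]; simp

lemma Reg.sum {t : U} (ht : Transcendental M t) {a : M} {ι : Type*} (s : Finset ι) (f : ι → U)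
    (hf : ∀ i ∈ s, Reg t a (f i)) : Reg t a (∑ i ∈ s, f i) := by
  classical
  induction s using Finset.induction_on with
  | empty => exact ⟨0, 1, by simp, by simp⟩
  | insert i s hi ih =>
    rw [Finset.sum_insert hi]
    exact (hf i (by simp)).add ht (ih fun j hj => hf j (by simp [hj]))

lemma pole_case (t : U) (htr : Transcendental M t) (τ : M) (hτ : τ ≠ 0)
    (ht : t′ = algebraMap M U τ) (a d : M) (ha : a′ = 0) (hd : d ≠ 0) (h : U) (hh : Reg t a h)
    (A₀ B₀ : M[X])
    (hv : (aeval t A₀ / aeval t B₀)′ = algebraMap M U d / (t - algebraMap M U a) + h) : False := by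
  have hinj := transcendental_iff_injective.mp htr
  have : CharZero M := (algebraMap M U).charZero_iff (algebraMap M U).injective |>.mpr inferInstance
  obtain ⟨P, Q, hQ, hco, hrep⟩ := exists_rep t htr A₀ B₀
  rw [hrep] at hv
  obtain ⟨A, B, hB, rfl⟩ := hh
  have hne : ∀ R : M[X], R ≠ 0 → aeval t R ≠ 0 := fun R hR h => hR (hinj (by simpa using h))
  have hQt := hne Q hQ.ne_zero
  have hBt := hne B (by rintro rfl; simp at hB)
  set p : M[X] := X - C a with hp
  have hpt' : aeval t p = t - algebraMap M U a := by simp [hp]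
  have hpt := hne p (X_sub_C_ne_zero a)
  set δ := implicitDeriv (C τ) with hδ
  have hδp : δ p = C τ := by simp [hp, hδ, ha]
  have hpp : Prime p := prime_X_sub_C a
  have hB' : ¬ p ∣ B := fun h => hB (dvd_iff_isRoot.mp h)
  have hC : ∀ x : M, x ≠ 0 → ¬ p ∣ C x := fun x hx h => hx (by
    simpa using (dvd_iff_isRoot.mp h))
  rw [← hpt'] at hv
  have e1 : (δ P * Q - P * δ Q) * (p * B) = Q ^ 2 * (C d * B + p * A) := by
    apply hinj
    have h2 : (aeval t P)′ = (aeval t P / aeval t Q * aeval t Q)′ := by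
      rw [div_mul_cancel₀ _ hQt]
    rw [Derivation.leibniz, hv, deriv_poly t τ ht, deriv_poly t τ ht] at h2
    simp only [smul_eq_mul] at h2
    simp only [map_sub, map_add, map_mul, map_pow, aeval_C]
    rw [h2]
    field_simp
    ring
  have hnd : ¬ p ∣ C d * B + p * A := by
    rw [dvd_add_left (dvd_mul_right _ _)]
    intro h
    rcases hpp.dvd_or_dvd h with h | h
    exacts [hC d hd h, hB' h]
  obtain ⟨R, hR, hpR⟩ := exists_eq_pow_rootMultiplicity_mul_and_not_dvd Q hQ.ne_zero a
  rw [← hp] at hR hpR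
  generalize Q.rootMultiplicity a = n at hR
  rcases n with _ | n
  · simp only [pow_zero, one_mul] at hR
    have : p ∣ Q ^ 2 * (C d * B + p * A) := by rw [← e1]; exact ⟨(δ P * Q - P * δ Q) * B, by ring⟩
    rcases hpp.dvd_or_dvd this with h | h
    · exact hpR (hR ▸ hpp.dvd_of_dvd_pow h)
    · exact hnd h
  · have hpP : ¬ p ∣ P := fun h => by
      have hpQ : p ∣ Q := by rw [hR, pow_succ]; exact ⟨p ^ n * R, by ring⟩
      exact hpp.not_isUnit (hco.isUnit_of_dvd' h hpQ)
    have e3 : δ Q = p ^ n * (((n + 1 : ℕ) : M[X]) * C τ * R + p * δ R) := by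
      rw [hR, Derivation.leibniz, Derivation.leibniz_pow, hδp]
      simp only [smul_eq_mul, nsmul_eq_mul, Nat.add_sub_cancel]
      ring
    rw [e3] at e1
    have e4 : p ^ (n+1) * (p * (δ P * R * B - P * δ R * B) - ((n+1 : ℕ) : M[X]) * C τ * R * P * B)
        = p ^ (n+1) * (p * (p ^ n * R ^ 2 * (C d * B + p * A))) := by
      rw [hR] at e1
      linear_combination e1
    have e5 := mul_left_cancel₀ (pow_ne_zero _ hpp.ne_zero) e4
    have : p ∣ ((n+1 : ℕ) : M[X]) * C τ * R * P * B :=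
      ⟨(δ P * R * B - P * δ R * B) - p ^ n * R ^ 2 * (C d * B + p * A),
        by linear_combination -e5⟩
    rw [← C_eq_natCast] at this
    rcases hpp.dvd_or_dvd this with h | h
    · rcases hpp.dvd_or_dvd h with h | h
      · rcases hpp.dvd_or_dvd h with h | h
        · rcases hpp.dvd_or_dvd h with h | h
          · exact hC _ (by exact_mod_cast Nat.succ_ne_zero n) h
          · exact hC _ hτ h
        · exact hpR h
      · exact hpP h
    · exact hB' h

end generic

section subfields
variable {U : Type*} [Field U]

/-- the differential structure on a differential subfield -/
@[reducible] noncomputable def diffSub [Differential U] (K : Subfield U)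
    (hK : ∀ a ∈ K, a′ ∈ K) : Differential K where
  deriv := Derivation.mk' (AddMonoidHom.toIntLinearMap
    { toFun := fun a => (⟨(a : U)′, hK a a.2⟩ : K)
      map_zero' := by ext; simp
      map_add' := fun a b => by ext; simp }) (fun a b => by ext; simp)

lemma diffSub_alg [Differential U] (K : Subfield U) (hK : ∀ a ∈ K, a′ ∈ K) :
    let := diffSub K hK
    DifferentialAlgebra K U :=
  let := diffSub K hK
  ⟨fun _ => rfl⟩

lemma closure_closed [Differential U] (s : Set U) (hs : ∀ a ∈ s, a′ ∈ Subfield.closure s) :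
    ∀ a ∈ Subfield.closure s, a′ ∈ Subfield.closure s := by
  intro a ha
  induction ha using Subfield.closure_induction with
  | mem x hx => exact hs x hx
  | one => simp
  | add x y hx hy h1 h2 => rw [map_add]; exact add_mem h1 h2
  | neg x hx h1 => rw [map_neg]; exact neg_mem h1
  | inv x hx h1 =>
    rw [Derivation.leibniz_inv, smul_eq_mul]
    exact mul_mem (neg_mem (pow_mem (inv_mem hx) _)) h1
  | mul x y hx hy h1 h2 =>
    rw [Derivation.leibniz, smul_eq_mul, smul_eq_mul]
    exact add_mem (mul_mem hx h2) (mul_mem hy h1)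

lemma mem_closure_simple (K : Subfield U) (t x : U)
    (hx : x ∈ Subfield.closure ((K : Set U) ∪ {t})) :
    ∃ A B : K[X], x = aeval t A / aeval t B := by
  rw [← IntermediateField.mem_adjoin_simple_iff]
  have : Subfield.closure ((K : Set U) ∪ {t}) ≤ (IntermediateField.adjoin K {t}).toSubfield := by
    rw [Subfield.closure_le]
    rintro y (hy | hy)
    · exact (IntermediateField.adjoin K {t}).algebraMap_mem ⟨y, hy⟩
    · exact IntermediateField.subset_adjoin K {t} hy
  exact this hx

theorem ostrowski [CharZero U] [Differential U] : ∀ (n : ℕ) (K : Subfield U)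
    (_ : ∀ a ∈ K, a′ ∈ K) (_ : ∀ u : U, u′ = 0 → u ∈ K) (w : Fin n → U) (_ : ∀ i, (w i)′ ∈ K)
    (_ : ∀ e : Fin n → U, (∀ i, (e i)′ = 0) → ∑ i, e i * w i ∈ K → e = 0),
    AlgebraicIndependent K w := by
  intro n
  induction n with
  | zero =>
    intro K _ _ w _ _
    exact algebraicIndependent_empty_type_iff.mpr (algebraMap K U).injective
  | succ n ih =>
    intro K hK hN w hw hlin
    let := diffSub K hK
    have := diffSub_alg K hK
    have hN' : ∀ u : U, u′ = 0 → u ∈ Set.range (algebraMap K U) := fun u hu => ⟨⟨u, hN u hu⟩, rfl⟩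
    set t := w 0 with ht
    have htr : Transcendental K t := by
      intro halg
      obtain ⟨a, ha⟩ := algebraic_case hN' t halg ⟨t′, hw 0⟩ rfl
      have := hlin (Pi.single 0 1) (fun i => by
        by_cases h : i = 0
        · subst h; simp
        · simp [h]) (by
        simp only [Fin.sum_univ_succ]
        simp
        rw [← ht, ← ha]; exact a.2)
      have := congrFun this 0
      simp at this
    set K1 := Subfield.closure ((K : Set U) ∪ {t}) with hK1
    have hle : K ≤ K1 := fun x hx => Subfield.subset_closure (Or.inl hx)
    have htK1 : t ∈ K1 := Subfield.subset_closure (Or.inr rfl)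
    have hcl : ∀ a ∈ K1, a′ ∈ K1 := closure_closed _ (by
      rintro a (ha | ha)
      · exact hle (hK a ha)
      · rw [Set.mem_singleton_iff.mp ha]; exact hle (hw 0))
    have hind := ih K1 hcl (fun u hu => hle (hN u hu)) (fun i => w i.succ)
      (fun i => hle (hw _)) (by
        intro e he hsum
        obtain ⟨A, B, hAB⟩ := mem_closure_simple K t _ hsum
        have hder : (∑ i, e i * w i.succ)′ ∈ K := by
          rw [map_sum]
          refine sum_mem fun i _ => ?_
          rw [Derivation.leibniz, he i, smul_zero, add_zero, smul_eq_mul]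
          exact mul_mem (hN _ (he i)) (hw _)
        obtain ⟨f, b, hf, hfb⟩ := linear_case hN' t htr ⟨t′, hw 0⟩ rfl A B ⟨_, hder⟩
          (by rw [← hAB]; rfl)
        rw [← hAB] at hfb
        have hf' : (f : U)′ = 0 := by
          exact congrArg Subtype.val hf
        have := hlin (Fin.cons (-(f : U)) e) (fun i => by
          refine Fin.cases ?_ (fun j => ?_) i
          · simp [hf']
          · simpa using he j) (by
          rw [Fin.sum_univ_succ]
          simp only [Fin.cons_zero, Fin.cons_succ]
          rw [hfb, ← ht]
          have : -(f : U) * t + (algebraMap K U f * t + algebraMap K U b) = b := by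
            change -(f : U) * t + ((f : U) * t + (b : U)) = b
            ring
          rw [this]; exact b.2)
        funext i
        simpa using congrFun this i.succ)
    let : Algebra K K1 := (Subfield.inclusion hle).toAlgebra
    have : IsScalarTower K K1 U := .of_algebraMap_eq fun _ => rfl
    have hx : AlgebraicIndependent K (fun _ : Unit => t) :=
      algebraicIndependent_unique_type_iff.mpr htr
    have h := hx.sumElim_of_tower (S := K1) (y := fun i : Fin n => w i.succ)
      (by rintro _ ⟨_, rfl⟩; exact ⟨⟨t, htK1⟩, rfl⟩) hind
    have h2 := h.comp (fun i : Fin (n+1) => (Fin.cases (Sum.inr ()) Sum.inl i : Fin n ⊕ Unit))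
      (by
        intro i j
        refine Fin.cases ?_ (fun i => ?_) i <;> refine Fin.cases ?_ (fun j => ?_) j <;> simp)
    convert h2 using 1
    funext i
    refine Fin.cases ?_ (fun i => ?_) i <;> simp [ht]

end subfields
end LogInd

open scoped Differential

/-- Let `F` be a characteristic-zero differential field with algebraically closed
field of constants `C`, and let `U ⊇ F` be a no-new-constants extension.  Let
`S ⊆ U` be a finite set of antiderivatives of `F` which is algebraically independent
over `F`.  Suppose `w₁, …, w_s ∈ U` satisfy `wⱼ' = yⱼ'/(yⱼ + cⱼ)` with `yⱼ ∈ S`,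
`cⱼ ∈ C`, the pairs `(yⱼ, cⱼ)` being pairwise distinct.  Then `w₁, …, w_s` are
algebraically independent over `F(S)`. -/
theorem log_type_antiderivatives_algebraically_independent
    {U : Type*} [Field U] [CharZero U]
    (D : U → U) (hD : IsDerivation D)
    (F : Subfield U) (hF : ∀ a ∈ F, D a ∈ F)
    (C : Subfield U) (hC : ∀ c : U, c ∈ C ↔ (c ∈ F ∧ D c = 0))
    [IsAlgClosed C]
    (hNNC : ∀ a : U, D a = 0 → a ∈ F)
    (S : Finset U) (hS : ∀ a ∈ S, D a ∈ F)
    (hSind : AlgebraicIndependent F (fun a : {a // a ∈ S} => (a : U)))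
    {s : ℕ} (y : Fin s → U) (hyS : ∀ j, y j ∈ S)
    (c : Fin s → U) (hc : ∀ j, c j ∈ C)
    (hdist : ∀ j j', j ≠ j' → (y j, c j) ≠ (y j', c j'))
    (w : Fin s → U) (hw : ∀ j, D (w j) = D (y j) / (y j + c j)) :
    AlgebraicIndependent (Subfield.closure ((F : Set U) ∪ (S : Set U))) w := by
  classical
  let : Differential U := ⟨Derivation.mk' (AddMonoidHom.toIntLinearMap (AddMonoidHom.mk' D hD.map_add))
    (fun a b => by
      change D (a * b) = a • D b + b • D a
      rw [hD.leibniz, smul_eq_mul, smul_eq_mul]; ring)⟩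
  change ∀ a ∈ F, a′ ∈ F at hF
  change ∀ c : U, c ∈ C ↔ (c ∈ F ∧ c′ = 0) at hC
  change ∀ a : U, a′ = 0 → a ∈ F at hNNC
  change ∀ a ∈ S, a′ ∈ F at hS
  change ∀ j, (w j)′ = (y j)′ / (y j + c j) at hw
  have hFle : F ≤ Subfield.closure ((F : Set U) ∪ (S : Set U)) :=
    fun x hx => Subfield.subset_closure (Or.inl hx)
  have hSle : ∀ x ∈ S, x ∈ Subfield.closure ((F : Set U) ∪ (S : Set U)) :=
    fun x hx => Subfield.subset_closure (Or.inr hx)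
  have hcF : ∀ j, c j ∈ F := fun j => ((hC _).1 (hc j)).1
  refine LogInd.ostrowski s _ (LogInd.closure_closed _ ?_) (fun u hu => hFle (hNNC u hu)) w ?_ ?_
  · rintro a (ha | ha)
    · exact hFle (hF a ha)
    · exact hFle (hS a ha)
  · intro i
    rw [hw]
    exact div_mem (hFle (hS _ (hyS i))) (add_mem (hSle _ (hyS i)) (hFle (hcF i)))
  intro e he hsum
  by_contra hne
  obtain ⟨j0, hj0⟩ := Function.ne_iff.mp hne
  simp only [Pi.zero_apply] at hj0
  have heF : ∀ j, e j ∈ F := fun j => hNNC _ (he j)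
  -- the field generated by the other elements of `S`
  let i0 : {a // a ∈ S} := ⟨y j0, hyS j0⟩
  let T : Set U := (fun a : {a // a ∈ S} => (a : U)) '' {i0}ᶜ
  let L : Subfield U := (IntermediateField.adjoin F T).toSubfield
  have htr : Transcendental L (y j0) := by
    have h1 : Transcendental (Algebra.adjoin F T) (y j0) :=
      hSind.transcendental_adjoin (i := i0) (s := {i0}ᶜ) (by simp)
    exact (IntermediateField.transcendental_adjoin_iff (F := F) (s := T)).mpr h1
  have hFL : F ≤ L := fun x hx => (IntermediateField.adjoin F T).algebraMap_mem ⟨x, hx⟩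
  have hSL : ∀ x ∈ S, x ≠ y j0 → x ∈ L := fun x hx hxy =>
    IntermediateField.subset_adjoin F T ⟨⟨x, hx⟩, by simpa [i0, Subtype.ext_iff] using hxy, rfl⟩
  have hLcl : ∀ a ∈ L, a′ ∈ L := by
    have hL : L = Subfield.closure (Set.range (algebraMap F U) ∪ T) := rfl
    rw [hL]
    apply LogInd.closure_closed
    rw [← hL]
    rintro a (⟨a, rfl⟩ | ⟨a, _, rfl⟩)
    · exact hFL (hF _ a.2)
    · exact hFL (hS _ a.2)
  let := LogInd.diffSub L hLcl
  have := LogInd.diffSub_alg L hLcl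
  have hg : ∑ i, e i * w i ∈ Subfield.closure ((L : Set U) ∪ {y j0}) := by
    refine (Subfield.closure_le.mpr ?_) hsum
    rintro x (hx | hx)
    · exact Subfield.subset_closure (Or.inl (hFL hx))
    · by_cases h : x = y j0
      · exact Subfield.subset_closure (Or.inr h)
      · exact Subfield.subset_closure (Or.inl (hSL x hx h))
  obtain ⟨A, B, hAB⟩ := LogInd.mem_closure_simple L _ _ hg
  have hy0 : (y j0)′ ≠ 0 := fun h => by
    have : y j0 ∈ L := hFL (hNNC _ h)
    exact htr (isAlgebraic_algebraMap (⟨_, this⟩ : L))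
  have hdF : ∀ j, e j * (y j)′ ∈ F := fun j => mul_mem (heF j) (hS _ (hyS j))
  have hder : (∑ i, e i * w i)′ = ∑ i, e i * (y i)′ / (y i + c i) := by
    rw [map_sum]
    refine Finset.sum_congr rfl fun i _ => ?_
    rw [Derivation.leibniz, he i, smul_zero, add_zero, smul_eq_mul, hw, mul_div_assoc]
  rw [hAB, ← Finset.add_sum_erase _ _ (Finset.mem_univ j0)] at hder
  refine LogInd.pole_case (M := L) (y j0) htr ⟨(y j0)′, hFL (hS _ (hyS j0))⟩
    (fun h => hy0 (congrArg Subtype.val h)) rfl ⟨-c j0, neg_mem (hFL (hcF j0))⟩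
    ⟨e j0 * (y j0)′, hFL (hdF j0)⟩ ?_ (fun h => mul_ne_zero hj0 hy0 (congrArg Subtype.val h))
    _ (LogInd.Reg.sum htr (Finset.univ.erase j0) (fun i => e i * (y i)′ / (y i + c i)) ?_) A B ?_
  · apply Subtype.ext
    change (-c j0)′ = 0
    rw [map_neg, ((hC _).1 (hc j0)).2, neg_zero]
  · intro j hj
    have hjne : j ≠ j0 := (Finset.mem_erase.mp hj).1
    by_cases hyy : y j = y j0
    · have hcc : c j ≠ c j0 := fun h => hdist j j0 hjne (by rw [hyy, h])
      refine ⟨Polynomial.C ⟨e j * (y j)′, hFL (hdF j)⟩,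
        Polynomial.X + Polynomial.C ⟨c j, hFL (hcF j)⟩, ?_, ?_⟩
      · simp only [Polynomial.eval_add, Polynomial.eval_X, Polynomial.eval_C]
        intro h
        have h' : -c j0 + c j = 0 := congrArg Subtype.val h
        exact hcc (by linear_combination h')
      · simp only [map_add, Polynomial.aeval_C, Polynomial.aeval_X, hyy]
        rfl
    · refine ⟨Polynomial.C ⟨e j * (y j)′ / (y j + c j), div_mem (hFL (hdF j))
        (add_mem (hSL _ (hyS j) hyy) (hFL (hcF j)))⟩, 1, by simp, ?_⟩
      simp only [map_one, div_one, Polynomial.aeval_C]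
      rfl
  · rw [hder]
    congr 2
    change y j0 + c j0 = y j0 - (-c j0)
    ring
end

section
/- Let C be an algebraically closed field of characteristic zero and let U be a differential field containing C whose field of constants is exactly C. Suppose x ∈ U satisfies x′ = 1, and suppose for every n ≥ 1 and every vector c = (c_1,…,c_n) ∈ C^n an element ℓ(c) ∈ U is given such that, writing πc = (c_1,…,c_{n−1}) (with ℓ(πc) := x when n = 1), one has ℓ(πc) + c_n ≠ 0 and ℓ(c)′ = ℓ(πc)′/(ℓ(πc) + c_n). Then the family consisting of x together with all the elements ℓ(c), for all n ≥ 1 and all c ∈ C^n, is algebraically independent over C; in particular every finite set of iterated logarithms is algebraically independent over C. -/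
section IterLog

open Polynomial

/-- If `y' ∈ F` and `y` is algebraic over the differential field `F` (which contains all
constants), then `y ∈ F`. -/
theorem il_mem_of_isAlgebraic {k U : Type*} [Field k] [Field U] [Algebra k U] [CharZero U]
    (δ : Derivation k U U) (hconst : ∀ u : U, δ u = 0 → ∃ a : k, algebraMap k U a = u)
    (F : IntermediateField k U) (hF : ∀ a ∈ F, δ a ∈ F) (y : U) (hy : δ y ∈ F)
    (halg : IsAlgebraic F y) : y ∈ F := by
  have key : ∀ P : F[X], ∃ Q : F[X], (∀ i, (Q.coeff i : U) =
      δ (P.coeff i : U) + ((i + 1 : ℕ) : U) * (P.coeff (i + 1) : U) * δ y) ∧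
      aeval y Q = δ (aeval y P) := by
    intro P
    induction P using Polynomial.induction_on' with
    | add p q hp hq =>
      obtain ⟨Q1, h1, e1⟩ := hp
      obtain ⟨Q2, h2, e2⟩ := hq
      refine ⟨Q1 + Q2, fun i => ?_, by simp [e1, e2]⟩
      simp only [coeff_add, IntermediateField.coe_add, h1, h2, map_add]
      ring
    | monomial n a =>
      refine ⟨monomial n ⟨δ a, hF _ a.2⟩ + derivative (monomial n a) * C ⟨δ y, hy⟩,
        fun i => ?_, ?_⟩
      · rw [coeff_add, coeff_mul_C, coeff_derivative]
        simp only [coeff_monomial]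
        push_cast
        split_ifs <;> simp <;> first | (left; ring) | ring
      · simp only [derivative_monomial, map_add, map_mul, aeval_monomial, aeval_C,
          Derivation.leibniz, Derivation.leibniz_pow, smul_eq_mul, nsmul_eq_mul]
        simp only [IntermediateField.algebraMap_apply]
        push_cast
        ring
  have hint : IsIntegral F y := halg.isIntegral
  set P := minpoly F y with hP
  have hmon : P.Monic := minpoly.monic hint
  have hpos : 0 < P.natDegree := minpoly.natDegree_pos hint
  obtain ⟨Q, hQ, eQ⟩ := key P
  rw [hP, minpoly.aeval, map_zero] at eQ
  have hQ0 : Q = 0 := by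
    by_contra hne
    have h1 := natDegree_le_natDegree (minpoly.degree_le_of_ne_zero F y hne eQ)
    have h2 : Q.natDegree < P.natDegree := by
      rw [natDegree_lt_iff_degree_lt hne, degree_lt_iff_coeff_zero]
      intro m hm
      have h3 : (Q.coeff m : U) = 0 := by
        rw [hQ, coeff_eq_zero_of_natDegree_lt (show P.natDegree < m + 1 by omega)]
        rcases hm.eq_or_lt with h | h
        · rw [← h, coeff_natDegree, hmon.leadingCoeff]; simp
        · rw [coeff_eq_zero_of_natDegree_lt h]; simp
      exact_mod_cast h3
    rw [← hP] at h1
    omega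
  obtain ⟨m, hm⟩ : ∃ m, P.natDegree = m + 1 := ⟨P.natDegree - 1, by omega⟩
  have h4 := hQ m
  rw [hQ0, ← hm, coeff_natDegree, hmon.leadingCoeff, hm] at h4
  have hm0 : ((m + 1 : ℕ) : U) ≠ 0 := Nat.cast_ne_zero.2 (by omega)
  have h5 : δ ((P.coeff m : U) + ((m + 1 : ℕ) : U) * y) = 0 := by
    rw [map_add, Derivation.leibniz, Derivation.map_natCast]
    simp only [smul_eq_mul]
    simp at h4 ⊢
    linear_combination -h4
  obtain ⟨a, ha⟩ := hconst _ h5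
  have h6 : y = (algebraMap k U a - P.coeff m) / ((m + 1 : ℕ) : U) := by
    rw [ha]; field_simp; ring
  rw [h6]
  exact div_mem (sub_mem (F.algebraMap_mem a) (P.coeff m).2) (natCast_mem F _)

/-- The local ring at `t = 0` inside `F(t)`. -/
def ilLocal {U : Type*} [Field U] {k : Type*} [Field k] [Algebra k U] (F : IntermediateField k U)
    (t : U) (ht : Transcendental F t) : Subring U where
  carrier := {f | ∃ P Q : F[X], Q.coeff 0 ≠ 0 ∧ f * aeval t Q = aeval t P}
  mul_mem' := by
    rintro a b ⟨P, Q, h, e⟩ ⟨P', Q', h', e'⟩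
    refine ⟨P * P', Q * Q', by simp [mul_coeff_zero, h, h'], ?_⟩
    rw [map_mul, map_mul, ← e, ← e']; ring
  one_mem' := ⟨1, 1, by simp, by simp⟩
  add_mem' := by
    rintro a b ⟨P, Q, h, e⟩ ⟨P', Q', h', e'⟩
    refine ⟨P * Q' + P' * Q, Q * Q', by simp [mul_coeff_zero, h, h'], ?_⟩
    rw [map_mul, map_add, map_mul, map_mul, ← e, ← e']; ring
  zero_mem' := ⟨0, 1, by simp, by simp⟩
  neg_mem' := by
    rintro a ⟨P, Q, h, e⟩
    exact ⟨-P, Q, h, by rw [map_neg, ← e]; ring⟩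

section
variable {k U : Type*} [Field k] [Field U] [Algebra k U] (F : IntermediateField k U)
    (t : U) (ht : Transcendental F t)

theorem il_aeval_ne {Q : F[X]} (h : Q ≠ 0) (ht : Transcendental F t) : aeval t Q ≠ 0 :=
  fun h0 => ht ⟨Q, h, h0⟩

theorem il_aeval_mem (P : F[X]) : aeval t P ∈ ilLocal F t ht := ⟨P, 1, by simp, by simp⟩

theorem il_base_mem (a : U) (ha : a ∈ F) : a ∈ ilLocal F t ht := by
  have := il_aeval_mem F t ht (C ⟨a, ha⟩)
  rwa [aeval_C] at this

theorem il_t_mem : t ∈ ilLocal F t ht := by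
  have := il_aeval_mem F t ht X
  rwa [aeval_X] at this

theorem il_inv_mem (Q : F[X]) (h : Q.coeff 0 ≠ 0) : (aeval t Q)⁻¹ ∈ ilLocal F t ht := by
  refine ⟨1, Q, h, ?_⟩
  rw [inv_mul_cancel₀ (il_aeval_ne F t (by rintro rfl; simp at h) ht), map_one]

theorem il_t_inv_not_mem : t⁻¹ ∉ ilLocal F t ht := by
  rintro ⟨P, Q, h, e⟩
  have ht0 : t ≠ 0 := by
    have := il_aeval_ne F t X_ne_zero ht
    rwa [aeval_X] at this
  have h1 : aeval t (Q - X * P) = 0 := by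
    rw [map_sub, map_mul, aeval_X, ← e]; field_simp; ring
  have h2 : Q - X * P = 0 := by
    by_contra hne
    exact il_aeval_ne F t hne ht h1
  rw [sub_eq_zero.1 h2] at h
  simp at h

/-- Elements of `F(t)`: in the local ring, or a unit over a positive power of `t`. -/
theorem il_cases (f : U) (hf : f ∈ IntermediateField.adjoin F {t}) :
    f ∈ ilLocal F t ht ∨ ∃ (u : U) (n : ℕ), u ∈ ilLocal F t ht ∧ u⁻¹ ∈ ilLocal F t ht ∧ u ≠ 0 ∧
      f = u / t ^ (n + 1) := by
  obtain ⟨r, s, rfl⟩ := (IntermediateField.mem_adjoin_simple_iff F f).1 hf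
  by_cases hr : r = 0
  · left; simp [hr, zero_mem]
  by_cases hs : s = 0
  · left; simp [hs, zero_mem]
  have ht0 : t ≠ 0 := by
    have := il_aeval_ne F t X_ne_zero ht
    rwa [aeval_X] at this
  have fac : ∀ p : F[X], p ≠ 0 → ∃ (n : ℕ) (q : F[X]), q.coeff 0 ≠ 0 ∧ p = X ^ n * q := by
    intro p hp
    obtain ⟨q, hq, hnd⟩ := exists_eq_pow_rootMultiplicity_mul_and_not_dvd p hp 0
    refine ⟨_, q, ?_, by simpa using hq⟩
    rw [map_zero, sub_zero, X_dvd_iff] at hnd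
    exact hnd
  obtain ⟨n, q, hq, rfl⟩ := fac r hr
  obtain ⟨m, q', hq', rfl⟩ := fac s hs
  have hne : aeval t q ≠ 0 := il_aeval_ne F t (by rintro rfl; simp at hq) ht
  have hne' : aeval t q' ≠ 0 := il_aeval_ne F t (by rintro rfl; simp at hq') ht
  have m1 := il_aeval_mem F t ht q
  have m2 := il_aeval_mem F t ht q'
  have i1 := il_inv_mem F t ht q hq
  have i2 := il_inv_mem F t ht q' hq'
  simp only [map_mul, map_pow, aeval_X]
  rcases le_or_gt m n with h | h
  · left
    obtain ⟨d, rfl⟩ := Nat.exists_eq_add_of_le h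
    have : t ^ (m + d) * aeval t q / (t ^ m * aeval t q') = t ^ d * aeval t q * (aeval t q')⁻¹ := by
      field_simp
      ring
    rw [this]
    exact mul_mem (mul_mem (pow_mem (il_t_mem F t ht) _) m1) i2
  · right
    obtain ⟨d, rfl⟩ := Nat.exists_eq_add_of_lt h
    refine ⟨aeval t q * (aeval t q')⁻¹, d, mul_mem m1 i2, ?_, by positivity, ?_⟩
    · rw [mul_inv, inv_inv]; exact mul_mem i1 m2
    · field_simp
      ring

/-- The local ring is stable under the derivation as soon as `F` and `t` are mapped into it. -/
theorem il_deriv_mem (δ : Derivation k U U) (hF : ∀ a ∈ F, δ a ∈ ilLocal F t ht)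
    (hdt : δ t ∈ ilLocal F t ht) (f : U) (hf : f ∈ ilLocal F t ht) : δ f ∈ ilLocal F t ht := by
  have hp : ∀ P : F[X], δ (aeval t P) ∈ ilLocal F t ht := by
    intro P
    induction P using Polynomial.induction_on' with
    | add p q hp hq => rw [map_add, map_add]; exact add_mem hp hq
    | monomial n a =>
      rw [aeval_monomial, Derivation.leibniz, Derivation.leibniz_pow]
      simp only [smul_eq_mul, nsmul_eq_mul]
      have := il_t_mem F t ht
      exact add_mem (mul_mem (il_base_mem F t ht _ a.2) (mul_mem (natCast_mem _ _)
        (mul_mem (pow_mem this _) hdt))) (mul_mem (pow_mem this _) (hF _ a.2))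
  have hf' := hf
  obtain ⟨P, Q, h, e⟩ := hf'
  have hne : aeval t Q ≠ 0 := il_aeval_ne F t (by rintro rfl; simp at h) ht
  have h1 := congrArg δ e
  rw [Derivation.leibniz] at h1
  simp only [smul_eq_mul] at h1
  have h2 : δ f = (δ (aeval t P) - f * δ (aeval t Q)) * (aeval t Q)⁻¹ := by
    rw [← h1]; field_simp; ring
  rw [h2]
  exact mul_mem (sub_mem (hp P) (mul_mem hf (hp Q))) (il_inv_mem F t ht Q h)

/-- No element of `F(t)` is a logarithm of `t`. -/
theorem il_no_log [CharZero U] (δ : Derivation k U U) (hF : ∀ a ∈ F, δ a ∈ ilLocal F t ht)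
    (hdt : δ t ∈ F) (hdt0 : δ t ≠ 0) (f : U)
    (hf : f ∈ IntermediateField.adjoin F {t}) : δ f ≠ δ t / t := by
  intro hlog
  have ht0 : t ≠ 0 := by
    have := il_aeval_ne F t X_ne_zero ht
    rwa [aeval_X] at this
  have hdi : (δ t)⁻¹ ∈ ilLocal F t ht := il_base_mem F t ht _ (inv_mem hdt)
  have hdm : δ t ∈ ilLocal F t ht := il_base_mem F t ht _ hdt
  apply il_t_inv_not_mem F t ht
  rcases il_cases F t ht f hf with h | ⟨u, n, hu, hui, hu0, rfl⟩
  · have h1 := il_deriv_mem F t ht δ hF hdm f h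
    have h2 : t⁻¹ = δ f * (δ t)⁻¹ := by rw [hlog]; field_simp
    rw [h2]; exact mul_mem h1 hdi
  · have h1 := il_deriv_mem F t ht δ hF hdm u hu
    rw [Derivation.leibniz_div, Derivation.leibniz_pow] at hlog
    simp only [smul_eq_mul, nsmul_eq_mul, Nat.add_sub_cancel] at hlog
    have hn : ((n + 1 : ℕ) : U) ≠ 0 := Nat.cast_ne_zero.2 (by omega)
    have hni : (((n + 1 : ℕ) : U))⁻¹ ∈ ilLocal F t ht :=
      il_base_mem F t ht _ (inv_mem (natCast_mem F _))
    have h2 : t⁻¹ = (δ u - δ t * t ^ n) * ((((n + 1 : ℕ) : U))⁻¹ * u⁻¹ * (δ t)⁻¹) := by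
      generalize ((n + 1 : ℕ) : U) = N at *
      field_simp at hlog ⊢
      rw [pow_succ] at hlog
      have hp : t ^ n ≠ 0 := pow_ne_zero _ ht0
      apply mul_left_cancel₀ (mul_ne_zero hp ht0)
      linear_combination (-1) * hlog
    rw [h2]
    exact mul_mem (sub_mem h1 (mul_mem hdm (pow_mem (il_t_mem F t ht) _)))
      (mul_mem (mul_mem hni hui) hdi)
end

/-- Inductive step: adjoining one new iterated logarithm to a prefix-closed independent family. -/
theorem il_step {k U ι : Type*} [Field k] [Field U] [Algebra k U] [CharZero U]
    (δ : Derivation k U U) (hconst : ∀ u : U, δ u = 0 → ∃ a : k, algebraMap k U a = u)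
    (v : ι → U) (lvl : ι → ℕ) (par : ι → ι) (cst : ι → k)
    (h0 : ∀ i, lvl i = 0 → δ (v i) = 1)
    (h00 : ∀ i j, lvl i = 0 → lvl j = 0 → i = j)
    (hlt : ∀ i, lvl i ≠ 0 → lvl (par i) < lvl i)
    (hne : ∀ i, lvl i ≠ 0 → v (par i) + algebraMap k U (cst i) ≠ 0)
    (hd : ∀ i, lvl i ≠ 0 → δ (v i) = δ (v (par i)) / (v (par i) + algebraMap k U (cst i)))
    (hinj : ∀ i j, lvl i ≠ 0 → lvl j ≠ 0 → par i = par j → cst i = cst j → i = j)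
    (S : Set ι) (hS : ∀ i ∈ S, lvl i ≠ 0 → par i ∈ S)
    (hind : AlgebraicIndepOn k v S) (c : ι) (hc : c ∉ S) (hpc : lvl c ≠ 0 → par c ∈ S) :
    AlgebraicIndepOn k v (insert c S) := by
  refine hind.insert ?_
  rw [← IntermediateField.transcendental_adjoin_iff]
  intro halg
  set F := IntermediateField.adjoin k (v '' S) with hFdef
  have hvF : ∀ i ∈ S, v i ∈ F := fun i hi =>
    IntermediateField.subset_adjoin _ _ (Set.mem_image_of_mem v hi)
  have hdvF : ∀ n i, lvl i = n → (lvl i ≠ 0 → par i ∈ S) → δ (v i) ∈ F := by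
    intro n
    induction n using Nat.strong_induction_on with
    | _ n ih =>
      intro i hi hiS
      by_cases hl : lvl i = 0
      · rw [h0 i hl]; exact one_mem _
      · rw [hd i hl]
        exact div_mem (ih _ (hi ▸ hlt i hl) _ rfl (hS _ (hiS hl)))
          (add_mem (hvF _ (hiS hl)) (F.algebraMap_mem _))
  have hF : ∀ a ∈ F, δ a ∈ F := by
    intro a ha
    induction ha using IntermediateField.adjoin_induction with
    | mem x hx => obtain ⟨i, hi, rfl⟩ := hx; exact hdvF _ i rfl (hS i hi)
    | algebraMap x => rw [Derivation.map_algebraMap]; exact zero_mem _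
    | add x y hx hy h1 h2 => rw [map_add]; exact add_mem h1 h2
    | inv x hx h1 =>
      rw [Derivation.leibniz_inv]
      exact mul_mem (neg_mem (pow_mem (inv_mem hx) _)) h1
    | mul x y hx hy h1 h2 =>
      rw [Derivation.leibniz]
      exact add_mem (mul_mem hx h2) (mul_mem hy h1)
  have hcF : v c ∈ F := il_mem_of_isAlgebraic δ hconst F hF (v c) (hdvF _ c rfl hpc) halg
  have hdne : ∀ n i, lvl i = n → δ (v i) ≠ 0 := by
    intro n
    induction n using Nat.strong_induction_on with
    | _ n ih =>
      intro i hi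
      by_cases hl : lvl i = 0
      · rw [h0 i hl]; exact one_ne_zero
      · rw [hd i hl]
        exact div_ne_zero (ih _ (hi ▸ hlt i hl) _ rfl) (hne i hl)
  by_cases hlc : lvl c = 0
  · -- the root
    have hSe : ∀ n i, lvl i = n → i ∉ S := by
      intro n
      induction n using Nat.strong_induction_on with
      | _ n ih =>
        intro i hi hiS
        by_cases hl : lvl i = 0
        · exact hc (h00 i c hl hlc ▸ hiS)
        · exact ih _ (hi ▸ hlt i hl) _ rfl (hS i hiS hl)
    have hS0 : S = ∅ := Set.eq_empty_of_forall_notMem fun i => hSe _ i rfl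
    rw [hFdef, hS0, Set.image_empty, IntermediateField.adjoin_empty,
      IntermediateField.mem_bot] at hcF
    obtain ⟨a, ha⟩ := hcF
    exact hdne _ c rfl (by rw [← ha, Derivation.map_algebraMap])
  have hp := hpc hlc
  set p := par c with hpdef
  set F' := IntermediateField.adjoin k (v '' (S \ {p})) with hF'def
  have hvF' : ∀ i ∈ S, i ≠ p → v i ∈ F' := fun i hi hip =>
    IntermediateField.subset_adjoin _ _ (Set.mem_image_of_mem v ⟨hi, hip⟩)
  have htr : Transcendental F' (v p) := by
    rw [IntermediateField.transcendental_adjoin_iff]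
    refine ((AlgebraicIndepOn.insert_iff (s := S \ {p}) (i := p) (by simp)).1 ?_).2
    rwa [Set.insert_sdiff_singleton, Set.insert_eq_of_mem hp]
  obtain ⟨t, htdef⟩ : ∃ t, t = v p + algebraMap k U (cst c) := ⟨_, rfl⟩
  have ht : Transcendental F' t := by
    intro h
    apply htr
    have h2 : IsAlgebraic F' (algebraMap F' U ⟨algebraMap k U (cst c), F'.algebraMap_mem _⟩) :=
      isAlgebraic_algebraMap _
    have h3 := h.sub h2
    rwa [htdef, IntermediateField.algebraMap_apply, add_sub_cancel_right] at h3
  have hδt : δ t = δ (v p) := by rw [htdef, map_add, Derivation.map_algebraMap, add_zero]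
  have hlow : ∀ n i, lvl i = n → i ∈ S → n ≤ lvl p → δ (v i) ∈ F' := by
    intro n
    induction n using Nat.strong_induction_on with
    | _ n ih =>
      intro i hi hiS hn
      by_cases hl : lvl i = 0
      · rw [h0 i hl]; exact one_mem _
      · rw [hd i hl]
        have h1 := hlt i hl
        exact div_mem (ih _ (hi ▸ h1) _ rfl (hS _ hiS hl) (by omega))
          (add_mem (hvF' _ (hS _ hiS hl) (by intro h; rw [h] at h1; omega)) (F'.algebraMap_mem _))
  have hgen : ∀ n i, lvl i = n → i ∈ S → δ (v i) ∈ ilLocal F' t ht := by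
    intro n
    induction n using Nat.strong_induction_on with
    | _ n ih =>
      intro i hi hiS
      by_cases hl : lvl i = 0
      · rw [h0 i hl]; exact one_mem _
      · rw [hd i hl, div_eq_mul_inv]
        refine mul_mem (ih _ (hi ▸ hlt i hl) _ rfl (hS _ hiS hl)) ?_
        by_cases hip : par i = p
        · have hcne : cst i - cst c ≠ 0 := by
            intro h
            exact hc (hinj i c hl hlc hip (sub_eq_zero.1 h) ▸ hiS)
          have h1 := il_inv_mem F' t ht
            (X + C ⟨algebraMap k U (cst i - cst c), F'.algebraMap_mem _⟩) (by
              rw [coeff_add, coeff_X_zero, coeff_C_zero, zero_add]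
              intro h
              have h' := congrArg (algebraMap F' U) h
              rw [IntermediateField.algebraMap_apply, map_zero] at h'
              exact hcne ((map_eq_zero _).1 h'))
          rw [map_add, aeval_X, aeval_C, IntermediateField.algebraMap_apply] at h1
          have h2 : v (par i) + algebraMap k U (cst i) =
              t + algebraMap k U (cst i - cst c) := by
            rw [hip, htdef, map_sub]
            ring
          rw [h2]
          exact h1
        · exact il_base_mem F' t ht _ (inv_mem (add_mem (hvF' _ (hS _ hiS hl) hip)
            (F'.algebraMap_mem _)))
  have hF'R : ∀ a ∈ F', δ a ∈ ilLocal F' t ht := by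
    intro a ha
    induction ha using IntermediateField.adjoin_induction with
    | mem x hx => obtain ⟨i, hi, rfl⟩ := hx; exact hgen _ i rfl hi.1
    | algebraMap x => rw [Derivation.map_algebraMap]; exact zero_mem _
    | add x y hx hy h1 h2 => rw [map_add]; exact add_mem h1 h2
    | inv x hx h1 =>
      rw [Derivation.leibniz_inv]
      exact mul_mem (il_base_mem F' t ht _ (neg_mem (pow_mem (inv_mem hx) _))) h1
    | mul x y hx hy h1 h2 =>
      rw [Derivation.leibniz]
      exact add_mem (mul_mem (il_base_mem F' t ht _ hx) h2)
        (mul_mem (il_base_mem F' t ht _ hy) h1)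
  have hle : F ≤ (IntermediateField.adjoin F' {t}).restrictScalars k := by
    rw [hFdef, IntermediateField.adjoin_le_iff]
    rintro _ ⟨i, hi, rfl⟩
    change v i ∈ IntermediateField.adjoin F' {t}
    have hb : ∀ a ∈ F', a ∈ IntermediateField.adjoin F' {t} := fun a ha =>
      (IntermediateField.adjoin F' {t}).algebraMap_mem ⟨a, ha⟩
    by_cases hip : i = p
    · have h1 : v i = t - algebraMap k U (cst c) := by rw [hip, htdef]; ring
      rw [h1]
      exact sub_mem (IntermediateField.mem_adjoin_simple_self F' t) (hb _ (F'.algebraMap_mem _))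
    · exact hb _ (hvF' i hi hip)
  refine il_no_log F' t ht δ hF'R ?_ ?_ (v c) (hle hcF) ?_
  · rw [hδt]; exact hlow _ p rfl hp le_rfl
  · rw [hδt]; exact hdne _ p rfl
  · rw [hδt, htdef]; exact hd c hlc

theorem il_main {k U ι : Type*} [Field k] [Field U] [Algebra k U] [CharZero U]
    (δ : Derivation k U U) (hconst : ∀ u : U, δ u = 0 → ∃ a : k, algebraMap k U a = u)
    (v : ι → U) (lvl : ι → ℕ) (par : ι → ι) (cst : ι → k)
    (h0 : ∀ i, lvl i = 0 → δ (v i) = 1)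
    (h00 : ∀ i j, lvl i = 0 → lvl j = 0 → i = j)
    (hlt : ∀ i, lvl i ≠ 0 → lvl (par i) < lvl i)
    (hne : ∀ i, lvl i ≠ 0 → v (par i) + algebraMap k U (cst i) ≠ 0)
    (hd : ∀ i, lvl i ≠ 0 → δ (v i) = δ (v (par i)) / (v (par i) + algebraMap k U (cst i)))
    (hinj : ∀ i j, lvl i ≠ 0 → lvl j ≠ 0 → par i = par j → cst i = cst j → i = j) :
    AlgebraicIndependent k v := by
  classical
  have hfin : ∀ n (S : Finset ι), S.card = n → (∀ i ∈ S, lvl i ≠ 0 → par i ∈ S) →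
      AlgebraicIndepOn k v (S : Set ι) := by
    intro n
    induction n with
    | zero =>
      intro S hS _
      rw [Finset.card_eq_zero.1 hS, Finset.coe_empty]
      exact algebraicIndependent_empty_type
    | succ n ih =>
      intro S hcard hS
      obtain ⟨c, hc, hmax⟩ := Finset.exists_max_image S lvl
        (Finset.card_pos.1 (by omega))
      have hpar : ∀ i ∈ S, lvl i ≠ 0 → par i ∈ S.erase c := by
        intro i hi hl
        refine Finset.mem_erase.2 ⟨?_, hS i hi hl⟩
        intro h
        have h1 := hlt i hl
        have h2 := hmax i hi
        rw [h] at h1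
        omega
      have hE : ∀ i ∈ S.erase c, lvl i ≠ 0 → par i ∈ S.erase c := fun i hi hl =>
        hpar i (Finset.mem_of_mem_erase hi) hl
      have h1 := ih (S.erase c) (by rw [Finset.card_erase_of_mem hc, hcard]; rfl) hE
      have h2 := il_step δ hconst v lvl par cst h0 h00 hlt hne hd hinj (S.erase c : Finset ι)
        (by simpa only [Finset.mem_coe] using hE) h1 c (by simp)
        (fun hl => Finset.mem_coe.2 (hpar c hc hl))
      rwa [← Finset.coe_insert, Finset.insert_erase hc] at h2
  have hcl1 : ∀ n i, lvl i = n →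
      ∃ S : Finset ι, i ∈ S ∧ ∀ i ∈ S, lvl i ≠ 0 → par i ∈ S := by
    intro n
    induction n using Nat.strong_induction_on with
    | _ n ih =>
      intro i hi
      by_cases hl : lvl i = 0
      · refine ⟨{i}, by simp, ?_⟩
        intro j hj hjl
        rw [Finset.mem_singleton.1 hj] at hjl
        exact absurd hl hjl
      · obtain ⟨S, hiS, hS⟩ := ih _ (hi ▸ hlt i hl) _ rfl
        refine ⟨insert i S, by simp, ?_⟩
        intro j hj hjl
        rcases Finset.mem_insert.1 hj with rfl | hj
        · exact Finset.mem_insert_of_mem hiS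
        · exact Finset.mem_insert_of_mem (hS j hj hjl)
  choose cl hcl hcl' using fun i => hcl1 _ i rfl
  refine algebraicIndependent_of_finite_type fun T hT => ?_
  have h1 := hfin _ (hT.toFinset.biUnion cl) rfl (by
    intro i hi hl
    obtain ⟨j, hj, hij⟩ := Finset.mem_biUnion.1 hi
    exact Finset.mem_biUnion.2 ⟨j, hj, hcl' j i hij hl⟩)
  refine AlgebraicIndepOn.mono h1 ?_
  intro i hi
  exact Finset.mem_coe.2 (Finset.mem_biUnion.2 ⟨i, hT.mem_toFinset.2 hi, hcl i⟩)

end IterLog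

/-- **Algebraic independence of iterated logarithms.**  Let `C` be an algebraically
closed field of characteristic zero and `U` a differential field containing `C` whose
constants are exactly `C`.  Suppose `x ∈ U` satisfies `x' = 1` and for every `n ≥ 1`
and `c ∈ Cⁿ` an element `ℓ(c) ∈ U` is given (here `ℓ n c` has level `n + 1`) with
`ℓ(πc) + cₙ ≠ 0` and `ℓ(c)' = ℓ(πc)'/(ℓ(πc) + cₙ)`, where `π` drops the last
coordinate and `ℓ` of the empty vector is `x`.  Then the family consisting of `x`
together with all the `ℓ(c)` is algebraically independent over `C`. -/
theorem iterated_logarithms_algebraically_independent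
    {U : Type*} [Field U] [CharZero U]
    (D : U → U) (hD : IsDerivation D)
    (C : Subfield U) (hC : ∀ c : U, c ∈ C ↔ D c = 0)
    [IsAlgClosed C]
    (x : U) (hx : D x = 1)
    (l : (n : ℕ) → (Fin (n + 1) → C) → U)
    (hbase : ∀ c : Fin 1 → C,
      x + (c 0 : U) ≠ 0 ∧ D (l 0 c) = D x / (x + (c 0 : U)))
    (hstep : ∀ (n : ℕ) (c : Fin (n + 2) → C),
      l n (Fin.init c) + (c (Fin.last (n + 1)) : U) ≠ 0 ∧
      D (l (n + 1) c) =
        D (l n (Fin.init c)) / (l n (Fin.init c) + (c (Fin.last (n + 1)) : U))) :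
    AlgebraicIndependent C
      (fun o : Option (Σ n : ℕ, Fin (n + 1) → C) =>
        o.elim x (fun p => l p.1 p.2)) := by
  have hone : D 1 = 0 := (hC 1).1 C.one_mem
  have hsmul : ∀ (a : C) (u : U), D (a • u) = a • D u := by
    intro a u
    rw [Algebra.smul_def, Algebra.smul_def, hD.leibniz]
    have : D (algebraMap C U a) = 0 := (hC _).1 a.2
    rw [this]; ring
  let δ : Derivation C U U := Derivation.mk'
    { toFun := D, map_add' := hD.map_add, map_smul' := hsmul } (by
      intro a b
      change D (a * b) = a • D b + b • D a
      rw [hD.leibniz, smul_eq_mul, smul_eq_mul]; ring)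
  have hδ : ∀ u, δ u = D u := fun _ => rfl
  refine il_main δ (fun u hu => ⟨⟨u, (hC u).2 hu⟩, rfl⟩) _
    (fun o => o.elim 0 (fun p => p.1 + 1))
    (fun o => match o with
      | none => none
      | some ⟨0, _⟩ => none
      | some ⟨n + 1, c⟩ => some ⟨n, Fin.init c⟩)
    (fun o => match o with
      | none => 0
      | some ⟨n, c⟩ => c (Fin.last n)) ?_ ?_ ?_ ?_ ?_ ?_
  · rintro (_ | ⟨n, c⟩) h
    · exact hx
    · simp at h
  · rintro (_ | ⟨n, c⟩) (_ | ⟨m, d⟩) h h' <;> simp at h h' ⊢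
  · rintro (_ | ⟨_ | n, c⟩) h <;> simp at h ⊢
  · rintro (_ | ⟨_ | n, c⟩) h
    · simp at h
    · exact (hbase c).1
    · exact (hstep n c).1
  · rintro (_ | ⟨_ | n, c⟩) h
    · simp at h
    · exact (hbase c).2
    · exact (hstep n c).2
  · rintro (_ | ⟨_ | n, c⟩) (_ | ⟨_ | m, d⟩) h h' hp hc
    · rfl
    · simp at h
    · simp at h
    · simp at h'
    · have : c = d := by
        funext i
        rw [show i = Fin.last 0 from Fin.ext (by have := i.2; simp)]
        exact hc
      rw [this]
    · simp at hp
    · simp at h'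
    · simp at hp
    · simp only [Option.some.injEq, Sigma.mk.injEq] at hp
      obtain ⟨rfl, h2⟩ := hp
      have h3 := eq_of_heq h2
      have : c = d := by
        rw [← Fin.snoc_init_self c, ← Fin.snoc_init_self d, h3]
        congr 1
      rw [this]
end

section
/- Let C be a field, let K ⊇ C be a field extension, and let (λ_i)_{i∈I} be a family of elements of K that is algebraically independent over C. Let E ⊆ I be finite, let P, Q be relatively prime polynomials in the variables {X_i : i ∈ E} over C with Q ≠ 0, and assume that for every i ∈ E either ∂P/∂X_i ≠ 0 or ∂Q/∂X_i ≠ 0 (i.e. E is exactly the set of essential variables of u). Set u = P((λ_i)_{i∈E}) / Q((λ_i)_{i∈E}) ∈ K. If S ⊆ I is any subset such that u lies in the subfield C({λ_i : i ∈ S}) of K generated by C and {λ_i : i ∈ S}, then E ⊆ S. -/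
open MvPolynomial in
theorem totalDegree_pderiv_lt_aux {σ R : Type*} [CommRing R] (i : σ) (p : MvPolynomial σ R)
    (h : pderiv i p ≠ 0) : (pderiv i p).totalDegree < p.totalDegree := by
  classical
  obtain ⟨m, hm, hmd⟩ : ∃ m ∈ (pderiv i p).support,
      (pderiv i p).totalDegree = m.sum fun _ e => e := by
    have hne : (pderiv i p).support.Nonempty := by
      rwa [Finset.nonempty_iff_ne_empty, Ne, support_eq_empty]
    exact Finset.exists_mem_eq_sup _ hne _
  rw [mem_support_iff] at hm
  have hc : ∃ d ∈ p.support, coeff m (pderiv i (monomial d (coeff d p))) ≠ 0 := by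
    by_contra! hcon
    apply hm
    conv_lhs => rw [p.as_sum, map_sum, coeff_sum]
    exact Finset.sum_eq_zero hcon
  obtain ⟨d, hd, hdm⟩ := hc
  rw [pderiv_monomial, coeff_monomial] at hdm
  split_ifs at hdm with heq
  · have hdi : d i ≠ 0 := by
      intro h0
      simp [h0] at hdm
    have hle : Finsupp.single i 1 ≤ d := by
      rw [Finsupp.single_le_iff]; omega
    have h1 : m + Finsupp.single i 1 = d := by
      rw [← heq]; exact tsub_add_cancel_of_le hle
    have h2 := le_totalDegree hd
    rw [← h1, Finsupp.sum_add_index' (by simp) (by simp), Finsupp.sum_single_index rfl, ← hmd] at h2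
    omega
  · exact absurd rfl hdm

open MvPolynomial in
theorem pderiv_rename_aux {σ τ R : Type*} [CommRing R] (f : σ → τ) (hf : Function.Injective f)
    (i : σ) (p : MvPolynomial σ R) :
    pderiv (f i) (rename f p) = rename f (pderiv i p) := by
  classical
  induction p using MvPolynomial.induction_on with
  | C a => simp
  | add p q hp hq => simp [hp, hq]
  | mul_X p n hp =>
    simp only [map_mul, rename_X, Derivation.leibniz, hp, map_add, smul_eq_mul, pderiv_X]
    by_cases h : n = i
    · subst h; simp
    · have : f n ≠ f i := fun h' => h (hf h')
      simp [h, this]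

open MvPolynomial in
theorem pderiv_rename_zero_aux {σ τ R : Type*} [CommRing R] (f : σ → τ) (i : τ)
    (hi : ∀ j, f j ≠ i) (p : MvPolynomial σ R) :
    pderiv i (rename f p) = 0 := by
  classical
  induction p using MvPolynomial.induction_on with
  | C a => simp
  | add p q hp hq => simp [hp, hq]
  | mul_X p n hp =>
    simp [Derivation.leibniz, hp, pderiv_X, hi n]


/-- **Uniqueness of the set of essential elements.**  Let `K ⊇ C` be a field
extension and `(λᵢ)_{i ∈ I}` a family in `K` algebraically independent over `C`.
Let `E ⊆ I` be finite, let `P, Q` be relatively prime polynomials over `C` in the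
variables indexed by `E` with `Q ≠ 0`, such that every variable of `E` actually
occurs in `P` or in `Q`, and set `u = P((λᵢ)) / Q((λᵢ))`.  If `u` lies in the
subfield of `K` generated by `C` and `{λᵢ : i ∈ S}` for some `S ⊆ I`, then
`E ⊆ S`. -/
theorem essential_elements_subset
    {C K : Type*} [Field C] [Field K] [Algebra C K]
    {I : Type*} (lam : I → K) (hind : AlgebraicIndependent C lam)
    (E : Finset I)
    (P Q : MvPolynomial {i // i ∈ E} C)
    (hPQ : IsRelPrime P Q) (hQ : Q ≠ 0)
    (hess : ∀ i : {i // i ∈ E},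
      MvPolynomial.pderiv i P ≠ 0 ∨ MvPolynomial.pderiv i Q ≠ 0)
    (u : K)
    (hu : u = MvPolynomial.aeval (fun i : {i // i ∈ E} => lam i) P /
        MvPolynomial.aeval (fun i : {i // i ∈ E} => lam i) Q)
    (S : Set I)
    (huS : u ∈ Subfield.closure (Set.range (algebraMap C K) ∪ lam '' S)) :
    ↑E ⊆ S := by
  classical
  intro i hi
  have hiE : i ∈ E := hi
  by_contra hiS
  have hmem : u ∈ IntermediateField.adjoin C (Set.range fun s : S => lam s) := by
    have : (Set.range fun s : S => lam s) = lam '' S := by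
      ext x; simp
    rw [this]
    exact huS
  rw [IntermediateField.mem_adjoin_range_iff] at hmem
  obtain ⟨A, B, hAB⟩ := hmem
  let e : {i // i ∈ E} → I := Subtype.val
  let s : S → I := Subtype.val
  have he : Function.Injective e := Subtype.val_injective
  have hev : ∀ p : MvPolynomial {i // i ∈ E} C,
      MvPolynomial.aeval (fun i : {i // i ∈ E} => lam i) p
        = MvPolynomial.aeval lam (MvPolynomial.rename e p) := by
    intro p; rw [MvPolynomial.aeval_rename]; rfl
  have hsv : ∀ p : MvPolynomial S C,
      MvPolynomial.aeval (fun i : S => lam i) p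
        = MvPolynomial.aeval lam (MvPolynomial.rename s p) := by
    intro p; rw [MvPolynomial.aeval_rename]; rfl
  have hinj : Function.Injective (MvPolynomial.aeval (R := C) lam) := hind
  have hre := MvPolynomial.rename_injective (R := C) e he
  have key : MvPolynomial.pderiv ⟨i, hiE⟩ P * Q = P * MvPolynomial.pderiv ⟨i, hiE⟩ Q := by
    have hQ0 : MvPolynomial.aeval lam (MvPolynomial.rename e Q) ≠ 0 := by
      rw [Ne, map_eq_zero_iff _ hinj, map_eq_zero_iff _ hre]; exact hQ
    rw [hu, hev, hev, hsv, hsv] at hAB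
    by_cases hB : MvPolynomial.aeval lam (MvPolynomial.rename s B) = 0
    · rw [hB, div_zero, div_eq_zero_iff, or_iff_left hQ0, map_eq_zero_iff _ hinj,
        map_eq_zero_iff _ hre] at hAB
      simp [hAB]
    · rw [div_eq_div_iff hQ0 hB, ← map_mul, ← map_mul] at hAB
      have h1 := hinj hAB
      have hB' : MvPolynomial.rename s B ≠ 0 := fun h => hB (by rw [h, map_zero])
      have h2 := congrArg (MvPolynomial.pderiv i) h1
      have hs0 : ∀ p : MvPolynomial S C, MvPolynomial.pderiv i (MvPolynomial.rename s p) = 0 :=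
        pderiv_rename_zero_aux s i (fun j hj => hiS (hj ▸ j.2))
      have her : ∀ p : MvPolynomial {i // i ∈ E} C, MvPolynomial.pderiv i (MvPolynomial.rename e p)
          = MvPolynomial.rename e (MvPolynomial.pderiv ⟨i, hiE⟩ p) :=
        pderiv_rename_aux e he ⟨i, hiE⟩
      simp only [Derivation.leibniz, hs0, her, smul_eq_mul, mul_zero, zero_add, add_zero] at h2
      apply hre
      apply mul_right_cancel₀ hB'
      simp only [map_mul]
      linear_combination (MvPolynomial.rename e Q) * h2
        - (MvPolynomial.rename e (MvPolynomial.pderiv (⟨i, hiE⟩ : {i // i ∈ E}) Q)) * h1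
  have hdvd : Q ∣ MvPolynomial.pderiv ⟨i, hiE⟩ Q :=
    hPQ.symm.dvd_of_dvd_mul_left (Dvd.intro_left _ key)
  have hQz : MvPolynomial.pderiv ⟨i, hiE⟩ Q = 0 := by
    by_contra hne
    have hlt := totalDegree_pderiv_lt_aux _ _ hne
    obtain ⟨R, hR⟩ := hdvd
    have hR0 : R ≠ 0 := by
      rintro rfl; exact hne (by rw [hR, mul_zero])
    rw [hR, MvPolynomial.totalDegree_mul_of_isDomain hQ hR0] at hlt
    omega
  have hPz : MvPolynomial.pderiv ⟨i, hiE⟩ P = 0 := by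
    rw [hQz, mul_zero] at key
    exact (mul_eq_zero.mp key).resolve_right hQ
  exact (hess ⟨i, hiE⟩).elim (fun h => h hPz) (fun h => h hQz)
end
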